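/- arXiv:2501.12606 — 14 statements merged into one kernel-verified Lean document; each statement's English description precedes it below -/
import Mathlib

section
/- Let ρ₀ > 0 and let h : [ρ₀, ∞) → ℝ be continuous with h(ρ) → 0 as ρ → ∞. Suppose u is a solution of u'' = q u on [ρ₀, ∞), where q(ρ) = ρ⁻² · (−1/4 + h(ρ)), and u is square-integrable on [ρ₀, ∞). Then u is identically zero on [ρ₀, ∞). -/
open Set MeasureTheory Filter

/-- The first-order form of the Euler-type equation `t² u'' = (-1/4 + h) u`, in terms of `u` and
`w = t u' - u / 2`. -/
theorem euler_hasDerivWithinAt {s : Set ℝ} {t k : ℝ} {u u' : ℝ → ℝ} (ht : 0 < t)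
    (hu : HasDerivWithinAt u (u' t) s t)
    (hu' : HasDerivWithinAt u' ((t ^ 2)⁻¹ * (-(1/4) + k) * u t) s t) :
    HasDerivWithinAt (fun x => x * u' x - u x / 2)
      (((t * u' t - u t / 2) / 2 + k * u t) / t) s t := by
  have := ((hasDerivWithinAt_id t s).mul hu').sub (hu.div_const 2)
  refine this.congr_deriv ?_
  simp only [id]
  field_simp
  ring

/-- Growth estimate for the energy `u² + w²` of the system `t u' = u / 2 + w`,
`t w' = w / 2 + h u` with `|h| ≤ M`. -/
theorem monotoneOn_energy_mul_exp {a b M : ℝ} {h u w : ℝ → ℝ} (ha : 0 < a)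
    (hM : ∀ t ∈ Icc a b, |h t| ≤ M)
    (hu : ∀ t ∈ Icc a b, HasDerivWithinAt u ((u t / 2 + w t) / t) (Icc a b) t)
    (hw : ∀ t ∈ Icc a b, HasDerivWithinAt w ((w t / 2 + h t * u t) / t) (Icc a b) t) :
    MonotoneOn (fun t => (u t ^ 2 + w t ^ 2) * Real.exp (M * Real.log t)) (Icc a b) := by
  have hd : ∀ t ∈ Icc a b, HasDerivWithinAt
      (fun t => (u t ^ 2 + w t ^ 2) * Real.exp (M * Real.log t))
      (Real.exp (M * Real.log t) / t *
        ((1 + M) * (u t ^ 2 + w t ^ 2) + 2 * (1 + h t) * (u t * w t))) (Icc a b) t := by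
    intro t ht
    have ht0 : t ≠ 0 := (ha.trans_le ht.1).ne'
    have hexp := (((Real.hasDerivAt_log ht0).const_mul M).exp).hasDerivWithinAt (s := Icc a b)
    refine ((((hu t ht).pow 2).add ((hw t ht).pow 2)).mul hexp).congr_deriv ?_
    simp only [Pi.add_apply, Pi.pow_apply]
    field_simp
    ring
  refine monotoneOn_of_hasDerivWithinAt_nonneg (convex_Icc a b)
    (fun t ht => (hd t ht).continuousWithinAt)
    (fun t ht => (hd t (interior_subset ht)).mono interior_subset) ?_
  intro t ht
  have ht := interior_subset ht
  have ht0 : 0 < t := ha.trans_le ht.1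
  refine mul_nonneg (by positivity) ?_
  obtain ⟨h1, h2⟩ := abs_le.1 (hM t ht)
  have hM0 : 0 ≤ M := (abs_nonneg _).trans (hM t ht)
  rcases le_total 0 (1 + h t) with hh | hh
  · nlinarith [mul_nonneg hh (sq_nonneg (u t + w t)), sq_nonneg (u t), sq_nonneg (w t),
      mul_nonneg (sub_nonneg.2 h2) (add_nonneg (sq_nonneg (u t)) (sq_nonneg (w t)))]
  · nlinarith [mul_nonneg (neg_nonneg.2 hh) (sq_nonneg (u t - w t)),
      mul_nonneg (by linarith : 0 ≤ M + h t + 2)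
        (add_nonneg (sq_nonneg (u t)) (sq_nonneg (w t)))]

/-- A function that is nondecreasing and integrable on a half-line is nowhere positive there. -/
theorem MonotoneOn.nonpos_of_integrableOn_Ici {f : ℝ → ℝ} {a : ℝ} (hf : MonotoneOn f (Ici a))
    (hint : IntegrableOn f (Ici a)) : f a ≤ 0 := by
  by_contra! hpos
  have hconst : IntegrableOn (fun _ : ℝ => f a) (Ici a) := by
    refine Integrable.mono' hint aestronglyMeasurable_const ?_
    filter_upwards [ae_restrict_mem measurableSet_Ici] with x hx
    rw [Real.norm_of_nonneg hpos.le]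
    exact hf self_mem_Ici hx hx
  rw [integrableOn_const_iff] at hconst
  simp [hpos.ne'] at hconst

/-- If `|h| ≤ 1`, a square-integrable solution component `u` of the system `t u' = u / 2 + w`,
`t w' = w / 2 + h u` forces the initial energy to vanish. -/
theorem energy_nonpos_of_integrableOn_sq {T : ℝ} {h u w : ℝ → ℝ} (hT : 0 < T)
    (hM : ∀ t ∈ Ici T, |h t| ≤ 1)
    (hu : ∀ t ∈ Ici T, HasDerivAt u ((u t / 2 + w t) / t) t)
    (hw : ∀ t ∈ Ici T, HasDerivAt w ((w t / 2 + h t * u t) / t) t)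
    (hL2 : IntegrableOn (fun t => u t ^ 2) (Ici T)) :
    u T ^ 2 + w T ^ 2 ≤ 0 := by
  by_contra! hE
  set c := (u T ^ 2 + w T ^ 2) * T
  have hc0 : 0 < c := mul_pos hE hT
  have hlow : ∀ t ∈ Ici T, c ≤ (u t ^ 2 + w t ^ 2) * t := by
    intro t ht
    have := monotoneOn_energy_mul_exp (b := t) hT (fun s hs => hM s hs.1)
      (fun s hs => (hu s hs.1).hasDerivWithinAt) (fun s hs => (hw s hs.1).hasDerivWithinAt)
      (left_mem_Icc.2 ht) (right_mem_Icc.2 ht) ht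
    simpa only [one_mul, Real.exp_log hT, Real.exp_log (hT.trans_le ht)] using this
  have hcont : ContinuousOn (fun t => u t ^ 2) (Ici T) :=
    fun t ht => ((hu t ht).continuousAt.pow 2).continuousWithinAt
  set I := ∫ t in Ici T, u t ^ 2
  have hprim : ∀ t ∈ Ici T, ∫ s in T..t, u s ^ 2 ≤ I := by
    intro t ht
    rw [intervalIntegral.integral_of_le ht]
    exact setIntegral_mono_set hL2 (Eventually.of_forall fun s => sq_nonneg (u s))
      (Eventually.of_forall fun s hs => hs.1.le)
  have hmono : MonotoneOn
      (fun t => t * (u t * w t) + 4 * (∫ s in T..t, u s ^ 2) - c / 2 * Real.log t) (Ici T) := by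
    have hint : ∀ t ∈ Ici T, IntervalIntegrable (fun s => u s ^ 2) volume T t := fun t ht =>
      (hcont.mono (by rw [uIcc_of_le ht]; exact Icc_subset_Ici_self)).intervalIntegrable
    have hd : ∀ t ∈ interior (Ici T), HasDerivAt
        (fun t => t * (u t * w t) + 4 * (∫ s in T..t, u s ^ 2) - c / 2 * Real.log t)
        (2 * (u t * w t) + h t * u t ^ 2 + w t ^ 2 + 4 * u t ^ 2 - c / 2 / t) t := by
      intro t ht
      have htT := interior_subset ht
      have ht0 : t ≠ 0 := (hT.trans_le htT).ne'
      have hmeas : StronglyMeasurableAtFilter (fun s => u s ^ 2) (nhds t) :=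
        ⟨Ici T, mem_interior_iff_mem_nhds.1 ht, hcont.aestronglyMeasurable measurableSet_Ici⟩
      have hp := intervalIntegral.integral_hasDerivAt_right (hint t htT) hmeas
        ((hu t htT).continuousAt.pow 2)
      refine ((((hasDerivAt_id t).mul ((hu t htT).mul (hw t htT))).add (hp.const_mul 4)).sub
        ((Real.hasDerivAt_log ht0).const_mul (c / 2))).congr_deriv ?_
      simp only [id, Pi.mul_apply]
      field_simp
      ring
    have hpc : ContinuousOn (fun t => ∫ s in T..t, u s ^ 2) (Ici T) := by
      intro t ht
      have hI := intervalIntegral.continuousOn_primitive_interval (f := fun s => u s ^ 2)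
        (μ := volume) (a := T) (b := t + 1) (hL2.mono_set (by
          rw [uIcc_of_le (le_add_of_le_of_nonneg ht zero_le_one)]; exact Icc_subset_Ici_self))
      rw [uIcc_of_le (le_add_of_le_of_nonneg ht zero_le_one)] at hI
      refine (hI t ⟨ht, by linarith⟩).mono_of_mem_nhdsWithin ?_
      rw [← Ici_inter_Iic]
      exact inter_mem self_mem_nhdsWithin
        (mem_nhdsWithin_of_mem_nhds (Iic_mem_nhds (by linarith)))
    refine monotoneOn_of_hasDerivWithinAt_nonneg (convex_Ici T) ?_
      (fun t ht => (hd t ht).hasDerivWithinAt) ?_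
    · refine ((continuousOn_id.mul ?_).add (continuousOn_const.mul hpc)).sub
        (continuousOn_const.mul ?_)
      · exact fun t ht =>
          ((hu t ht).continuousAt.mul (hw t ht).continuousAt).continuousWithinAt
      · exact fun t ht =>
          (Real.continuousAt_log (hT.trans_le ht).ne').continuousWithinAt
    · intro t ht
      have htT := interior_subset ht
      have ht0 : 0 < t := hT.trans_le htT
      have h1 : c / 2 / t ≤ (u t ^ 2 + w t ^ 2) / 2 := by
        rw [div_le_iff₀ ht0]
        linarith [hlow t htT]
      nlinarith [(abs_le.1 (hM t htT)).1, sq_nonneg (2 * u t + w t), sq_nonneg (u t)]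
  have hlog : Tendsto (fun t => c / 2 * Real.log t) atTop atTop :=
    Real.tendsto_log_atTop.const_mul_atTop (half_pos hc0)
  obtain ⟨N, hN⟩ := eventually_atTop.1
    (hlog.eventually_gt_atTop (4 * I + c / 2 * Real.log T - T * (u T * w T)))
  have hTS : T ≤ max T N := le_max_left T N
  have hpos : ∀ t ∈ Ici (max T N), 0 < u t * w t := by
    intro t ht
    have htT : T ≤ t := hTS.trans ht
    have h1 := hmono self_mem_Ici htT htT
    simp only [intervalIntegral.integral_same] at h1
    have h2 := hN t ((le_max_right T N).trans ht)
    have h3 := hprim t htT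
    exact pos_of_mul_pos_right (by linarith : 0 < t * (u t * w t)) (hT.trans_le htT).le
  have husq : MonotoneOn (fun t => u t ^ 2) (Ici (max T N)) := by
    refine monotoneOn_of_hasDerivWithinAt_nonneg (convex_Ici _)
      (hcont.mono (Ici_subset_Ici.2 hTS))
      (fun t ht => ((hu t (hTS.trans (interior_subset ht))).pow 2).hasDerivWithinAt) ?_
    intro t ht
    have ht := interior_subset ht
    have ht0 : 0 < t := hT.trans_le (hTS.trans ht)
    have hrw : (2 : ℕ) * u t ^ (2 - 1) * ((u t / 2 + w t) / t) = (u t ^ 2 + 2 * (u t * w t)) / t := by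
      push_cast
      ring
    rw [hrw]
    exact div_nonneg (by nlinarith [hpos t ht, sq_nonneg (u t)]) ht0.le
  have hle := husq.nonpos_of_integrableOn_Ici (hL2.mono_set (Ici_subset_Ici.2 hTS))
  have hu0 : u (max T N) = 0 := pow_eq_zero_iff two_ne_zero |>.1 (le_antisymm hle (sq_nonneg _))
  have := hpos _ self_mem_Ici
  simp [hu0] at this

/-- Let ρ₀ > 0 and let h : [ρ₀, ∞) → ℝ be continuous with h(ρ) → 0 as ρ → ∞.
Suppose u is a solution of u'' = q u on [ρ₀, ∞), where q(ρ) = ρ⁻² · (−1/4 + h(ρ)), and u is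
square-integrable on [ρ₀, ∞). Then u is identically zero on [ρ₀, ∞). -/
theorem stmt_0 (ρ₀ : ℝ) (hρ₀ : 0 < ρ₀) (h u u' : ℝ → ℝ)
    (hcont : ContinuousOn h (Ici ρ₀))
    (hlim : Tendsto h atTop (nhds 0))
    (hu : ∀ t ∈ Ici ρ₀, HasDerivWithinAt u (u' t) (Ici ρ₀) t)
    (hu'cont : ContinuousOn u' (Ici ρ₀))
    (hu' : ∀ t ∈ Ici ρ₀, HasDerivWithinAt u' ((t ^ 2)⁻¹ * (-(1/4) + h t) * u t) (Ici ρ₀) t)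
    (hL2 : IntegrableOn (fun ρ => u ρ ^ 2) (Ici ρ₀)) :
    ∀ t ∈ Ici ρ₀, u t = 0 := by
  intro t ht
  by_contra hne
  obtain ⟨N, hN⟩ := eventually_atTop.1 (Metric.tendsto_nhds.1 hlim 1 one_pos)
  set T := max (t + 1) N
  have htT : t < T := (lt_add_one t).trans_le (le_max_left _ _)
  have hρT : ρ₀ < T := lt_of_le_of_lt ht htT
  have ht0 : 0 < t := hρ₀.trans_le ht
  have hw : ∀ s ∈ Ici ρ₀, HasDerivWithinAt (fun x => x * u' x - u x / 2)
      (((s * u' s - u s / 2) / 2 + h s * u s) / s) (Ici ρ₀) s := fun s hs =>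
    euler_hasDerivWithinAt (hρ₀.trans_le hs) (hu s hs) (hu' s hs)
  have hu₁ : ∀ s ∈ Ici ρ₀,
      HasDerivWithinAt u ((u s / 2 + (s * u' s - u s / 2)) / s) (Ici ρ₀) s := by
    intro s hs
    have hs0 : s ≠ 0 := (hρ₀.trans_le hs).ne'
    refine (hu s hs).congr_deriv ?_
    field_simp
    ring
  have hsub : Icc t T ⊆ Ici ρ₀ := fun s hs => le_trans ht hs.1
  obtain ⟨M, hM⟩ := isCompact_Icc.exists_bound_of_continuousOn (hcont.mono hsub)
  have hmono := monotoneOn_energy_mul_exp ht0 hM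
    (fun s hs => (hu₁ s (hsub hs)).mono hsub) (fun s hs => (hw s (hsub hs)).mono hsub)
    (left_mem_Icc.2 htT.le) (right_mem_Icc.2 htT.le) htT.le
  have hE := energy_nonpos_of_integrableOn_sq (ht0.trans htT)
    (fun s hs => by
      simpa [Real.dist_eq] using (hN s ((le_max_right _ _).trans hs)).le)
    (fun s hs => (hu₁ s (hρT.le.trans hs)).hasDerivAt (Ici_mem_nhds (hρT.trans_le hs)))
    (fun s hs => (hw s (hρT.le.trans hs)).hasDerivAt (Ici_mem_nhds (hρT.trans_le hs)))
    (hL2.mono_set (Ici_subset_Ici.2 hρT.le))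
  have hEt : 0 < u t ^ 2 + (t * u' t - u t / 2) ^ 2 := by positivity
  have hpos := mul_pos hEt (Real.exp_pos (M * Real.log t))
  exact absurd (hpos.trans_le hmono)
    (not_lt.2 (mul_nonpos_of_nonpos_of_nonneg hE (Real.exp_pos _).le))
end

section
/- Let ρ₁ > 0 and α ∈ (1, 2). Let u : [ρ₁, ∞) → ℝ be continuously differentiable and suppose there is a constant C₀ such that |u(ρ)| ≤ C₀ ρ^(−1/2) for all ρ ≥ ρ₁. Then ((α − 1)²/4) · ∫_{ρ₁}^∞ ρ^(α−2) u(ρ)² dρ ≤ ∫_{ρ₁}^∞ ρ^α u'(ρ)² dρ, where both sides are Lebesgue integrals with values in [0, ∞]. -/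
open Set MeasureTheory

/-- Hardy's inequality on a bounded interval, with the boundary term at the right endpoint. -/
theorem hardy_intervalIntegral_le {a R α : ℝ} (ha : 0 < a) (haR : a ≤ R) (hα : 1 ≤ α)
    {u u' : ℝ → ℝ} (hu : ∀ t ∈ Ici a, HasDerivWithinAt u (u' t) (Ici a) t)
    (hu' : ContinuousOn u' (Ici a)) :
    (α - 1) ^ 2 / 4 * ∫ x in a..R, x ^ (α - 2) * u x ^ 2 ≤
      (∫ x in a..R, x ^ α * u' x ^ 2) + (α - 1) / 2 * (R ^ (α - 1) * u R ^ 2) := by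
  have hpos : ∀ x ∈ Icc a R, 0 < x := fun x hx => ha.trans_le hx.1
  have hcu : ContinuousOn u (Icc a R) :=
    (show ContinuousOn u (Ici a) from fun t ht => (hu t ht).continuousWithinAt).mono
      Icc_subset_Ici_self
  have hcu' : ContinuousOn u' (Icc a R) := hu'.mono Icc_subset_Ici_self
  have hpow : ∀ p : ℝ, ContinuousOn (fun x : ℝ => x ^ p) (Icc a R) := fun p =>
    continuousOn_id.rpow_const fun x hx => Or.inl (hpos x hx).ne'
  have hf : IntervalIntegrable (fun x => x ^ (α - 2) * u x ^ 2) volume a R :=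
    ((hpow _).mul (hcu.pow 2)).intervalIntegrable_of_Icc haR
  have hg : IntervalIntegrable (fun x => x ^ α * u' x ^ 2) volume a R :=
    ((hpow _).mul (hcu'.pow 2)).intervalIntegrable_of_Icc haR
  have hG' : IntervalIntegrable (fun x => (α - 1) * x ^ (α - 2) * u x ^ 2 +
      x ^ (α - 1) * (2 * u x * u' x)) volume a R :=
    (((continuousOn_const.mul (hpow _)).mul (hcu.pow 2)).add
      ((hpow _).mul ((continuousOn_const.mul hcu).mul hcu'))).intervalIntegrable_of_Icc haR
  have hFTC := intervalIntegral.integral_eq_sub_of_hasDeriv_right_of_le haR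
    (f := fun x => x ^ (α - 1) * u x ^ 2) ((hpow _).mul (hcu.pow 2))
    (fun x hx => by
      have hx0 : 0 < x := ha.trans hx.1
      have h1 : HasDerivWithinAt (fun y : ℝ => y ^ (α - 1)) ((α - 1) * x ^ (α - 2)) (Ioi x) x := by
        have := (Real.hasDerivAt_rpow_const (p := α - 1) (Or.inl hx0.ne')).hasDerivWithinAt
          (s := Ioi x)
        rwa [show α - 1 - 1 = α - 2 by ring] at this
      have h2 : HasDerivWithinAt u (u' x) (Ioi x) x :=
        (hu x hx.1.le).mono fun y hy => hx.1.le.trans (le_of_lt hy)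
      exact (h1.mul (h2.pow 2)).congr_deriv (by simp)) hG'
  have hmono := intervalIntegral.integral_mono_on haR
    ((hf.const_mul ((α - 1) ^ 2 / 4)).sub (hG'.const_mul ((α - 1) / 2))) hg
    (fun x hx => by
      have hx0 := hpos x hx
      have e1 : x ^ (α - 1) = x ^ (α - 2) * x := by
        rw [← Real.rpow_add_one hx0.ne']; ring_nf
      have e2 : x ^ α = x ^ (α - 2) * x ^ 2 := by
        rw [← Real.rpow_natCast x 2, ← Real.rpow_add hx0]; norm_num
      have h0 : 0 ≤ x ^ (α - 2) * (x * u' x + (α - 1) / 2 * u x) ^ 2 := by positivity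
      rw [e1, e2]
      linarith)
  rw [intervalIntegral.integral_sub (hf.const_mul _) (hG'.const_mul _),
    intervalIntegral.integral_const_mul, intervalIntegral.integral_const_mul, hFTC] at hmono
  have h0 : 0 ≤ (α - 1) / 2 * (a ^ (α - 1) * u a ^ 2) :=
    mul_nonneg (by linarith) (by positivity)
  linarith

/-- Hardy-type inequality: for ρ₁ > 0, α ∈ (1,2), and u continuously
differentiable on [ρ₁, ∞) with |u(ρ)| ≤ C₀ ρ^(−1/2),
((α − 1)²/4) ∫_{ρ₁}^∞ ρ^(α−2) u² ≤ ∫_{ρ₁}^∞ ρ^α (u')² (Lebesgue integrals in [0,∞]). -/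
theorem stmt_1 (ρ₁ α : ℝ) (hρ₁ : 0 < ρ₁) (hα : α ∈ Ioo (1 : ℝ) 2)
    (u u' : ℝ → ℝ) (C₀ : ℝ)
    (hu : ∀ t ∈ Ici ρ₁, HasDerivWithinAt u (u' t) (Ici ρ₁) t)
    (hu'cont : ContinuousOn u' (Ici ρ₁))
    (hbound : ∀ ρ ∈ Ici ρ₁, |u ρ| ≤ C₀ * ρ ^ (-(1/2) : ℝ)) :
    ENNReal.ofReal ((α - 1) ^ 2 / 4) *
        ∫⁻ ρ in Ici ρ₁, ENNReal.ofReal (ρ ^ (α - 2) * u ρ ^ 2)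
      ≤ ∫⁻ ρ in Ici ρ₁, ENNReal.ofReal (ρ ^ α * u' ρ ^ 2) := by
  obtain ⟨hα1, hα2⟩ := hα
  have hcu : ContinuousOn u (Ici ρ₁) := fun t ht => (hu t ht).continuousWithinAt
  have hpow : ∀ p : ℝ, ContinuousOn (fun x : ℝ => x ^ p) (Ici ρ₁) := fun p =>
    continuousOn_id.rpow_const fun x hx => Or.inl (hρ₁.trans_le hx).ne'
  have hf : ContinuousOn (fun x => x ^ (α - 2) * u x ^ 2) (Ici ρ₁) := (hpow _).mul (hcu.pow 2)
  have hg : ContinuousOn (fun x => x ^ α * u' x ^ 2) (Ici ρ₁) := (hpow _).mul (hu'cont.pow 2)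
  have hconv : ∀ (p : ℝ) (v : ℝ → ℝ), ContinuousOn (fun x => x ^ p * v x ^ 2) (Ici ρ₁) →
      ∀ R, ρ₁ ≤ R → ∫⁻ x in Ioc ρ₁ R, ENNReal.ofReal (x ^ p * v x ^ 2) =
        ENNReal.ofReal (∫ x in ρ₁..R, x ^ p * v x ^ 2) := fun p v hv R hR => by
    rw [intervalIntegral.integral_of_le hR, ofReal_integral_eq_lintegral_ofReal]
    · exact ((hv.mono Icc_subset_Ici_self).intervalIntegrable_of_Icc hR).1
    · filter_upwards [ae_restrict_mem measurableSet_Ioc] with x hx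
      have : 0 < x := hρ₁.trans hx.1
      simp only [Pi.zero_apply]
      positivity
  have hle : ∀ R, ρ₁ ≤ R → ENNReal.ofReal ((α - 1) ^ 2 / 4) *
      ∫⁻ x in Ioc ρ₁ R, ENNReal.ofReal (x ^ (α - 2) * u x ^ 2) ≤
        (∫⁻ x in Ici ρ₁, ENNReal.ofReal (x ^ α * u' x ^ 2)) +
          ENNReal.ofReal ((α - 1) / 2 * C₀ ^ 2 * R ^ (-(2 - α))) := fun R hR => by
    have hR0 : 0 < R := hρ₁.trans_le hR
    have hbdry : R ^ (α - 1) * u R ^ 2 ≤ C₀ ^ 2 * R ^ (-(2 - α)) := by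
      have h1 : u R ^ 2 ≤ (C₀ * R ^ (-(1/2) : ℝ)) ^ 2 :=
        sq_le_sq' (by linarith [neg_abs_le (u R), hbound R hR])
          ((le_abs_self _).trans (hbound R hR))
      have h2 : (R ^ (-(1/2) : ℝ)) ^ 2 = R ^ (-1 : ℝ) := by
        rw [← Real.rpow_natCast, ← Real.rpow_mul hR0.le]; norm_num
      have h3 : R ^ (-(2 - α)) = R ^ (α - 1) * R ^ (-1 : ℝ) := by
        rw [← Real.rpow_add hR0]; ring_nf
      rw [mul_pow, h2] at h1
      rw [h3]
      calc R ^ (α - 1) * u R ^ 2 ≤ R ^ (α - 1) * (C₀ ^ 2 * R ^ (-1 : ℝ)) := by gcongr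
        _ = _ := by ring
    have hmain := hardy_intervalIntegral_le hρ₁ hR hα1.le hu hu'cont
    have hb := mul_le_mul_of_nonneg_left hbdry (show 0 ≤ (α - 1) / 2 by linarith)
    calc _ = ENNReal.ofReal ((α - 1) ^ 2 / 4 * ∫ x in ρ₁..R, x ^ (α - 2) * u x ^ 2) := by
          rw [hconv _ _ hf R hR, ENNReal.ofReal_mul (by positivity)]
      _ ≤ ENNReal.ofReal ((∫ x in ρ₁..R, x ^ α * u' x ^ 2) +
          (α - 1) / 2 * C₀ ^ 2 * R ^ (-(2 - α))) := ENNReal.ofReal_le_ofReal (by linarith)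
      _ ≤ _ := ENNReal.ofReal_add_le
      _ ≤ _ := by
          rw [← hconv _ _ hg R hR]
          gcongr
          exact fun x hx => hx.1.le
  have hlim : Filter.Tendsto
      (fun R => ∫⁻ x in Ioc ρ₁ R, ENNReal.ofReal (x ^ (α - 2) * u x ^ 2)) Filter.atTop
      (nhds (∫⁻ x in Ici ρ₁, ENNReal.ofReal (x ^ (α - 2) * u x ^ 2))) := by
    have hm : AEMeasurable (fun x => ENNReal.ofReal (x ^ (α - 2) * u x ^ 2))
        (volume.restrict (Ioi ρ₁)) :=
      ((hf.mono Ioi_subset_Ici_self).aemeasurable measurableSet_Ioi).ennreal_ofReal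
    have := (aecover_Iic (μ := volume.restrict (Ioi ρ₁))
      Filter.tendsto_id).lintegral_tendsto_of_countably_generated hm
    simp only [id, Measure.restrict_restrict measurableSet_Iic, Iic_inter_Ioi] at this
    rwa [← restrict_Ioi_eq_restrict_Ici]
  have hrem : Filter.Tendsto (fun R : ℝ => ENNReal.ofReal ((α - 1) / 2 * C₀ ^ 2 * R ^ (-(2 - α))))
      Filter.atTop (nhds 0) := by
    have := ENNReal.tendsto_ofReal
      ((tendsto_rpow_neg_atTop (show 0 < 2 - α by linarith)).const_mul ((α - 1) / 2 * C₀ ^ 2))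
    simpa using this
  have hrhs := hrem.const_add (∫⁻ x in Ici ρ₁, ENNReal.ofReal (x ^ α * u' x ^ 2))
  rw [add_zero] at hrhs
  exact le_of_tendsto_of_tendsto
    (ENNReal.Tendsto.const_mul hlim (Or.inr ENNReal.ofReal_ne_top)) hrhs
    ((Filter.eventually_ge_atTop ρ₁).mono hle)
end

section
/- Let ρ₀ ≥ 1 and let h : [ρ₀, ∞) → ℝ be continuous and bounded. Suppose u is a solution of u'' = q u on [ρ₀, ∞), where q(ρ) = ρ⁻² · (−1/4 + h(ρ)), and u is square-integrable on [ρ₀, ∞). Then there exists a constant C such that |u'(ρ)| ≤ C ρ^(−3/2) and |u(ρ)| ≤ C ρ^(−1/2) for all ρ ≥ ρ₀. -/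
open Set MeasureTheory

/-- The scale-invariant energy `u² + t² u'²` of a solution of `u'' = q u` with `|t² q| ≤ K` decays
at most polynomially. -/
lemma monotoneOn_pow_mul_energy {a K : ℝ} {n : ℕ} {u u' q : ℝ → ℝ} (ha : 0 < a)
    (hn : 1 + K ≤ n) (hq : ∀ t ∈ Ioi a, |t ^ 2 * q t| ≤ K)
    (hcu : ContinuousOn u (Ici a)) (hcu' : ContinuousOn u' (Ici a))
    (hu : ∀ t ∈ Ioi a, HasDerivAt u (u' t) t)
    (hu' : ∀ t ∈ Ioi a, HasDerivAt u' (q t * u t) t) :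
    MonotoneOn (fun t => t ^ n * (u t ^ 2 + t ^ 2 * u' t ^ 2)) (Ici a) := by
  refine monotoneOn_of_hasDerivWithinAt_nonneg (convex_Ici a) (by fun_prop)
    (f' := fun t => n * t ^ (n - 1) * (u t ^ 2 + t ^ 2 * u' t ^ 2) +
      t ^ n * (2 * u t * u' t + (2 * t * u' t ^ 2 + t ^ 2 * (2 * u' t * (q t * u t))))) ?_ ?_
  · intro t ht
    rw [interior_Ici] at ht
    have h1 := (hasDerivAt_pow n t).mul
      (((hu t ht).pow 2).add ((hasDerivAt_pow 2 t).mul ((hu' t ht).pow 2)))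
    refine (h1.congr_deriv ?_).hasDerivWithinAt
    simp
  · intro t ht
    rw [interior_Ici] at ht
    have ht0 : 0 < t := ha.trans ht
    have hp := abs_le.1 (hq t ht)
    have key : 0 ≤ n * (u t ^ 2 + (t * u' t) ^ 2) + 2 * (1 + t ^ 2 * q t) * u t * (t * u' t)
        + 2 * (t * u' t) ^ 2 := by
      generalize t ^ 2 * q t = p at hp
      generalize t * u' t = y
      generalize u t = x
      nlinarith [mul_nonneg (sub_nonneg.2 hn) (add_nonneg (sq_nonneg x) (sq_nonneg y)),
        mul_nonneg (show 0 ≤ K - p by linarith) (sq_nonneg (x - y)),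
        mul_nonneg (show 0 ≤ K + p by linarith) (sq_nonneg (x + y)),
        sq_nonneg (x + y), sq_nonneg y]
    have hn0 : n ≠ 0 := by
      rintro rfl
      have := (abs_nonneg _).trans (hq t ht)
      norm_num at hn
      linarith
    have hpow : t ^ n = t ^ (n - 1) * t := (pow_sub_one_mul hn0 t).symm
    have := mul_nonneg (pow_nonneg ht0.le (n - 1)) key
    refine this.trans_eq ?_
    rw [hpow]
    ring

/-- Caccioppoli-type estimate on `[R, 2R]`: a lower bound for the energy on this interval forces a
lower bound for the growth of any primitive `U` of `u²`. -/
lemma energy_le_of_primitive {R K e : ℝ} {u u' q U : ℝ → ℝ} (hR : 0 < R) (hK : 0 ≤ K)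
    (hq : ∀ t ∈ Ioo R (2 * R), |t ^ 2 * q t| ≤ K)
    (hcu : ContinuousOn u (Icc R (2 * R))) (hcu' : ContinuousOn u' (Icc R (2 * R)))
    (hcU : ContinuousOn U (Icc R (2 * R)))
    (hu : ∀ t ∈ Ioo R (2 * R), HasDerivAt u (u' t) t)
    (hu' : ∀ t ∈ Ioo R (2 * R), HasDerivAt u' (q t * u t) t)
    (hU : ∀ t ∈ Ioo R (2 * R), HasDerivAt U (u t ^ 2) t)
    (he : ∀ t ∈ Ioo R (2 * R), e ≤ u t ^ 2 + t ^ 2 * u' t ^ 2) :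
    e * R ≤ 60 * (4 + 2 * K) * (U (2 * R) - U R) := by
  have hmono : MonotoneOn (fun t => ((t - R) * (2 * R - t)) ^ 2 * (2 * u t * u' t)
      - (2 * ((t - R) * (2 * R - t)) * (3 * R - 2 * t)) * u t ^ 2
      - e / (2 * R ^ 2) * (R ^ 2 * (t - R) ^ 3 / 3 - R * (t - R) ^ 4 / 2 + (t - R) ^ 5 / 5)
      + (4 + 2 * K) * R ^ 2 * U t) (Icc R (2 * R)) := by
    refine monotoneOn_of_hasDerivWithinAt_nonneg (convex_Icc _ _) (by fun_prop)
      (f' := fun t => ((t - R) * (2 * R - t)) ^ 2 * (2 * u' t ^ 2 + 2 * q t * u t ^ 2)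
        - (2 * (3 * R - 2 * t) ^ 2 - 4 * ((t - R) * (2 * R - t))) * u t ^ 2
        - e / (2 * R ^ 2) * ((t - R) * (2 * R - t)) ^ 2 + (4 + 2 * K) * R ^ 2 * u t ^ 2) ?_ ?_
    · intro t ht
      rw [interior_Icc] at ht
      have hs : HasDerivAt (fun t => t - R) 1 t := (hasDerivAt_id t).sub_const R
      have hs' : HasDerivAt (fun t => 2 * R - t) (-1) t := (hasDerivAt_id t).const_sub (2 * R)
      have hl : HasDerivAt (fun t => 3 * R - 2 * t) (-(2 * 1)) t :=
        ((hasDerivAt_id t).const_mul 2).const_sub (3 * R)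
      have h1 := (((((hs.mul hs').pow 2).mul (((hu t ht).const_mul 2).mul (hu' t ht))).sub
        ((((hs.mul hs').const_mul 2).mul hl).mul ((hu t ht).pow 2))).sub
        ((((((hs.pow 3).const_mul (R ^ 2)).div_const 3).sub
          (((hs.pow 4).const_mul R).div_const 2)).add ((hs.pow 5).div_const 5)).const_mul
          (e / (2 * R ^ 2)))).add ((hU t ht).const_mul ((4 + 2 * K) * R ^ 2))
      refine (h1.congr_deriv ?_).hasDerivWithinAt
      simp
      ring
    · intro t ht
      rw [interior_Icc] at ht
      have ht0 : 0 < t := hR.trans ht.1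
      have hp := (abs_le.1 (hq t ht)).1
      have het := he t ht
      obtain ⟨h1, h2⟩ := ht
      have hφ0 : 0 ≤ (t - R) * (2 * R - t) := mul_nonneg (by linarith) (by linarith)
      have hφ1 : (t - R) * (2 * R - t) ≤ R ^ 2 := by nlinarith
      have hψ : 2 * (3 * R - 2 * t) ^ 2 - 4 * ((t - R) * (2 * R - t)) ≤ 2 * R ^ 2 := by nlinarith
      generalize 2 * (3 * R - 2 * t) ^ 2 - 4 * ((t - R) * (2 * R - t)) = ψ at *
      generalize (t - R) * (2 * R - t) = φ at *
      have hqK : -(K / R ^ 2) ≤ q t := by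
        have : R ^ 2 ≤ t ^ 2 := by gcongr
        rw [neg_le, le_div_iff₀ (by positivity)]
        by_cases hqn : 0 ≤ q t
        · nlinarith [mul_nonneg hqn (sq_nonneg R)]
        · nlinarith
      have hu1 : e / (4 * R ^ 2) - u t ^ 2 / R ^ 2 ≤ u' t ^ 2 := by
        have : R ^ 2 ≤ t ^ 2 := by gcongr
        have h4 : t ^ 2 ≤ 4 * R ^ 2 := by nlinarith
        have h5 : e ≤ u t ^ 2 + 4 * R ^ 2 * u' t ^ 2 := by nlinarith [sq_nonneg (u' t)]
        have h6 : e / (4 * R ^ 2) - u t ^ 2 / R ^ 2 = (e - 4 * u t ^ 2) / (4 * R ^ 2) := by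
          field_simp
        rw [h6, div_le_iff₀ (by positivity)]
        nlinarith [sq_nonneg (u t)]
      have hφ2 : φ ^ 2 * ((2 + 2 * K) / R ^ 2) ≤ (2 + 2 * K) * R ^ 2 := by
        rw [mul_div_assoc', div_le_iff₀ (by positivity)]
        have : φ ^ 2 ≤ (R ^ 2) ^ 2 := by gcongr
        nlinarith
      have a1 := mul_le_mul_of_nonneg_left hu1 (sq_nonneg φ)
      have a2 := mul_le_mul_of_nonneg_left hqK (mul_nonneg (sq_nonneg φ) (sq_nonneg (u t)))
      have a3 := mul_le_mul_of_nonneg_left hφ2 (sq_nonneg (u t))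
      have a4 := mul_le_mul_of_nonneg_left hψ (sq_nonneg (u t))
      have e1 : e / (2 * R ^ 2) = 2 * (e / (4 * R ^ 2)) := by field_simp; norm_num
      have e2 : (2 + 2 * K) / R ^ 2 = 2 * R⁻¹ ^ 2 + 2 * (K / R ^ 2) := by field_simp
      have e3 : u t ^ 2 / R ^ 2 = u t ^ 2 * R⁻¹ ^ 2 := by field_simp
      rw [e1]
      rw [e2] at a3
      rw [e3] at a1
      linarith
  have h2R : R ≤ 2 * R := by linarith
  have h := hmono (left_mem_Icc.2 h2R) (right_mem_Icc.2 h2R) h2R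
  have hval : e / (2 * R ^ 2) * (R ^ 2 * (2 * R - R) ^ 3 / 3 - R * (2 * R - R) ^ 4 / 2
      + (2 * R - R) ^ 5 / 5) = e * R / 60 * R ^ 2 := by
    field_simp
    ring
  simp only [hval] at h
  have h' : e * R / 60 * R ^ 2 ≤ (4 + 2 * K) * (U (2 * R) - U R) * R ^ 2 := by
    linear_combination h
  have := le_of_mul_le_mul_right h' (by positivity)
  linarith

/-- Let ρ₀ ≥ 1, h continuous and bounded on [ρ₀, ∞). If u solves
u'' = ρ⁻²(−1/4 + h(ρ)) u on [ρ₀, ∞) and u is square-integrable on [ρ₀, ∞), then there is a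
constant C with |u'(ρ)| ≤ C ρ^(−3/2) and |u(ρ)| ≤ C ρ^(−1/2) for all ρ ≥ ρ₀. -/
theorem stmt_3 (ρ₀ : ℝ) (hρ₀ : 1 ≤ ρ₀) (h u u' : ℝ → ℝ)
    (hcont : ContinuousOn h (Ici ρ₀))
    (hbdd : ∃ M, ∀ ρ ∈ Ici ρ₀, |h ρ| ≤ M)
    (hu : ∀ t ∈ Ici ρ₀, HasDerivWithinAt u (u' t) (Ici ρ₀) t)
    (hu'cont : ContinuousOn u' (Ici ρ₀))
    (hu' : ∀ t ∈ Ici ρ₀, HasDerivWithinAt u' ((t ^ 2)⁻¹ * (-(1/4) + h t) * u t) (Ici ρ₀) t)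
    (hL2 : IntegrableOn (fun ρ => u ρ ^ 2) (Ici ρ₀)) :
    ∃ C : ℝ, ∀ ρ ∈ Ici ρ₀,
      |u' ρ| ≤ C * ρ ^ (-(3/2) : ℝ) ∧ |u ρ| ≤ C * ρ ^ (-(1/2) : ℝ) := by
  obtain ⟨M, hM⟩ := hbdd
  have hM0 : 0 ≤ M := (abs_nonneg _).trans (hM ρ₀ self_mem_Ici)
  have hpos : 0 < ρ₀ := by linarith
  obtain ⟨n, hn⟩ := exists_nat_ge (1 + (M + 1 / 4))
  have hcu : ContinuousOn u (Ici ρ₀) := fun t ht => (hu t ht).continuousWithinAt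
  have hdu : ∀ t ∈ Ioi ρ₀, HasDerivAt u (u' t) t := fun t ht =>
    (hu t (mem_Ici_of_Ioi ht)).hasDerivAt (Ici_mem_nhds ht)
  have hdu' : ∀ t ∈ Ioi ρ₀, HasDerivAt u' ((t ^ 2)⁻¹ * (-(1/4) + h t) * u t) t := fun t ht =>
    (hu' t (mem_Ici_of_Ioi ht)).hasDerivAt (Ici_mem_nhds ht)
  have hq : ∀ t ∈ Ioi ρ₀, |t ^ 2 * ((t ^ 2)⁻¹ * (-(1/4) + h t))| ≤ M + 1 / 4 := by
    intro t ht
    have ht0 : t ≠ 0 := (hpos.trans ht).ne'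
    rw [mul_inv_cancel_left₀ (pow_ne_zero 2 ht0)]
    have := abs_le.1 (hM t (mem_Ici_of_Ioi ht))
    exact abs_le.2 ⟨by linarith, by linarith⟩
  have hmono := monotoneOn_pow_mul_energy hpos hn hq hcu hu'cont hdu hdu'
  set B := ∫ t in Ici ρ₀, u t ^ 2 with hB
  have hB0 : 0 ≤ B := integral_nonneg fun t => sq_nonneg _
  have hint : ∀ a ∈ Ici ρ₀, ∀ b ∈ Ici ρ₀, IntervalIntegrable (fun t => u t ^ 2) volume a b := by
    intro a ha b hb
    exact ((hcu.pow 2).mono (OrdConnected.uIcc_subset ordConnected_Ici ha hb)).intervalIntegrable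
  set D := 60 * (4 + 2 * (M + 1 / 4)) * B with hD
  have hD0 : 0 ≤ D := by positivity
  have hE : ∀ R ∈ Ici ρ₀, (u R ^ 2 + R ^ 2 * u' R ^ 2) * R ≤ 2 ^ n * D := by
    intro R hR
    have hR0 : 0 < R := hpos.trans_le hR
    have hsubI : Ioo R (2 * R) ⊆ Ioi ρ₀ := fun t ht => lt_of_le_of_lt hR ht.1
    have hsub : Icc R (2 * R) ⊆ Ici ρ₀ := fun t ht => le_trans hR ht.1
    have hU : ∀ t ∈ Ioi ρ₀, HasDerivAt (fun t => ∫ s in ρ₀..t, u s ^ 2) (u t ^ 2) t := by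
      intro t ht
      have hc : ContinuousOn (fun t => u t ^ 2) (Ioi ρ₀) := (hcu.pow 2).mono Ioi_subset_Ici_self
      exact intervalIntegral.integral_hasDerivAt_right
        (hint ρ₀ self_mem_Ici t (mem_Ici_of_Ioi ht))
        (hc.stronglyMeasurableAtFilter isOpen_Ioi t ht) (hc.continuousAt (Ioi_mem_nhds ht))
    have huIcc : uIcc ρ₀ (2 * R) = Icc ρ₀ (2 * R) := uIcc_of_le (by linarith [mem_Ici.1 hR])
    have hcU : ContinuousOn (fun t => ∫ s in ρ₀..t, u s ^ 2) (Icc R (2 * R)) :=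
      (intervalIntegral.continuousOn_primitive_interval
        (hL2.mono_set (huIcc.trans_subset Icc_subset_Ici_self))).mono
        (huIcc ▸ Icc_subset_Icc_left (mem_Ici.1 hR))
    have hmain := energy_le_of_primitive (e := (u R ^ 2 + R ^ 2 * u' R ^ 2) / 2 ^ n) hR0
      (by positivity) (fun t ht => hq t (hsubI ht)) (hcu.mono hsub)
      (hu'cont.mono hsub) hcU (fun t ht => hdu t (hsubI ht)) (fun t ht => hdu' t (hsubI ht))
      (fun t ht => hU t (hsubI ht)) (by
        intro t ht
        have h1 := hmono hR (hsub (Ioo_subset_Icc_self ht)) ht.1.le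
        have h2 : t ^ n ≤ (2 * R) ^ n := pow_le_pow_left₀ (hR0.trans ht.1).le ht.2.le n
        rw [mul_pow] at h2
        rw [div_le_iff₀ (by positivity)]
        refine le_of_mul_le_mul_left (h1.trans ?_) (pow_pos hR0 n)
        refine (mul_le_mul_of_nonneg_right h2 (by positivity)).trans_eq ?_
        ring)
    have hdiff : (∫ s in ρ₀..(2 * R), u s ^ 2) - ∫ s in ρ₀..R, u s ^ 2 ≤ B := by
      have h2R : 2 * R ∈ Ici ρ₀ := by
        have := mem_Ici.1 hR
        exact mem_Ici.2 (by linarith)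
      rw [intervalIntegral.integral_interval_sub_left (hint _ self_mem_Ici _ h2R)
        (hint _ self_mem_Ici _ hR), intervalIntegral.integral_of_le (by linarith)]
      exact setIntegral_mono_set hL2 (Filter.Eventually.of_forall fun t => sq_nonneg _)
        (Ioc_subset_Icc_self.trans hsub).eventuallyLE
    have h3 := hmain.trans (mul_le_mul_of_nonneg_left hdiff (by positivity))
    rw [div_mul_eq_mul_div, div_le_iff₀ (by positivity)] at h3
    rwa [← hD, mul_comm D] at h3
  refine ⟨√(2 ^ n * D), fun ρ hρ => ?_⟩
  have hρ0 : 0 < ρ := hpos.trans_le hρ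
  have hEρ := hE ρ hρ
  have hhalf : ρ ^ (-(1/2) : ℝ) = (√ρ)⁻¹ := by
    rw [Real.rpow_neg hρ0.le, Real.sqrt_eq_rpow]
  have hthree : ρ ^ (-(3/2) : ℝ) = (√ρ)⁻¹ * ρ⁻¹ := by
    rw [← hhalf, ← Real.rpow_neg_one ρ, ← Real.rpow_add hρ0]
    norm_num
  have hs : 0 < √ρ := Real.sqrt_pos.2 hρ0
  have hle : ∀ x : ℝ, x ^ 2 ≤ u ρ ^ 2 + ρ ^ 2 * u' ρ ^ 2 → |x| ≤ √(2 ^ n * D) * (√ρ)⁻¹ := by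
    intro x hx
    rw [← div_eq_mul_inv, le_div_iff₀ hs]
    refine Real.le_sqrt_of_sq_le ?_
    rw [mul_pow, sq_abs, Real.sq_sqrt hρ0.le]
    exact (mul_le_mul_of_nonneg_right hx hρ0.le).trans hEρ
  refine ⟨?_, ?_⟩
  · have := hle (ρ * u' ρ) (by nlinarith [sq_nonneg (u ρ)])
    rw [abs_mul, abs_of_pos hρ0] at this
    rw [hthree, ← mul_assoc, ← div_eq_mul_inv, le_div_iff₀ hρ0]
    linarith
  · rw [hhalf]
    exact hle (u ρ) (by nlinarith [sq_nonneg (ρ * u' ρ)])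
end

section
/- Let a ∈ ℝ and let F : (a, ∞) → ℝ be twice continuously differentiable such that F'(ρ) + F''(ρ) > 0 for all ρ > a. Then F has at most one critical point in (a, ∞), and for every C ∈ ℝ the set {ρ ∈ (a, ∞) : F(ρ) ≤ C} is convex, i.e. an interval (possibly empty). -/
open Set

/-- If `g + g' > 0` on `(a, ∞)`, then `x ↦ exp x * g x` is strictly increasing there. -/
theorem strictMonoOn_exp_mul_of_add_deriv_pos {a : ℝ} {g g' : ℝ → ℝ}
    (hg : ∀ x ∈ Ioi a, HasDerivAt g (g' x) x) (hpos : ∀ x ∈ Ioi a, 0 < g x + g' x) :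
    StrictMonoOn (fun x => Real.exp x * g x) (Ioi a) := by
  have hd : ∀ x ∈ Ioi a,
      HasDerivAt (fun x => Real.exp x * g x) (Real.exp x * g x + Real.exp x * g' x) x :=
    fun x hx => (Real.hasDerivAt_exp x).mul (hg x hx)
  refine strictMonoOn_of_deriv_pos (convex_Ioi a)
    (fun x hx => (hd x hx).continuousAt.continuousWithinAt) fun x hx => ?_
  rw [interior_Ioi] at hx
  rw [(hd x hx).deriv, ← mul_add]
  exact mul_pos (Real.exp_pos x) (hpos x hx)

/-- Let F be twice continuously differentiable on (a, ∞) with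
F'(ρ) + F''(ρ) > 0 for all ρ > a. Then F has at most one critical point in (a, ∞), and for
every C the set {ρ ∈ (a, ∞) : F(ρ) ≤ C} is convex. -/
theorem stmt_5 (a : ℝ) (F F' F'' : ℝ → ℝ)
    (hF : ∀ ρ ∈ Ioi a, HasDerivAt F (F' ρ) ρ)
    (hF' : ∀ ρ ∈ Ioi a, HasDerivAt F' (F'' ρ) ρ)
    (hF''cont : ContinuousOn F'' (Ioi a))
    (hpos : ∀ ρ ∈ Ioi a, 0 < F' ρ + F'' ρ) :
    Set.Subsingleton {ρ ∈ Ioi a | F' ρ = 0} ∧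
    ∀ C : ℝ, Convex ℝ {ρ ∈ Ioi a | F ρ ≤ C} := by
  have hmono := strictMonoOn_exp_mul_of_add_deriv_pos hF' hpos
  refine ⟨?_, fun C => ?_⟩
  · rintro x ⟨hx, hx0⟩ y ⟨hy, hy0⟩
    exact hmono.injOn hx hy (by simp [hx0, hy0])
  · refine (ordConnected_iff.2 ?_).convex
    rintro x ⟨hx, hxC⟩ y ⟨hy, hyC⟩ - z ⟨hxz, hzy⟩
    have hz : z ∈ Ioi a := lt_of_lt_of_le hx hxz
    refine ⟨hz, ?_⟩
    by_contra! hzC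
    have hxz' : x < z := lt_of_le_of_ne hxz (by rintro rfl; exact hxC.not_gt hzC)
    have hzy' : z < y := lt_of_le_of_ne hzy (by rintro rfl; exact hyC.not_gt hzC)
    obtain ⟨c, hc, hc'⟩ := exists_hasDerivAt_eq_slope F F' hxz'
      (fun t ht => (hF t (lt_of_lt_of_le hx ht.1)).continuousAt.continuousWithinAt)
      (fun t ht => hF t (lt_trans hx ht.1))
    obtain ⟨d, hd, hd'⟩ := exists_hasDerivAt_eq_slope F F' hzy'
      (fun t ht => (hF t (lt_of_lt_of_le hz ht.1)).continuousAt.continuousWithinAt)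
      (fun t ht => hF t (lt_trans hz ht.1))
    have hc0 : 0 < F' c := by
      rw [hc']
      exact div_pos (by linarith) (by linarith)
    have hd0 : F' d < 0 := by
      rw [hd']
      exact div_neg_of_neg_of_pos (by linarith) (by linarith)
    have hlt : Real.exp c * F' c < Real.exp d * F' d :=
      hmono (lt_trans hx hc.1) (lt_trans hz hd.1) (lt_trans hc.2 hd.1)
    linarith [mul_pos (Real.exp_pos c) hc0, mul_neg_of_pos_of_neg (Real.exp_pos d) hd0]
end

section
/- Let a < b be real numbers and let G : [a, b] → ℝ be continuous with −1 ≤ G(t) ≤ 3/2 for all t ∈ [a, b]. Then every nontrivial solution w of w'' = q w on [a, b], where q(t) = −1 + G(t), has at most 3(b − a)/π + 1 zeros in [a, b]; that is, the set {t ∈ [a, b] : w(t) = 0} is finite with cardinality at most 3(b − a)/π + 1. -/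
open Set

/-- The energy `w ^ 2 + w' ^ 2` satisfies a Grönwall inequality, so a solution of
`w'' = (-1 + G) w` with bounded `G` and vanishing Cauchy data at a point is zero. -/
lemma eq_zero_of_cauchy_data_eq_zero {a b c K : ℝ} {G w w' : ℝ → ℝ}
    (hG : ∀ t ∈ Icc a b, |G t| ≤ K)
    (hw : ∀ t ∈ Icc a b, HasDerivWithinAt w (w' t) (Icc a b) t)
    (hw' : ∀ t ∈ Icc a b, HasDerivWithinAt w' ((-1 + G t) * w t) (Icc a b) t)
    (hc : c ∈ Icc a b) (hwc : w c = 0) (hwc' : w' c = 0) :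
    ∀ t ∈ Icc a b, w t = 0 := by
  have key : ∀ k : ℝ, ∀ t ∈ Icc a b,
      HasDerivWithinAt (fun x => (w x ^ 2 + w' x ^ 2) * Real.exp (k * x))
        ((2 * G t * (w t * w' t) + k * (w t ^ 2 + w' t ^ 2)) * Real.exp (k * t))
        (Icc a b) t := by
    intro k t ht
    have hexp : HasDerivWithinAt (fun x => Real.exp (k * x)) (Real.exp (k * t) * (k * 1))
        (Icc a b) t := (((hasDerivAt_id t).const_mul k).exp).hasDerivWithinAt
    refine ((((hw t ht).pow 2).add ((hw' t ht).pow 2)).mul hexp).congr_deriv ?_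
    simp only [Pi.add_apply, Pi.pow_apply]
    push_cast
    ring
  have bound : ∀ t ∈ Icc a b, |2 * G t * (w t * w' t)| ≤ K * (w t ^ 2 + w' t ^ 2) := by
    intro t ht
    have h2 : 2 * |w t * w' t| ≤ w t ^ 2 + w' t ^ 2 := by
      rw [abs_mul]
      nlinarith [sq_nonneg (|w t| - |w' t|), sq_abs (w t), sq_abs (w' t)]
    calc |2 * G t * (w t * w' t)| = |G t| * (2 * |w t * w' t|) := by
          rw [abs_mul, abs_mul, abs_two]; ring
      _ ≤ K * (w t ^ 2 + w' t ^ 2) :=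
          mul_le_mul (hG t ht) h2 (by positivity) ((abs_nonneg _).trans (hG t ht))
  have hmono : MonotoneOn (fun x => (w x ^ 2 + w' x ^ 2) * Real.exp (K * x)) (Icc a b) := by
    refine monotoneOn_of_hasDerivWithinAt_nonneg (convex_Icc a b)
      (fun t ht => (key K t ht).continuousWithinAt)
      (fun t ht => (key K t (interior_subset ht)).mono interior_subset) fun t ht => ?_
    have := (abs_le.mp (bound t (interior_subset ht))).1
    exact mul_nonneg (by linarith) (Real.exp_pos _).le
  have hanti : AntitoneOn (fun x => (w x ^ 2 + w' x ^ 2) * Real.exp (-K * x)) (Icc a b) := by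
    refine antitoneOn_of_hasDerivWithinAt_nonpos (convex_Icc a b)
      (fun t ht => (key (-K) t ht).continuousWithinAt)
      (fun t ht => (key (-K) t (interior_subset ht)).mono interior_subset) fun t ht => ?_
    have := (abs_le.mp (bound t (interior_subset ht))).2
    exact mul_nonpos_of_nonpos_of_nonneg (by linarith) (Real.exp_pos _).le
  intro t ht
  have henergy : w t ^ 2 + w' t ^ 2 ≤ 0 := by
    rcases le_total t c with h | h
    · have := hmono ht hc h
      simp only [hwc, hwc'] at this
      exact nonpos_of_mul_nonpos_left (by simpa using this) (Real.exp_pos (K * t))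
    · have := hanti hc ht h
      simp only [hwc, hwc'] at this
      exact nonpos_of_mul_nonpos_left (by simpa using this) (Real.exp_pos (-K * t))
  exact pow_eq_zero_iff two_ne_zero |>.mp (by nlinarith [sq_nonneg (w t), sq_nonneg (w' t)])

/-- Sturm comparison with `v'' = -k² v`: if `-k² < q` and a solution of `w'' = q w` vanishes at
both ends of an interval shorter than `π / k`, its Cauchy data vanish throughout.  The proof is
Picone's identity, with comparison function `cos (k (x - m))`, `m` the midpoint. -/
lemma cauchy_data_eq_zero_of_short_interval {s t k : ℝ} {q w w' : ℝ → ℝ} (hst : s < t)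
    (hk : 0 < k) (hlen : k * (t - s) < Real.pi)
    (hq : ∀ x ∈ Icc s t, -k ^ 2 < q x)
    (hw : ∀ x ∈ Icc s t, HasDerivWithinAt w (w' x) (Icc s t) x)
    (hw' : ∀ x ∈ Icc s t, HasDerivWithinAt w' (q x * w x) (Icc s t) x)
    (hs : w s = 0) (ht : w t = 0) :
    ∀ x ∈ Icc s t, w x = 0 ∧ w' x = 0 := by
  set m := (s + t) / 2 with hm
  set F : ℝ → ℝ := fun x => w x * w' x + k * w x ^ 2 * Real.tan (k * (x - m)) with hF
  have hderiv : ∀ x ∈ Icc s t, HasDerivWithinAt F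
      ((w' x + k * w x * Real.tan (k * (x - m))) ^ 2 + (q x + k ^ 2) * w x ^ 2)
      (Icc s t) x := by
    intro x hx
    have hcos : Real.cos (k * (x - m)) ≠ 0 := by
      refine (Real.cos_pos_of_mem_Ioo ⟨?_, ?_⟩).ne'
      · nlinarith [mul_nonneg hk.le (sub_nonneg.2 hx.1)]
      · nlinarith [mul_nonneg hk.le (sub_nonneg.2 hx.2)]
    have htan : HasDerivWithinAt (fun x => Real.tan (k * (x - m)))
        (1 / Real.cos (k * (x - m)) ^ 2 * (k * 1)) (Icc s t) x :=
      (HasDerivAt.comp (h₂ := Real.tan) (h := fun x => k * (x - m)) x (Real.hasDerivAt_tan hcos)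
        (((hasDerivAt_id x).sub_const m).const_mul k)).hasDerivWithinAt
    refine (((hw x hx).mul (hw' x hx)).add
      ((((hw x hx).pow 2).const_mul k).mul htan)).congr_deriv ?_
    have hsec : 1 / Real.cos (k * (x - m)) ^ 2 = 1 + Real.tan (k * (x - m)) ^ 2 := by
      rw [one_div, ← Real.inv_one_add_tan_sq hcos, inv_inv]
    rw [hsec]
    simp only [Pi.pow_apply]
    push_cast
    ring
  have hmono : MonotoneOn F (Icc s t) := by
    refine monotoneOn_of_hasDerivWithinAt_nonneg (convex_Icc s t)
      (fun x hx => (hderiv x hx).continuousWithinAt)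
      (fun x hx => (hderiv x (interior_subset hx)).mono interior_subset) fun x hx => ?_
    have := hq x (interior_subset hx)
    have : 0 ≤ q x + k ^ 2 := by linarith
    positivity
  have hF0 : ∀ x ∈ Icc s t, F x = 0 := by
    intro x hx
    have h1 := hmono (left_mem_Icc.2 hst.le) hx hx.1
    have h2 := hmono hx (right_mem_Icc.2 hst.le) hx.2
    have hFs : F s = 0 := by simp [hF, hs]
    have hFt : F t = 0 := by simp [hF, ht]
    linarith
  intro x hx
  have hzero := (uniqueDiffOn_Icc hst x hx).eq_deriv _ (hderiv x hx)
    ((hasDerivWithinAt_const x (Icc s t) (0 : ℝ)).congr hF0 (hF0 x hx))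
  have hqx : 0 < q x + k ^ 2 := by linarith [hq x hx]
  have hw2 : (q x + k ^ 2) * w x ^ 2 = 0 := by
    have : 0 ≤ (q x + k ^ 2) * w x ^ 2 := by positivity
    nlinarith [sq_nonneg (w' x + k * w x * Real.tan (k * (x - m)))]
  have hwx : w x = 0 := by simpa [hqx.ne'] using hw2
  exact ⟨hwx, by simpa [hwx] using hzero⟩

/-- A subset of `[a, b]` whose distinct points are at distance at least `d` has at most
`(b - a) / d + 1` elements. -/
lemma finite_and_ncard_le_of_separated {a b d : ℝ} (hab : a ≤ b) (hd : 0 < d) {S : Set ℝ}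
    (hS : S ⊆ Icc a b) (hsep : ∀ s ∈ S, ∀ t ∈ S, s < t → d ≤ t - s) :
    S.Finite ∧ (S.ncard : ℝ) ≤ (b - a) / d + 1 := by
  set f : ℝ → ℕ := fun x => ⌊(x - a) / d⌋₊ with hf
  set N := ⌊(b - a) / d⌋₊ with hN
  have hmaps : MapsTo f S (Finset.range (N + 1) : Set ℕ) := by
    intro x hx
    rw [Finset.mem_coe, Finset.mem_range, Nat.lt_succ_iff]
    refine Nat.floor_le_floor ?_
    have := (hS hx).2
    gcongr
  have hlt : ∀ s ∈ S, ∀ t ∈ S, s < t → f s ≠ f t := by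
    intro s hs t ht hst h
    have h1 : (f s : ℝ) ≤ (s - a) / d :=
      Nat.floor_le (div_nonneg (sub_nonneg.2 (hS hs).1) hd.le)
    have h2 : (t - a) / d < f t + 1 := Nat.lt_floor_add_one _
    rw [← h, div_lt_iff₀ hd] at h2
    rw [le_div_iff₀ hd] at h1
    linarith [hsep s hs t ht hst]
  have hinj : InjOn f S := by
    intro s hs t ht h
    rcases lt_trichotomy s t with hst | hst | hst
    · exact absurd h (hlt s hs t ht hst)
    · exact hst
    · exact absurd h.symm (hlt t ht s hs hst)
  refine ⟨Finite.of_injOn hmaps hinj (Finset.finite_toSet _), ?_⟩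
  have hcard : S.ncard ≤ N + 1 := by
    simpa only [ncard_coe_finset, Finset.card_range] using
      ncard_le_ncard_of_injOn f hmaps hinj (Finset.finite_toSet _)
  calc (S.ncard : ℝ) ≤ (N + 1 : ℕ) := by exact_mod_cast hcard
    _ = N + 1 := by push_cast; ring
    _ ≤ (b - a) / d + 1 := by
      gcongr
      exact Nat.floor_le (div_nonneg (sub_nonneg.2 hab) hd.le)

/-- Let a < b and G : [a, b] → ℝ continuous with −1 ≤ G ≤ 3/2. Then every
nontrivial solution w of w'' = (−1 + G) w on [a, b] has at most 3(b − a)/π + 1 zeros in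
[a, b]. -/
theorem stmt_7 (a b : ℝ) (hab : a < b) (G : ℝ → ℝ)
    (hG : ContinuousOn G (Icc a b))
    (hGbd : ∀ t ∈ Icc a b, -1 ≤ G t ∧ G t ≤ 3/2)
    (w w' : ℝ → ℝ)
    (hw : ∀ t ∈ Icc a b, HasDerivWithinAt w (w' t) (Icc a b) t)
    (hw'cont : ContinuousOn w' (Icc a b))
    (hw' : ∀ t ∈ Icc a b, HasDerivWithinAt w' ((-1 + G t) * w t) (Icc a b) t)
    (hnt : ∃ t ∈ Icc a b, w t ≠ 0) :
    {t ∈ Icc a b | w t = 0}.Finite ∧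
      ({t ∈ Icc a b | w t = 0}.ncard : ℝ) ≤ 3 * (b - a) / Real.pi + 1 := by
  have hπ := Real.pi_pos
  have hsep : ∀ s ∈ {t ∈ Icc a b | w t = 0}, ∀ t ∈ {t ∈ Icc a b | w t = 0}, s < t →
      Real.pi / 3 ≤ t - s := by
    rintro s ⟨hs, hws⟩ t ⟨ht, hwt⟩ hst
    by_contra! hlt
    have hsub : Icc s t ⊆ Icc a b := Icc_subset_Icc hs.1 ht.2
    obtain ⟨h0, h0'⟩ := cauchy_data_eq_zero_of_short_interval (k := 3)
      (q := fun x => -1 + G x) hst (by norm_num) (by linarith)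
      (fun x hx => by linarith [(hGbd x (hsub hx)).1])
      (fun x hx => (hw x (hsub hx)).mono hsub) (fun x hx => (hw' x (hsub hx)).mono hsub)
      hws hwt s (left_mem_Icc.2 hst.le)
    obtain ⟨r, hr, hwr⟩ := hnt
    refine hwr (eq_zero_of_cauchy_data_eq_zero (K := 3 / 2) (fun x hx => ?_) hw hw' hs h0 h0'
      r hr)
    exact abs_le.2 ⟨by linarith [(hGbd x hx).1], (hGbd x hx).2⟩
  have hcount := finite_and_ncard_le_of_separated hab.le (by positivity) (sep_subset _ _) hsep
  refine ⟨hcount.1, hcount.2.trans_eq ?_⟩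
  field_simp
end

section
/- Let a < b be real numbers and let G : [a, b] → ℝ be continuous with G(t) ≤ 3/4 for all t ∈ [a, b]. Then for every nontrivial solution w of w'' = q w on [a, b], where q(t) = −1 + G(t), the number of zeros of w in [a, b] is at least (b − a)/(4π) − 1; that is, there is a finite set Z ⊆ {t ∈ [a, b] : w(t) = 0} with cardinality at least (b − a)/(4π) − 1. -/
open Set

/-- Sturm comparison with `sin ((t - c) / 2)`: a solution of `w'' = q w` with `q ≤ -1/4` that is
positive at `c` cannot stay positive on all of `[c, c + 2π]`. -/
theorem exists_nonpos_of_le_neg_quarter (c : ℝ) (q w w' : ℝ → ℝ)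
    (hq : ∀ t ∈ Icc c (c + 2 * Real.pi), q t ≤ -(1 / 4))
    (hw : ∀ t ∈ Icc c (c + 2 * Real.pi), HasDerivWithinAt w (w' t) (Icc c (c + 2 * Real.pi)) t)
    (hw' : ∀ t ∈ Icc c (c + 2 * Real.pi),
      HasDerivWithinAt w' (q t * w t) (Icc c (c + 2 * Real.pi)) t) :
    ∃ t ∈ Icc c (c + 2 * Real.pi), w t ≤ 0 := by
  by_contra! hpos
  have hpi := Real.pi_pos
  set I := Icc c (c + 2 * Real.pi)
  have hs (t : ℝ) : HasDerivWithinAt (fun t => Real.sin ((t - c) / 2))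
      (Real.cos ((t - c) / 2) * (1 / 2)) I t :=
    ((((hasDerivAt_id t).sub_const c).div_const 2).sin).hasDerivWithinAt
  have hc (t : ℝ) : HasDerivWithinAt (fun t => Real.cos ((t - c) / 2))
      (-Real.sin ((t - c) / 2) * (1 / 2)) I t :=
    ((((hasDerivAt_id t).sub_const c).div_const 2).cos).hasDerivWithinAt
  have hW (t : ℝ) (ht : t ∈ I) := ((hw t ht).mul ((hc t).mul_const (1 / 2))).sub
    ((hw' t ht).mul (hs t))
  have hmono := monotoneOn_of_hasDerivWithinAt_nonneg (convex_Icc c (c + 2 * Real.pi))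
    (fun t ht => (hW t ht).continuousWithinAt)
    (fun t ht => (hW t (interior_subset ht)).mono interior_subset)
    (fun t ht => by
      have ht' := interior_subset ht
      have h1 := hpos t ht'
      have h2 := hq t ht'
      have h3 : 0 ≤ Real.sin ((t - c) / 2) :=
        Real.sin_nonneg_of_nonneg_of_le_pi (by linarith [ht'.1]) (by linarith [ht'.2])
      have h4 := mul_nonneg (mul_nonneg h1.le h3) (by linarith : 0 ≤ -(1 / 4) - q t)
      linarith)
  have hl : c ∈ I := ⟨le_rfl, by linarith⟩
  have hr : c + 2 * Real.pi ∈ I := ⟨by linarith, le_rfl⟩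
  have h := hmono hl hr hl.2
  simp at h
  linarith [hpos _ hl, hpos _ hr]

/-- A solution of `w'' = q w` with `q ≤ -1/4` vanishes somewhere on every closed interval of
length `2π`. -/
theorem exists_zero_of_le_neg_quarter (c : ℝ) (q w w' : ℝ → ℝ)
    (hq : ∀ t ∈ Icc c (c + 2 * Real.pi), q t ≤ -(1 / 4))
    (hw : ∀ t ∈ Icc c (c + 2 * Real.pi), HasDerivWithinAt w (w' t) (Icc c (c + 2 * Real.pi)) t)
    (hw' : ∀ t ∈ Icc c (c + 2 * Real.pi),
      HasDerivWithinAt w' (q t * w t) (Icc c (c + 2 * Real.pi)) t) :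
    ∃ t ∈ Icc c (c + 2 * Real.pi), w t = 0 := by
  obtain ⟨x, hx, hx0⟩ := exists_nonpos_of_le_neg_quarter c q w w' hq hw hw'
  obtain ⟨y, hy, hy0⟩ := exists_nonpos_of_le_neg_quarter c q (-w) (-w') hq
    (fun t ht => (hw t ht).neg)
    (fun t ht => by simpa using (hw' t ht).neg)
  have hcont : ContinuousOn w (Icc c (c + 2 * Real.pi)) :=
    fun t ht => (hw t ht).continuousWithinAt
  exact isPreconnected_Icc.intermediate_value hx hy hcont ⟨hx0, by simpa using hy0⟩

/-- Let a < b and G : [a, b] → ℝ continuous with G ≤ 3/4. Then every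
nontrivial solution w of w'' = (−1 + G) w on [a, b] has at least (b − a)/(4π) − 1 zeros in
[a, b]: there is a finite subset of the zero set of that cardinality. -/
theorem stmt_8 (a b : ℝ) (hab : a < b) (G : ℝ → ℝ)
    (hG : ContinuousOn G (Icc a b))
    (hGbd : ∀ t ∈ Icc a b, G t ≤ 3/4)
    (w w' : ℝ → ℝ)
    (hw : ∀ t ∈ Icc a b, HasDerivWithinAt w (w' t) (Icc a b) t)
    (hw'cont : ContinuousOn w' (Icc a b))
    (hw' : ∀ t ∈ Icc a b, HasDerivWithinAt w' ((-1 + G t) * w t) (Icc a b) t)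
    (hnt : ∃ t ∈ Icc a b, w t ≠ 0) :
    ∃ Z : Set ℝ, Z ⊆ {t ∈ Icc a b | w t = 0} ∧ Z.Finite ∧
      (b - a) / (4 * Real.pi) - 1 ≤ (Z.ncard : ℝ) := by
  have hpi := Real.pi_pos
  set n := ⌊(b - a) / (4 * Real.pi)⌋₊
  have hnle : (n : ℝ) * (4 * Real.pi) ≤ b - a :=
    (le_div_iff₀ (by positivity)).1 (Nat.floor_le (div_nonneg (by linarith) (by positivity)))
  have key (k : Fin n) : ∃ t ∈ Icc (a + k * (4 * Real.pi)) (a + k * (4 * Real.pi) + 2 * Real.pi),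
      t ∈ Icc a b ∧ w t = 0 := by
    have hk : ((k : ℕ) : ℝ) + 1 ≤ n := by exact_mod_cast k.2
    have hk' := mul_le_mul_of_nonneg_right hk (by positivity : 0 ≤ 4 * Real.pi)
    have hk0 : 0 ≤ ((k : ℕ) : ℝ) * (4 * Real.pi) := by positivity
    have hsub : Icc (a + k * (4 * Real.pi)) (a + k * (4 * Real.pi) + 2 * Real.pi) ⊆ Icc a b :=
      Icc_subset_Icc (by linarith) (by linarith)
    obtain ⟨t, ht, h0⟩ := exists_zero_of_le_neg_quarter (a + k * (4 * Real.pi))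
      (fun t => -1 + G t) w w' (fun t ht => by linarith [hGbd t (hsub ht)])
      (fun t ht => (hw t (hsub ht)).mono hsub) (fun t ht => (hw' t (hsub ht)).mono hsub)
    exact ⟨t, ht, hsub ht, h0⟩
  choose z hz hzI hz0 using key
  have hlt : StrictMono z := by
    intro i j hij
    have h1 : ((i : ℕ) : ℝ) + 1 ≤ (j : ℕ) := by exact_mod_cast hij
    have h2 := mul_le_mul_of_nonneg_right h1 (by positivity : 0 ≤ 4 * Real.pi)
    linarith [(hz i).2, (hz j).1]
  refine ⟨range z, ?_, finite_range z, ?_⟩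
  · rintro _ ⟨k, rfl⟩
    exact ⟨hzI k, hz0 k⟩
  · have hcard : (range z).ncard = n := by
      rw [← image_univ, ncard_image_of_injective _ hlt.injective, ncard_univ, Nat.card_fin]
    rw [hcard]
    linarith [Nat.lt_floor_add_one ((b - a) / (4 * Real.pi))]
end

section
/- Let a < b be real numbers and let q₁, q₂ : [a, b] → ℝ be continuous with q₂(t) < q₁(t) for all t ∈ (a, b). Let u be a solution of u'' = q₁ u on [a, b] with u(a) = u(b) = 0 and u(t) ≠ 0 for all t ∈ (a, b), and let v be any solution of v'' = q₂ v on [a, b]. Then there exists t₀ ∈ (a, b) with v(t₀) = 0. -/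
open Set

/-- A continuous function with no zero on an open interval has constant sign there. -/
theorem forall_pos_or_forall_neg_of_continuousOn_Ioo {a b : ℝ} {f : ℝ → ℝ}
    (hf : ContinuousOn f (Ioo a b)) (hne : ∀ t ∈ Ioo a b, f t ≠ 0) :
    (∀ t ∈ Ioo a b, 0 < f t) ∨ (∀ t ∈ Ioo a b, f t < 0) := by
  by_contra! h
  obtain ⟨⟨x, hx, hfx⟩, y, hy, hfy⟩ := h
  obtain ⟨z, hz, hfz⟩ := isPreconnected_Ioo.intermediate_value hx hy hf ⟨hfx, hfy⟩
  exact hne z hz hfz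

/-- A function positive on `Ioo a b` and continuous on `Icc a b` is nonnegative on `Icc a b`. -/
theorem nonneg_of_pos_on_Ioo {a b : ℝ} (hab : a < b) {f : ℝ → ℝ}
    (hf : ContinuousOn f (Icc a b)) (hpos : ∀ t ∈ Ioo a b, 0 < f t) :
    ∀ t ∈ Icc a b, 0 ≤ f t := by
  intro t ht
  have hcl : t ∈ closure (Ioo a b) := by rwa [closure_Ioo hab.ne]
  have : (nhdsWithin t (Ioo a b)).NeBot := mem_closure_iff_nhdsWithin_neBot.mp hcl
  refine ge_of_tendsto ((hf t ht).mono Ioo_subset_Icc_self) ?_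
  filter_upwards [self_mem_nhdsWithin] with x hx using (hpos x hx).le

theorem deriv_left_nonneg {a b d : ℝ} (hab : a < b) {f : ℝ → ℝ}
    (hf : HasDerivWithinAt f d (Icc a b) a) (hfa : f a = 0)
    (hpos : ∀ t ∈ Ioo a b, 0 < f t) : 0 ≤ d := by
  have := left_nhdsWithin_Ioo_neBot hab
  refine ge_of_tendsto ((hasDerivWithinAt_iff_tendsto_slope' (s := Ioo a b) (by simp)).mp
    (hf.mono Ioo_subset_Icc_self)) ?_
  filter_upwards [self_mem_nhdsWithin] with x hx
  rw [slope_def_field, hfa, sub_zero]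
  exact div_nonneg (hpos x hx).le (sub_nonneg.mpr hx.1.le)

theorem deriv_right_nonpos {a b d : ℝ} (hab : a < b) {f : ℝ → ℝ}
    (hf : HasDerivWithinAt f d (Icc a b) b) (hfb : f b = 0)
    (hpos : ∀ t ∈ Ioo a b, 0 < f t) : d ≤ 0 := by
  have := right_nhdsWithin_Ioo_neBot hab
  refine le_of_tendsto ((hasDerivWithinAt_iff_tendsto_slope' (s := Ioo a b) (by simp)).mp
    (hf.mono Ioo_subset_Icc_self)) ?_
  filter_upwards [self_mem_nhdsWithin] with x hx
  rw [slope_def_field, hfb, sub_zero]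
  exact div_nonpos_of_nonneg_of_nonpos (hpos x hx).le (sub_nonpos.mpr hx.2.le)

/-- Two functions satisfying the hypotheses of Sturm comparison cannot both be positive on the
open interval: their Wronskian would be strictly increasing, but goes from nonnegative to
nonpositive. -/
theorem sturm_not_both_pos {a b : ℝ} (hab : a < b) {q₁ q₂ : ℝ → ℝ}
    (hlt : ∀ t ∈ Ioo a b, q₂ t < q₁ t) {u u' v v' : ℝ → ℝ}
    (hu : ∀ t ∈ Icc a b, HasDerivWithinAt u (u' t) (Icc a b) t)
    (hu' : ∀ t ∈ Icc a b, HasDerivWithinAt u' (q₁ t * u t) (Icc a b) t)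
    (hua : u a = 0) (hub : u b = 0)
    (hv : ∀ t ∈ Icc a b, HasDerivWithinAt v (v' t) (Icc a b) t)
    (hv' : ∀ t ∈ Icc a b, HasDerivWithinAt v' (q₂ t * v t) (Icc a b) t)
    (hupos : ∀ t ∈ Ioo a b, 0 < u t) (hvpos : ∀ t ∈ Ioo a b, 0 < v t) : False := by
  have ha : a ∈ Icc a b := left_mem_Icc.mpr hab.le
  have hb : b ∈ Icc a b := right_mem_Icc.mpr hab.le
  have hW : ∀ t ∈ Icc a b, HasDerivWithinAt (fun s => u' s * v s - u s * v' s)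
      ((q₁ t - q₂ t) * (u t * v t)) (Icc a b) t := fun t ht =>
    (((hu' t ht).mul (hv t ht)).sub ((hu t ht).mul (hv' t ht))).congr_deriv (by ring)
  have hmono : StrictMonoOn (fun s => u' s * v s - u s * v' s) (Icc a b) := by
    refine strictMonoOn_of_hasDerivWithinAt_pos (convex_Icc a b)
      (fun t ht => (hW t ht).continuousWithinAt)
      (fun t ht => (hW t (interior_subset ht)).mono interior_subset) fun t ht => ?_
    rw [interior_Icc] at ht
    exact mul_pos (sub_pos.mpr (hlt t ht)) (mul_pos (hupos t ht) (hvpos t ht))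
  have hlt' := hmono ha hb hab
  have hvnn := nonneg_of_pos_on_Ioo hab (fun t ht => (hv t ht).continuousWithinAt) hvpos
  have h1 := mul_nonneg (deriv_left_nonneg hab (hu a ha) hua hupos) (hvnn a ha)
  have h2 := mul_nonpos_of_nonpos_of_nonneg
    (deriv_right_nonpos hab (hu b hb) hub hupos) (hvnn b hb)
  simp only [hua, hub, zero_mul, sub_zero] at hlt'
  linarith

/-- Sturm comparison: Let a < b, q₁, q₂ continuous on [a, b] with q₂ < q₁ on
(a, b). If u solves u'' = q₁ u on [a, b] with u(a) = u(b) = 0 and u ≠ 0 on (a, b), and v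
solves v'' = q₂ v on [a, b], then v vanishes somewhere in (a, b). -/
theorem stmt_9 (a b : ℝ) (hab : a < b) (q₁ q₂ : ℝ → ℝ)
    (hq₁ : ContinuousOn q₁ (Icc a b)) (hq₂ : ContinuousOn q₂ (Icc a b))
    (hlt : ∀ t ∈ Ioo a b, q₂ t < q₁ t)
    (u u' v v' : ℝ → ℝ)
    (hu : ∀ t ∈ Icc a b, HasDerivWithinAt u (u' t) (Icc a b) t)
    (hu'cont : ContinuousOn u' (Icc a b))
    (hu' : ∀ t ∈ Icc a b, HasDerivWithinAt u' (q₁ t * u t) (Icc a b) t)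
    (hua : u a = 0) (hub : u b = 0)
    (hune : ∀ t ∈ Ioo a b, u t ≠ 0)
    (hv : ∀ t ∈ Icc a b, HasDerivWithinAt v (v' t) (Icc a b) t)
    (hv'cont : ContinuousOn v' (Icc a b))
    (hv' : ∀ t ∈ Icc a b, HasDerivWithinAt v' (q₂ t * v t) (Icc a b) t) :
    ∃ t₀ ∈ Ioo a b, v t₀ = 0 := by
  by_contra! h
  have hun : ∀ t ∈ Icc a b, HasDerivWithinAt (-u) ((-u') t) (Icc a b) t :=
    fun t ht => (hu t ht).neg
  have hun' : ∀ t ∈ Icc a b, HasDerivWithinAt (-u') (q₁ t * (-u) t) (Icc a b) t :=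
    fun t ht => (hu' t ht).neg.congr_deriv (by simp)
  have hvn : ∀ t ∈ Icc a b, HasDerivWithinAt (-v) ((-v') t) (Icc a b) t :=
    fun t ht => (hv t ht).neg
  have hvn' : ∀ t ∈ Icc a b, HasDerivWithinAt (-v') (q₂ t * (-v) t) (Icc a b) t :=
    fun t ht => (hv' t ht).neg.congr_deriv (by simp)
  have huna : (-u) a = 0 := by simp [hua]
  have hunb : (-u) b = 0 := by simp [hub]
  have hucont : ContinuousOn u (Ioo a b) := fun t ht =>
    (hu t (Ioo_subset_Icc_self ht)).continuousWithinAt.mono Ioo_subset_Icc_self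
  have hvcont : ContinuousOn v (Ioo a b) := fun t ht =>
    (hv t (Ioo_subset_Icc_self ht)).continuousWithinAt.mono Ioo_subset_Icc_self
  rcases forall_pos_or_forall_neg_of_continuousOn_Ioo hucont hune with hup | hup <;>
    rcases forall_pos_or_forall_neg_of_continuousOn_Ioo hvcont h with hvp | hvp
  · exact sturm_not_both_pos hab hlt hu hu' hua hub hv hv' hup hvp
  · exact sturm_not_both_pos hab hlt hu hu' hua hub hvn hvn' hup
      fun t ht => neg_pos.mpr (hvp t ht)
  · exact sturm_not_both_pos hab hlt hun hun' huna hunb hv hv'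
      (fun t ht => neg_pos.mpr (hup t ht)) hvp
  · exact sturm_not_both_pos hab hlt hun hun' huna hunb hvn hvn'
      (fun t ht => neg_pos.mpr (hup t ht)) fun t ht => neg_pos.mpr (hvp t ht)
end

section
/- Let I, J ⊆ ℝ be nonempty open intervals, let V : I → ℝ be continuous, and let u : I × J → ℝ be infinitely differentiable such that for every E ∈ J and every ρ ∈ I one has ∂²u/∂ρ²(ρ, E) = (V(ρ) − E) u(ρ, E). Suppose a₀ ∈ I and E₀ ∈ J satisfy u(a₀, E₀) = 0 and the function ρ ↦ u(ρ, E₀) is not identically zero on I. Then there exist δ > 0 and an infinitely differentiable function a : (E₀ − δ, E₀ + δ) → I such that a(E₀) = a₀ and u(a(E), E) = 0 for all E with |E − E₀| < δ. -/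
open Set Filter Topology

/-- A solution of a homogeneous linear second order equation with vanishing Cauchy data at one
point of an open interval vanishes on the whole interval. -/
theorem eqOn_zero_of_deriv_deriv_eq_mul {I : Set ℝ} (hI : IsOpen I) (hI' : Convex ℝ I)
    {q w : ℝ → ℝ} (hq : ContinuousOn q I) (hw : DifferentiableOn ℝ w I)
    (hw' : DifferentiableOn ℝ (deriv w) I) (hode : ∀ t ∈ I, deriv (deriv w) t = q t * w t)
    {a : ℝ} (ha : a ∈ I) (h0 : w a = 0) (h1 : deriv w a = 0) : EqOn w 0 I := by
  intro t ht
  obtain ⟨l, hl, hlI⟩ : ∃ l < min a t, l ∈ I := by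
    have hm : min a t ∈ I := by rcases min_choice a t with h | h <;> rwa [h]
    exact ((eventually_mem_nhdsWithin).and
      (mem_nhdsWithin_of_mem_nhds (hI.mem_nhds hm)) : ∀ᶠ x in 𝓝[<] (min a t), _).exists
  obtain ⟨r, hr, hrI⟩ : ∃ r > max a t, r ∈ I := by
    have hm : max a t ∈ I := by rcases max_choice a t with h | h <;> rwa [h]
    exact ((eventually_mem_nhdsWithin).and
      (mem_nhdsWithin_of_mem_nhds (hI.mem_nhds hm)) : ∀ᶠ x in 𝓝[>] (max a t), _).exists
  rw [lt_min_iff] at hl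
  rw [gt_iff_lt, max_lt_iff] at hr
  have hsub : Icc l r ⊆ I := hI'.ordConnected.out hlI hrI
  obtain ⟨C, hC⟩ := isCompact_Icc.exists_bound_of_continuousOn (hq.mono hsub)
  have hlip : ∀ s ∈ Ioo l r, LipschitzOnWith (max 1 C.toNNReal)
      (fun x : ℝ × ℝ => (x.2, q s * x.1)) univ := by
    intro s hs
    rw [lipschitzOnWith_univ]
    refine LipschitzWith.prodMk LipschitzWith.prod_snd (LipschitzWith.of_dist_le_mul fun x y => ?_)
    rw [Real.dist_eq, ← mul_sub, abs_mul]
    have h2 := hC s (Ioo_subset_Icc_self hs)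
    rw [Real.norm_eq_abs] at h2
    have h3 : |x.1 - y.1| ≤ dist x y := by
      rw [← Real.dist_eq]; exact le_max_left _ _
    exact mul_le_mul (h2.trans (Real.le_coe_toNNReal C)) h3 (abs_nonneg _) (NNReal.coe_nonneg _)
  have hderiv : ∀ s ∈ Ioo l r, HasDerivAt (fun s => (w s, deriv w s))
      (deriv w s, q s * w s) s ∧ (w s, deriv w s) ∈ (univ : Set (ℝ × ℝ)) := by
    intro s hs
    have hsI := hI.mem_nhds (hsub (Ioo_subset_Icc_self hs))
    refine ⟨(hw.differentiableAt hsI).hasDerivAt.prodMk ?_, mem_univ _⟩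
    rw [← hode s (mem_of_mem_nhds hsI)]
    exact (hw'.differentiableAt hsI).hasDerivAt
  have hzero : ∀ s ∈ Ioo l r, HasDerivAt (fun _ : ℝ => ((0 : ℝ), (0 : ℝ)))
      ((0 : ℝ), q s * 0) s ∧ ((0 : ℝ), (0 : ℝ)) ∈ (univ : Set (ℝ × ℝ)) := by
    intro s _
    refine ⟨?_, mem_univ _⟩
    rw [mul_zero]
    exact hasDerivAt_const s ((0 : ℝ), (0 : ℝ))
  have := ODE_solution_unique_of_mem_Ioo (v := fun s x => (x.2, q s * x.1)) (s := fun _ => univ)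
    hlip (t₀ := a) ⟨hl.1, hr.1⟩ hderiv hzero (by simp [h0, h1]) ⟨hl.2, hr.2⟩
  exact congrArg Prod.fst this

theorem ContinuousLinearMap.isInvertible_of_apply_one_ne_zero {𝕜 : Type*}
    [NontriviallyNormedField 𝕜] {L : 𝕜 →L[𝕜] 𝕜} (h : L 1 ≠ 0) : L.IsInvertible :=
  ⟨ContinuousLinearEquiv.unitsEquivAut 𝕜 (Units.mk0 (L 1) h), by ext; simp⟩

/-- **Implicit function theorem**, with the implicit function of class `C^n`, `n = ∞` included,
on a whole neighbourhood of the base point. -/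
theorem exists_implicitFunction_eventually_contDiffAt {n : WithTop ℕ∞} (hn : n ≠ 0)
    {f : ℝ × ℝ → ℝ} {x y : ℝ} (hf : ∀ᶠ p in 𝓝 (x, y), ContDiffAt ℝ n f p)
    (h0 : fderiv ℝ f (x, y) (0, 1) ≠ 0) :
    ∃ g : ℝ → ℝ, g x = y ∧ ∀ᶠ z in 𝓝 x, ContDiffAt ℝ n g z ∧ f (z, g z) = f (x, y) := by
  have inv : ∀ p : ℝ × ℝ, fderiv ℝ f p (0, 1) ≠ 0 →
      (fderiv ℝ f p ∘L .inr ℝ ℝ ℝ).IsInvertible := fun p hp =>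
    ContinuousLinearMap.isInvertible_of_apply_one_ne_zero (by simpa using hp)
  have one_le : (1 : WithTop ℕ∞) ≤ n := ENat.one_le_iff_ne_zero_withTop.mpr hn
  have cdf := hf.self_of_nhds
  set g := cdf.implicitFunction hn (inv _ h0)
  have gx : g x = y := cdf.implicitFunction_apply_self hn (inv _ h0)
  have hgf : ∀ᶠ z in 𝓝 x, f (z, g z) = f (x, y) :=
    cdf.eventually_apply_implicitFunction hn (inv _ h0)
  have g1 : ContDiffAt ℝ 1 g x :=
    (cdf.contDiffAt_implicitFunction hn (inv _ h0)).of_le one_le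
  have hne : ∀ᶠ p in 𝓝 (x, y), fderiv ℝ f p (0, 1) ≠ 0 :=
    (((cdf.of_le one_le).fderiv_right (m := 0) (by simp)).continuousAt.clm_apply
      continuousAt_const).eventually_ne h0
  have htend : Tendsto (fun z => (z, g z)) (𝓝 x) (𝓝 (x, y)) := by
    have := continuousAt_id.prodMk g1.continuousAt
    simpa [ContinuousAt, gx] using this
  refine ⟨g, gx, ?_⟩
  filter_upwards [htend.eventually hf, htend.eventually hne, hgf.eventually_nhds,
    g1.eventually (by simp)] with z hz hz0 hzf hz1
  refine ⟨?_, hzf.self_of_nhds⟩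
  refine (hz.contDiffAt_implicitFunction hn (inv _ hz0)).congr_of_eventuallyEq ?_
  have htend' : Tendsto (fun t => (t, g t)) (𝓝 z) (𝓝 (z, g z)) :=
    continuousAt_id.prodMk hz1.continuousAt
  filter_upwards [hzf, htend'.eventually
    (hz.eventually_apply_eq_iff_implicitFunction hn (inv _ hz0))] with t ht hiff
  exact (hiff.mp (ht.trans hzf.self_of_nhds.symm)).symm

/-- Zeros of solutions depend smoothly on the eigenvalue parameter. -/
theorem stmt_10 (I J : Set ℝ) (hIopen : IsOpen I) (hJopen : IsOpen J)
    (hIne : I.Nonempty) (hJne : J.Nonempty)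
    (hIconv : Convex ℝ I) (hJconv : Convex ℝ J)
    (V : ℝ → ℝ) (hV : ContinuousOn V I)
    (u : ℝ × ℝ → ℝ) (hu : ContDiffOn ℝ (⊤ : ℕ∞) u (I ×ˢ J))
    (hode : ∀ E ∈ J, ∀ ρ ∈ I,
      deriv (deriv (fun s => u (s, E))) ρ = (V ρ - E) * u (ρ, E))
    (a₀ E₀ : ℝ) (ha₀ : a₀ ∈ I) (hE₀ : E₀ ∈ J)
    (hzero : u (a₀, E₀) = 0)
    (hnt : ∃ ρ ∈ I, u (ρ, E₀) ≠ 0) :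
    ∃ δ > 0, ∃ a : ℝ → ℝ,
      ContDiffOn ℝ (⊤ : ℕ∞) a (Ioo (E₀ - δ) (E₀ + δ)) ∧ a E₀ = a₀ ∧
      ∀ E ∈ Ioo (E₀ - δ) (E₀ + δ), a E ∈ I ∧ u (a E, E) = 0 := by
  have hopen : IsOpen (I ×ˢ J) := hIopen.prod hJopen
  have hw : ContDiffOn ℝ (⊤ : ℕ∞) (fun s => u (s, E₀)) I :=
    hu.comp (by fun_prop) fun s hs => ⟨hs, hE₀⟩
  have hderiv : deriv (fun s => u (s, E₀)) a₀ ≠ 0 := by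
    intro h1
    obtain ⟨ρ, hρ, hne⟩ := hnt
    exact hne (eqOn_zero_of_deriv_deriv_eq_mul hIopen hIconv (hV.sub continuousOn_const)
      (hw.differentiableOn (by simp))
      (((contDiffOn_infty_iff_deriv_of_isOpen hIopen).mp hw).2.differentiableOn (by simp))
      (hode E₀ hE₀) ha₀ hzero h1 hρ)
  have hf : ∀ᶠ p in 𝓝 (E₀, a₀), ContDiffAt ℝ (⊤ : ℕ∞) (u ∘ Prod.swap) p := by
    have hmem : ∀ᶠ p in 𝓝 (E₀, a₀), p.swap ∈ I ×ˢ J :=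
      continuous_swap.continuousAt.eventually (hopen.mem_nhds ⟨ha₀, hE₀⟩)
    filter_upwards [hmem] with p hp
    exact (hu.contDiffAt (hopen.mem_nhds hp)).comp p (contDiff_snd.prodMk contDiff_fst).contDiffAt
  have hpartial : fderiv ℝ (u ∘ Prod.swap) (E₀, a₀) (0, 1) ≠ 0 := by
    have hd := (hf.self_of_nhds.differentiableAt (by simp)).hasFDerivAt.comp_hasDerivAt a₀
      ((hasDerivAt_const a₀ E₀).prodMk (hasDerivAt_id a₀))
    rw [← hd.deriv]
    exact hderiv
  obtain ⟨a, ha, hev⟩ := exists_implicitFunction_eventually_contDiffAt (by simp) hf hpartial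
  have haI : ∀ᶠ E in 𝓝 E₀, a E ∈ I :=
    hev.self_of_nhds.1.continuousAt.eventually (hIopen.mem_nhds (ha ▸ ha₀))
  obtain ⟨δ, hδ, hball⟩ := Metric.eventually_nhds_iff_ball.mp (hev.and haI)
  rw [Real.ball_eq_Ioo] at hball
  exact ⟨δ, hδ, a, fun E hE => (hball E hE).1.1.contDiffWithinAt, ha, fun E hE =>
    ⟨(hball E hE).2, (hball E hE).1.2.trans hzero⟩⟩
end

section
/- Let ρ₀ ∈ ℝ and let q : [ρ₀, ∞) → ℝ be continuous, and suppose there exists R ≥ ρ₀ such that q(ρ) > 0 for all ρ ≥ R. Then every nontrivial solution u of u'' = q u on [ρ₀, ∞) has only finitely many zeros in [ρ₀, ∞); that is, the set {ρ ≥ ρ₀ : u(ρ) = 0} is finite. -/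
open Set

open Filter Topology

/-- A solution of `u'' = q u` on `[ρ₀, ∞)` with vanishing Cauchy data at one point is zero. -/
theorem eq_zero_of_cauchy_data_eq_zero_s12 {ρ₀ : ℝ} {q u u' : ℝ → ℝ}
    (hq : ContinuousOn q (Ici ρ₀))
    (hu : ∀ t ∈ Ici ρ₀, HasDerivWithinAt u (u' t) (Ici ρ₀) t)
    (hu' : ∀ t ∈ Ici ρ₀, HasDerivWithinAt u' (q t * u t) (Ici ρ₀) t)
    {z : ℝ} (hz : z ∈ Ici ρ₀) (huz : u z = 0) (hu'z : u' z = 0)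
    {t : ℝ} (ht : t ∈ Ici ρ₀) : u t = 0 := by
  have hsub : Icc ρ₀ (max z t) ⊆ Ici ρ₀ := Icc_subset_Ici_self
  obtain ⟨M, hM⟩ := isCompact_Icc.exists_bound_of_continuousOn (hq.mono hsub)
  have hzI : z ∈ Icc ρ₀ (max z t) := ⟨hz, le_max_left _ _⟩
  have htI : t ∈ Icc ρ₀ (max z t) := ⟨ht, le_max_right _ _⟩
  have hderiv (c : ℝ) : ∀ x ∈ Icc ρ₀ (max z t),
      HasDerivWithinAt (fun s => (u s ^ 2 + u' s ^ 2) * Real.exp (c * s))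
        ((2 * u x * u' x * (1 + q x) + c * (u x ^ 2 + u' x ^ 2)) * Real.exp (c * x))
        (Icc ρ₀ (max z t)) x := by
    intro x hx
    have h1 := (hu x (hsub hx)).mono hsub
    have h2 := (hu' x (hsub hx)).mono hsub
    have h3 := ((hasDerivAt_id x).const_mul c).exp.hasDerivWithinAt (s := Icc ρ₀ (max z t))
    refine (((h1.pow 2).add (h2.pow 2)).mul h3).congr_deriv ?_
    simp
    ring
  have hbound : ∀ x ∈ Icc ρ₀ (max z t),
      |2 * u x * u' x * (1 + q x)| ≤ (1 + M) * (u x ^ 2 + u' x ^ 2) := by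
    intro x hx
    have hqx : |1 + q x| ≤ 1 + M := by
      refine (abs_add_le _ _).trans ?_
      simpa using hM x hx
    have h2 : |2 * u x * u' x| ≤ u x ^ 2 + u' x ^ 2 := by
      rw [abs_le]
      constructor <;> nlinarith [sq_nonneg (u x + u' x), sq_nonneg (u x - u' x)]
    rw [abs_mul, mul_comm (1 + M)]
    exact mul_le_mul h2 hqx (abs_nonneg _) (by positivity)
  have henergy : u t ^ 2 + u' t ^ 2 ≤ 0 := by
    rcases le_total z t with h | h
    · have hanti := antitoneOn_of_hasDerivWithinAt_nonpos (convex_Icc ρ₀ (max z t))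
        (fun x hx => (hderiv (-(1 + M)) x hx).continuousWithinAt)
        (fun x hx => (hderiv (-(1 + M)) x (interior_subset hx)).mono interior_subset)
        (fun x hx => mul_nonpos_of_nonpos_of_nonneg
          (by linarith [(abs_le.1 (hbound x (interior_subset hx))).2]) (Real.exp_pos _).le)
      have := hanti hzI htI h
      simp only [huz, hu'z] at this
      exact nonpos_of_mul_nonpos_left (by simpa using this) (Real.exp_pos (-(1 + M) * t))
    · have hmono := monotoneOn_of_hasDerivWithinAt_nonneg (convex_Icc ρ₀ (max z t))
        (fun x hx => (hderiv (1 + M) x hx).continuousWithinAt)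
        (fun x hx => (hderiv (1 + M) x (interior_subset hx)).mono interior_subset)
        (fun x hx => mul_nonneg
          (by linarith [(abs_le.1 (hbound x (interior_subset hx))).1]) (Real.exp_pos _).le)
      have := hmono htI hzI h
      simp only [huz, hu'z] at this
      exact nonpos_of_mul_nonpos_left (by simpa using this) (Real.exp_pos ((1 + M) * t))
  nlinarith [sq_nonneg (u t), sq_nonneg (u' t)]

/-- If `q > 0` on `[R, ∞)` and a solution of `u'' = q u` has two zeros there, then `u` and `u'`
vanish simultaneously at a point between them. -/
theorem exists_cauchy_data_eq_zero_of_two_zeros {R : ℝ} {q u u' : ℝ → ℝ}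
    (hqpos : ∀ ρ, R ≤ ρ → 0 < q ρ)
    (hu : ∀ t ∈ Ici R, HasDerivWithinAt u (u' t) (Ici R) t)
    (hu' : ∀ t ∈ Ici R, HasDerivWithinAt u' (q t * u t) (Ici R) t)
    {a b : ℝ} (ha : R ≤ a) (hab : a < b) (hua : u a = 0) (hub : u b = 0) :
    ∃ z ∈ Ioo a b, u z = 0 ∧ u' z = 0 := by
  have hderiv : ∀ x ∈ Ici R, HasDerivWithinAt (fun s => u s * u' s)
      (u' x ^ 2 + q x * u x ^ 2) (Ici R) x := fun x hx =>
    ((hu x hx).mul (hu' x hx)).congr_deriv (by ring)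
  have hmono := monotoneOn_of_hasDerivWithinAt_nonneg (convex_Ici R)
    (fun x hx => (hderiv x hx).continuousWithinAt)
    (fun x hx => (hderiv x (interior_subset hx)).mono interior_subset)
    (fun x hx => by
      have := hqpos x (interior_subset hx)
      positivity)
  have hzero : ∀ x ∈ Ioo a b, u x * u' x = 0 := fun x hx => by
    have h1 := hmono ha (ha.trans hx.1.le) hx.1.le
    have h2 := hmono (ha.trans hx.1.le) (ha.trans hab.le) hx.2.le
    simp only [hua, hub, zero_mul] at h1 h2
    exact le_antisymm h2 h1
  obtain ⟨z, hz⟩ := exists_between hab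
  have hzR : R < z := ha.trans_lt hz.1
  have hd := (hderiv z hzR.le).hasDerivAt (Ici_mem_nhds hzR)
  have hd0 : HasDerivAt (fun s => u s * u' s) 0 z :=
    (hasDerivAt_const z (0 : ℝ)).congr_of_eventuallyEq
      (eventually_of_mem (Ioo_mem_nhds hz.1 hz.2) hzero)
  have hsum := hd.unique hd0
  have hqz := hqpos z hzR.le
  have h1 : q z * u z ^ 2 = 0 := by
    nlinarith [sq_nonneg (u' z), mul_nonneg hqz.le (sq_nonneg (u z))]
  have h2 : u' z ^ 2 = 0 := by linarith
  refine ⟨z, hz, ?_, by simpa using h2⟩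
  simpa [hqz.ne'] using h1

/-- Let q be continuous on [ρ₀, ∞) with q > 0 on [R, ∞) for some R ≥ ρ₀. Then
every nontrivial solution u of u'' = q u on [ρ₀, ∞) has finitely many zeros in [ρ₀, ∞). -/
theorem stmt_12 (ρ₀ R : ℝ) (hR : ρ₀ ≤ R) (q : ℝ → ℝ)
    (hq : ContinuousOn q (Ici ρ₀))
    (hqpos : ∀ ρ, R ≤ ρ → 0 < q ρ)
    (u u' : ℝ → ℝ)
    (hu : ∀ t ∈ Ici ρ₀, HasDerivWithinAt u (u' t) (Ici ρ₀) t)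
    (hu'cont : ContinuousOn u' (Ici ρ₀))
    (hu' : ∀ t ∈ Ici ρ₀, HasDerivWithinAt u' (q t * u t) (Ici ρ₀) t)
    (hnt : ∃ t ∈ Ici ρ₀, u t ≠ 0) :
    {ρ ∈ Ici ρ₀ | u ρ = 0}.Finite := by
  have hne : ∀ z ∈ Ici ρ₀, u z = 0 → u' z ≠ 0 := fun z hz h h' => by
    obtain ⟨t, ht, hut⟩ := hnt
    exact hut (eq_zero_of_cauchy_data_eq_zero_s12 hq hu hu' hz h h' ht)
  have hsub : Ici R ⊆ Ici ρ₀ := Ici_subset_Ici.2 hR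
  have htail : {ρ ∈ Ici R | u ρ = 0}.Subsingleton := by
    have key : ∀ a b, R ≤ a → a < b → u a = 0 → u b = 0 → False := fun a b ha hab hua hub => by
      obtain ⟨z, hz, h, h'⟩ := exists_cauchy_data_eq_zero_of_two_zeros hqpos
        (fun t ht => (hu t (hsub ht)).mono hsub) (fun t ht => (hu' t (hsub ht)).mono hsub)
        ha hab hua hub
      exact hne z (hsub (ha.trans hz.1.le)) h h'
    rintro a ⟨ha, hua⟩ b ⟨hb, hub⟩
    rcases lt_trichotomy a b with h | h | h
    · exact (key a b ha h hua hub).elim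
    · exact h
    · exact (key b a hb h hub hua).elim
  have hcompact : {ρ ∈ Icc ρ₀ R | u ρ = 0}.Finite := by
    by_contra hinf
    obtain ⟨z, hz, hacc⟩ := Set.Infinite.exists_accPt_of_subset_isCompact hinf isCompact_Icc
      (sep_subset _ _)
    have hfreq : ∃ᶠ y in 𝓝[Ici ρ₀ \ {z}] z, u y = 0 := by
      rw [accPt_iff_frequently] at hacc
      rw [frequently_nhdsWithin_iff]
      exact hacc.mono fun y hy => ⟨hy.2.2, hy.2.1.1, hy.1⟩
    have huz : u z = 0 := by
      by_contra h
      have hcont : ContinuousWithinAt u (Ici ρ₀ \ {z}) z :=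
        (hu z hz.1).continuousWithinAt.mono sdiff_subset
      exact hfreq (hcont.eventually_ne h)
    exact hfreq ((hu z hz.1).eventually_ne (hne z hz.1 huz))
  refine (hcompact.union htail.finite).subset ?_
  rintro x ⟨hx, hux⟩
  rcases le_total x R with h | h
  · exact Or.inl ⟨⟨hx, h⟩, hux⟩
  · exact Or.inr ⟨h, hux⟩
end

section
/- Let 0 < c < 1/4, ε > 0, a ∈ ℝ, and let B, 𝒳 : [2, ∞) → ℝ be continuous and bounded. Then there exists ρ₀ ≥ 2 such that for every E > 0 and every μ ≥ 0, every nontrivial solution u of u'' = q u on (ρ₀, ∞), where q(ρ) = E + μ e^(−2ρ) (1 + e^(−ρ) B(ρ)) − c ρ⁻² + a ρ⁻² (log ρ)^(−ε) + e^(−ρ) 𝒳(ρ), has at most one zero in (ρ₀, ∞). -/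
open Set

/-- A solution of `u'' = q u` with vanishing Cauchy data at an interior point is zero. -/
theorem eqOn_zero_of_cauchyData_eq_zero {r m : ℝ} {q u u' : ℝ → ℝ}
    (hq : ContinuousOn q (Ioi r))
    (hu : ∀ x ∈ Ioi r, HasDerivAt u (u' x) x)
    (hu' : ∀ x ∈ Ioi r, HasDerivAt u' (q x * u x) x)
    (hm : m ∈ Ioi r) (hum : u m = 0) (hum' : u' m = 0) :
    ∀ x ∈ Ioi r, u x = 0 := by
  intro x hx
  simp only [mem_Ioi] at hm hx
  obtain ⟨α, hα, hαmx⟩ := exists_between (lt_min hm hx)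
  obtain ⟨hαm, hαx⟩ := lt_min_iff.1 hαmx
  obtain ⟨β, hβ⟩ := exists_gt (max m x)
  obtain ⟨hβm, hβx⟩ := max_lt_iff.1 hβ
  have hsub : Icc α β ⊆ Ioi r := fun y hy => lt_of_lt_of_le hα hy.1
  obtain ⟨K, hK⟩ := isCompact_Icc.exists_bound_of_continuousOn (hq.mono hsub)
  have hLip : ∀ t ∈ Ioo α β,
      LipschitzOnWith (max 1 K).toNNReal (fun p : ℝ × ℝ => (p.2, q t * p.1)) univ := by
    intro t ht
    refine LipschitzOnWith.of_dist_le_mul fun p _ p' _ => ?_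
    have hqt : |q t| ≤ K := hK t (Ioo_subset_Icc_self ht)
    rw [Real.coe_toNNReal _ (le_max_of_le_left zero_le_one), Prod.dist_eq, Prod.dist_eq]
    simp only [Real.dist_eq, ← mul_sub, abs_mul]
    refine max_le ?_ ?_
    · calc |p.2 - p'.2| = 1 * |p.2 - p'.2| := (one_mul _).symm
        _ ≤ max 1 K * max |p.1 - p'.1| |p.2 - p'.2| := by
          gcongr
          exacts [le_max_left _ _, le_max_right _ _]
    · gcongr
      exacts [hqt.trans (le_max_right _ _), le_max_left _ _]
  have heq := ODE_solution_unique_of_mem_Ioo (f := fun t => (u t, u' t)) (g := fun _ => (0, 0))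
    hLip ⟨hαm, hβm⟩
    (fun t ht => ⟨(hu t (hsub (Ioo_subset_Icc_self ht))).prodMk
      (hu' t (hsub (Ioo_subset_Icc_self ht))), mem_univ _⟩)
    (fun t _ => ⟨by
      simpa [Prod.mk_zero_zero] using hasDerivAt_const t (0 : ℝ × ℝ), mem_univ _⟩)
    (by simp [hum, hum']) ⟨hαx, hβx⟩
  exact congrArg Prod.fst heq

/-- Sturm comparison with the solution `√x` of the critical Hardy equation: if
`q > -1 / (4 x ^ 2)`, then a nontrivial solution of `u'' = q u` has at most one zero. -/
theorem subsingleton_zeros_of_hardy_lt {r : ℝ} {q u u' : ℝ → ℝ} (hr : 0 ≤ r)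
    (hq : ContinuousOn q (Ioi r))
    (hlt : ∀ x ∈ Ioi r, 0 < q x + 1 / 4 * (x ^ 2)⁻¹)
    (hu : ∀ x ∈ Ioi r, HasDerivAt u (u' x) x)
    (hu' : ∀ x ∈ Ioi r, HasDerivAt u' (q x * u x) x)
    (hne : ∃ x ∈ Ioi r, u x ≠ 0) :
    Set.Subsingleton {x ∈ Ioi r | u x = 0} := by
  obtain ⟨p, hp, hup⟩ := hne
  have hF : ∀ x ∈ Ioi r, HasDerivAt (fun y => u y * u' y - u y ^ 2 * (2 * y)⁻¹)
      ((u' x - u x * (2 * x)⁻¹) ^ 2 + (q x + 1 / 4 * (x ^ 2)⁻¹) * u x ^ 2) x := by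
    intro x hx
    have hx0 : x ≠ 0 := (hr.trans_lt hx).ne'
    have hinv : HasDerivAt (fun y : ℝ => (2 * y)⁻¹) (-(2 * 1) / (2 * x) ^ 2) x :=
      ((hasDerivAt_id x).const_mul 2).fun_inv (by simpa using hx0)
    refine (((hu x hx).mul (hu' x hx)).sub (((hu x hx).fun_pow 2).mul hinv)).congr_deriv ?_
    field_simp
    ring
  have hnot : ∀ s ∈ Ioi r, ∀ t ∈ Ioi r, u s = 0 → u t = 0 → ¬ s < t := by
    intro s hs t ht hus hut hst
    have hsub : Icc s t ⊆ Ioi r := fun y hy => lt_of_lt_of_le hs hy.1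
    have hmono : MonotoneOn (fun y => u y * u' y - u y ^ 2 * (2 * y)⁻¹) (Icc s t) := by
      refine monotoneOn_of_hasDerivWithinAt_nonneg (convex_Icc s t)
        (HasDerivAt.continuousOn fun x hx => hF x (hsub hx))
        (fun x hx => (hF x (hsub (interior_subset hx))).hasDerivWithinAt) fun x hx => ?_
      have := hlt x (hsub (interior_subset hx))
      positivity
    obtain ⟨m, hm⟩ := exists_between hst
    have hmr : m ∈ Ioi r := hsub (Ioo_subset_Icc_self hm)
    have hzero : (fun y => u y * u' y - u y ^ 2 * (2 * y)⁻¹) =ᶠ[nhds m] fun _ => 0 := by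
      filter_upwards [Ioo_mem_nhds hm.1 hm.2] with y hy
      have hy' := Ioo_subset_Icc_self hy
      have h1 := hmono (left_mem_Icc.2 hst.le) hy' hy'.1
      have h2 := hmono hy' (right_mem_Icc.2 hst.le) hy'.2
      simp only [hus, hut] at h1 h2
      linarith
    have hderiv := (hF m hmr).unique ((hasDerivAt_const m (0 : ℝ)).congr_of_eventuallyEq hzero)
    have hpos := hlt m hmr
    have hum : u m = 0 := by
      by_contra h
      have : 0 < (q m + 1 / 4 * (m ^ 2)⁻¹) * u m ^ 2 := by positivity
      nlinarith [sq_nonneg (u' m - u m * (2 * m)⁻¹)]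
    have hum' : u' m = 0 := by simpa [hum] using hderiv
    exact hup (eqOn_zero_of_cauchyData_eq_zero hq hu hu' hmr hum hum' p hp)
  rintro s ⟨hs, hus⟩ t ⟨ht, hut⟩
  exact le_antisymm (not_lt.1 (hnot t ht s hs hut hus)) (not_lt.1 (hnot s hs t ht hus hut))

/-- For 0 < c < 1/4, ε > 0, a ∈ ℝ, and B, 𝒳 continuous and bounded on
[2, ∞), there exists ρ₀ ≥ 2 such that for every E > 0 and μ ≥ 0, every nontrivial solution
of u'' = q u on (ρ₀, ∞), with
q(ρ) = E + μ e^(−2ρ)(1 + e^(−ρ)B(ρ)) − c ρ⁻² + a ρ⁻² (log ρ)^(−ε) + e^(−ρ)𝒳(ρ),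
has at most one zero in (ρ₀, ∞). -/
theorem stmt_13 (c ε a : ℝ) (hc0 : 0 < c) (hc : c < 1/4) (hε : 0 < ε)
    (B 𝒳 : ℝ → ℝ)
    (hB : ContinuousOn B (Ici 2)) (hBbd : ∃ M, ∀ ρ ∈ Ici (2:ℝ), |B ρ| ≤ M)
    (h𝒳 : ContinuousOn 𝒳 (Ici 2)) (h𝒳bd : ∃ M, ∀ ρ ∈ Ici (2:ℝ), |𝒳 ρ| ≤ M) :
    ∃ ρ₀ : ℝ, 2 ≤ ρ₀ ∧ ∀ E > (0:ℝ), ∀ μ ≥ (0:ℝ), ∀ u u' : ℝ → ℝ,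
      (∀ ρ ∈ Ioi ρ₀, HasDerivAt u (u' ρ) ρ) →
      (∀ ρ ∈ Ioi ρ₀, HasDerivAt u'
        ((E + μ * Real.exp (-2 * ρ) * (1 + Real.exp (-ρ) * B ρ)
            - c * (ρ ^ 2)⁻¹ + a * (ρ ^ 2)⁻¹ * Real.log ρ ^ (-ε)
            + Real.exp (-ρ) * 𝒳 ρ) * u ρ) ρ) →
      (∃ ρ ∈ Ioi ρ₀, u ρ ≠ 0) →
      Set.Subsingleton {ρ ∈ Ioi ρ₀ | u ρ = 0} := by
  obtain ⟨MB, hMB⟩ := hBbd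
  obtain ⟨MX, hMX⟩ := h𝒳bd
  have hexp : Filter.Tendsto (fun x : ℝ => MB * Real.exp (-x)) Filter.atTop (nhds 0) := by
    simpa using (Real.tendsto_exp_neg_atTop_nhds_zero).const_mul MB
  have herr : Filter.Tendsto
      (fun x : ℝ => |a| * Real.log x ^ (-ε) + MX * (x ^ 2 * Real.exp (-x)))
      Filter.atTop (nhds 0) := by
    simpa using (((tendsto_rpow_neg_atTop hε).comp Real.tendsto_log_atTop).const_mul |a|).add
      ((Real.tendsto_pow_mul_exp_neg_atTop_nhds_zero 2).const_mul MX)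
  obtain ⟨R, hR⟩ := Filter.eventually_atTop.1
    ((hexp.eventually_lt_const one_pos).and (herr.eventually_lt_const (sub_pos.2 hc)))
  refine ⟨max 2 R, le_max_left _ _, fun E hE μ hμ u u' hu hu' hne => ?_⟩
  refine subsingleton_zeros_of_hardy_lt (zero_le_two.trans (le_max_left 2 R)) ?_ ?_ hu hu' hne
  · have hsub : Ioi (max 2 R) ⊆ Ici 2 := fun x hx => ((le_max_left 2 R).trans_lt hx).le
    have hB' := hB.mono hsub
    have hX' := h𝒳.mono hsub
    have hsq : ∀ x ∈ Ioi (max 2 R), x ^ 2 ≠ 0 := fun x hx =>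
      pow_ne_zero 2 (zero_lt_two.trans_le (hsub hx)).ne'
    have hinv : ContinuousOn (fun x : ℝ => (x ^ 2)⁻¹) (Ioi (max 2 R)) :=
      (continuous_pow 2).continuousOn.inv₀ hsq
    have hlog : ContinuousOn (fun x : ℝ => Real.log x ^ (-ε)) (Ioi (max 2 R)) :=
      (Real.continuousOn_log.mono fun x hx => (zero_lt_two.trans_le (hsub hx)).ne').rpow_const
        fun x hx => Or.inl (Real.log_pos (one_lt_two.trans_le (hsub hx))).ne'
    fun_prop
  · intro x hx
    obtain ⟨hx2, hxR⟩ := max_lt_iff.1 (mem_Ioi.1 hx)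
    obtain ⟨h1, h2⟩ := hR x hxR.le
    have hx0 : 0 < x := zero_lt_two.trans hx2
    have hμpos : 0 ≤ μ * Real.exp (-2 * x) * (1 + Real.exp (-x) * B x) := by
      have hB0 := mul_le_mul_of_nonneg_left (neg_le_of_abs_le (hMB x hx2.le))
        (Real.exp_pos (-x)).le
      have : 0 ≤ 1 + Real.exp (-x) * B x := by linarith
      positivity
    have hlog : 0 < Real.log x ^ (-ε) := Real.rpow_pos_of_pos (Real.log_pos (by linarith)) _
    have ha := mul_le_mul_of_nonneg_right (neg_abs_le a) hlog.le
    have hX := mul_le_mul_of_nonneg_left (neg_le_of_abs_le (hMX x hx2.le))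
      (mul_pos (pow_pos hx0 2) (Real.exp_pos (-x))).le
    have hmain : 0 ≤ (x ^ 2)⁻¹ * (1 / 4 - c + a * Real.log x ^ (-ε)
        + x ^ 2 * Real.exp (-x) * 𝒳 x) :=
      mul_nonneg (by positivity) (by linarith)
    have hexpand : (x ^ 2)⁻¹ * (1 / 4 - c + a * Real.log x ^ (-ε)
        + x ^ 2 * Real.exp (-x) * 𝒳 x) = 1 / 4 * (x ^ 2)⁻¹ - c * (x ^ 2)⁻¹
        + a * (x ^ 2)⁻¹ * Real.log x ^ (-ε) + Real.exp (-x) * 𝒳 x := by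
      field_simp
    linarith
end

section
/- Let E > 0, c > 0, δ < 2, ε > 0, a ∈ ℝ, ρ₁ > 1, and let 𝒳 : [ρ₁, ∞) → ℝ be continuous and bounded. Suppose u is a solution of u'' = q u on [ρ₁, ∞), where q(ρ) = −E − c ρ^(δ−2) + a ρ^(δ−2) (log ρ)^(−ε) + e^(−ρ) 𝒳(ρ), and u is square-integrable on [ρ₁, ∞). Then u is identically zero on [ρ₁, ∞). -/
open Set MeasureTheory

/-- A function with nonnegative derivative on `[a, ∞)` is bounded below there by its value at
`a`. -/
lemma le_of_hasDerivAt_nonneg {f f' : ℝ → ℝ} {a : ℝ}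
    (hf : ∀ t, a ≤ t → HasDerivAt f (f' t) t) (hf' : ∀ t, a ≤ t → 0 ≤ f' t)
    {t : ℝ} (ht : a ≤ t) : f a ≤ f t := by
  have hmono : MonotoneOn f (Ici a) := by
    refine monotoneOn_of_hasDerivWithinAt_nonneg (f' := f') (convex_Ici a)
      (fun x hx => (hf x hx).continuousAt.continuousWithinAt) ?_ ?_
    · intro x hx
      exact (hf x (interior_subset hx)).hasDerivWithinAt
    · intro x hx
      exact hf' x (interior_subset hx)
  exact hmono self_mem_Ici ht ht

/-- A function whose derivative is at least `k` on `[a, ∞)` grows at least linearly. -/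
lemma add_mul_le_of_le_hasDerivAt {f f' : ℝ → ℝ} {a k : ℝ}
    (hf : ∀ t, a ≤ t → HasDerivAt f (f' t) t) (hf' : ∀ t, a ≤ t → k ≤ f' t)
    {t : ℝ} (ht : a ≤ t) : f a + k * (t - a) ≤ f t := by
  have h := le_of_hasDerivAt_nonneg (f := fun s => f s - k * s) (f' := fun s => f' s - k * 1)
    (fun s hs => (hf s hs).sub ((hasDerivAt_id s).const_mul k))
    (fun s hs => by linarith [hf' s hs]) ht
  linarith

/-- If the energy `v² / w + u²` is nonzero at `r`, it stays bounded below by a positive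
constant, provided `w` is nonincreasing and the perturbation `h` decays exponentially. -/
lemma exists_pos_le_energy {E M r : ℝ} {w w' h u v : ℝ → ℝ} (hE : 0 < E) (hM : 0 ≤ M)
    (hw : ∀ t, r ≤ t → HasDerivAt w (w' t) t) (hw' : ∀ t, r ≤ t → w' t ≤ 0)
    (hEw : ∀ t, r ≤ t → E ≤ w t) (hh : ∀ t, r ≤ t → |h t| ≤ M * Real.exp (-t))
    (hu : ∀ t, r ≤ t → HasDerivAt u (v t) t)
    (hv : ∀ t, r ≤ t → HasDerivAt v ((-w t + h t) * u t) t)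
    (hpos : 0 < v r ^ 2 / w r + u r ^ 2) :
    ∃ κ, 0 < κ ∧ ∀ t, r ≤ t → κ ≤ v t ^ 2 / w t + u t ^ 2 := by
  set C := M * (1 + 1 / E) with hC
  have hC0 : 0 ≤ C := by positivity
  refine ⟨(v r ^ 2 / w r + u r ^ 2) * Real.exp (-(C * Real.exp (-r))), by positivity,
    fun t ht => ?_⟩
  have key := le_of_hasDerivAt_nonneg
    (f := fun s => (v s ^ 2 / w s + u s ^ 2) * Real.exp (-(C * Real.exp (-s))))
    (f' := fun s => ((2 * (h s * (u s * v s)) - v s ^ 2 * w' s / w s) / w s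
      + C * Real.exp (-s) * (v s ^ 2 / w s + u s ^ 2)) * Real.exp (-(C * Real.exp (-s))))
    (a := r) ?_ ?_ ht
  · refine key.trans (mul_le_of_le_one_right ?_ ?_)
    · have := hE.trans_le (hEw t ht)
      positivity
    · rw [Real.exp_le_one_iff]
      have := Real.exp_pos (-t)
      nlinarith
  · intro s hs
    have hws : w s ≠ 0 := (hE.trans_le (hEw s hs)).ne'
    have h1 := (((hv s hs).pow 2).div (hw s hs) hws).add ((hu s hs).pow 2)
    have h2 := ((((hasDerivAt_id s).neg).exp.const_mul C).neg).exp
    refine (h1.mul h2).congr_deriv ?_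
    simp only [Pi.add_apply, Pi.div_apply, Pi.pow_apply, Pi.neg_apply, id]
    field_simp
    ring
  · intro s hs
    have hws : 0 < w s := hE.trans_le (hEw s hs)
    refine mul_nonneg ?_ (Real.exp_pos _).le
    have h1 : 0 ≤ -(v s ^ 2 * w' s / w s) := by
      rw [← neg_div, ← mul_neg]
      exact div_nonneg (mul_nonneg (sq_nonneg _) (by linarith [hw' s hs])) hws.le
    have h2 : -(M * Real.exp (-s) * (u s ^ 2 + v s ^ 2)) ≤ 2 * (h s * (u s * v s)) := by
      have h3 : |2 * (h s * (u s * v s))| ≤ M * Real.exp (-s) * (u s ^ 2 + v s ^ 2) := by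
        have h4 : |2 * (u s * v s)| ≤ u s ^ 2 + v s ^ 2 := by
          rw [abs_le]
          constructor <;> nlinarith [sq_nonneg (u s + v s), sq_nonneg (u s - v s)]
        calc |2 * (h s * (u s * v s))| = |h s| * |2 * (u s * v s)| := by
              rw [← abs_mul]; ring_nf
          _ ≤ _ := mul_le_mul (hh s hs) h4 (abs_nonneg _) (by positivity)
      exact neg_le_of_abs_le h3
    have h5 : M * Real.exp (-s) * (u s ^ 2 + v s ^ 2) / w s
        ≤ C * Real.exp (-s) * (v s ^ 2 / w s + u s ^ 2) := by
      have h6 : u s ^ 2 / w s ≤ u s ^ 2 / E :=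
        div_le_div_of_nonneg_left (sq_nonneg _) hE (hEw s hs)
      have h7 : (u s ^ 2 + v s ^ 2) / w s ≤ (1 + 1 / E) * (v s ^ 2 / w s + u s ^ 2) := by
        have h8 : 0 ≤ 1 / E * (v s ^ 2 / w s) := by positivity
        have h9 : (1 + 1 / E) * (v s ^ 2 / w s + u s ^ 2)
          = v s ^ 2 / w s + u s ^ 2 / E + u s ^ 2 + 1 / E * (v s ^ 2 / w s) := by ring
        rw [add_div, h9]
        nlinarith [sq_nonneg (u s)]
      calc _ = M * Real.exp (-s) * ((u s ^ 2 + v s ^ 2) / w s) := by ring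
        _ ≤ M * Real.exp (-s) * ((1 + 1 / E) * (v s ^ 2 / w s + u s ^ 2)) := by gcongr
        _ = _ := by rw [hC]; ring
    have h10 : -(M * Real.exp (-s) * (u s ^ 2 + v s ^ 2)) / w s
        ≤ (2 * (h s * (u s * v s)) - v s ^ 2 * w' s / w s) / w s := by
      gcongr
      linarith
    rw [neg_div] at h10
    linarith

/-- A square-integrable solution of `u'' = (-w + h) u`, with `w` bounded, bounded below by
`E > 0` and nonincreasing, and `h` exponentially decaying, has zero Cauchy data. -/
lemma cauchyData_eq_zero_of_sq_integrable {E W M r : ℝ} {w w' h u v : ℝ → ℝ} (hE : 0 < E)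
    (hM : 0 ≤ M)
    (hw : ∀ t, r ≤ t → HasDerivAt w (w' t) t) (hw' : ∀ t, r ≤ t → w' t ≤ 0)
    (hEw : ∀ t, r ≤ t → E ≤ w t) (hwW : ∀ t, r ≤ t → w t ≤ W)
    (hr : 0 ≤ r) (hh : ∀ t, r ≤ t → |h t| ≤ M * Real.exp (-t))
    (hu : ∀ t, r ≤ t → HasDerivAt u (v t) t)
    (hv : ∀ t, r ≤ t → HasDerivAt v ((-w t + h t) * u t) t)
    (hL2 : IntegrableOn (fun t => u t ^ 2) (Ici r)) :
    u r = 0 ∧ v r = 0 := by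
  have hwr : 0 < w r := hE.trans_le (hEw r le_rfl)
  by_contra hne
  have hpos : 0 < v r ^ 2 / w r + u r ^ 2 := by
    by_cases h0 : u r = 0
    · have : v r ≠ 0 := fun h1 => hne ⟨h0, h1⟩
      positivity
    · positivity
  obtain ⟨κ, hκ, hκF⟩ := exists_pos_le_energy hE hM hw hw' hEw hh hu hv hpos
  set B := ∫ t in Ici r, u t ^ 2 with hB
  set J : ℝ → ℝ := fun t => ∫ s in r..t, u s ^ 2 with hJ
  have hcont : ContinuousOn (fun t => u t ^ 2) (Ici r) := fun t ht =>
    ((hu t ht).continuousAt.pow 2).continuousWithinAt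
  have hJB : ∀ t, r ≤ t → J t ≤ B := by
    intro t ht
    rw [hJ, hB]
    simp only
    rw [intervalIntegral.integral_of_le ht]
    exact setIntegral_mono_set hL2 (Filter.Eventually.of_forall fun s => sq_nonneg (u s))
      (LE.le.eventuallyLE fun s hs => hs.1.le)
  obtain ⟨D, hD⟩ : ∃ D, D = 2 * W + M := ⟨_, rfl⟩
  have hD0 : 0 ≤ D := by linarith [hEw r le_rfl, hwW r le_rfl]
  have hJd : ∀ t, r + 1 ≤ t → HasDerivAt J (u t ^ 2) t := by
    intro t ht
    have hrt : r < t := by linarith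
    refine intervalIntegral.integral_hasDerivAt_right ?_ ?_ ?_
    · exact (hcont.mono (by rw [uIcc_of_le hrt.le]; exact Icc_subset_Ici_self)).intervalIntegrable
    · exact (hcont.mono Ioi_subset_Ici_self).stronglyMeasurableAtFilter isOpen_Ioi t hrt
    · exact (hu t hrt.le).continuousAt.pow 2
  have hG : ∀ t, r + 1 ≤ t →
      u (r + 1) * v (r + 1) + D * J (r + 1) + E * κ * (t - (r + 1)) ≤ u t * v t + D * J t := by
    intro t ht
    refine add_mul_le_of_le_hasDerivAt (f := fun s => u s * v s + D * J s)
      (fun s hs => ((hu s (by linarith)).mul (hv s (by linarith))).add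
        ((hJd s hs).const_mul D)) ?_ ht
    intro s hs
    have hs' : r ≤ s := by linarith
    have hws : 0 < w s := hE.trans_le (hEw s hs')
    have h1 : w s * κ ≤ v s ^ 2 + w s * u s ^ 2 := by
      have := mul_le_mul_of_nonneg_left (hκF s hs') hws.le
      rwa [mul_add, mul_div_cancel₀ _ hws.ne'] at this
    have h2 : E * κ ≤ w s * κ := mul_le_mul_of_nonneg_right (hEw s hs') hκ.le
    have h3 : -M ≤ h s := by
      have h4 : Real.exp (-s) ≤ 1 := Real.exp_le_one_iff.2 (by linarith)
      have := neg_le_of_abs_le (hh s hs')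
      nlinarith
    have h5 : 0 ≤ (D - 2 * w s + h s) * u s ^ 2 :=
      mul_nonneg (by linarith [hwW s hs']) (sq_nonneg _)
    nlinarith
  have hEκ : 0 < E * κ := mul_pos hE hκ
  obtain ⟨T, hT, hTG⟩ : ∃ T, r + 1 ≤ T ∧ ∀ t, T ≤ t → 1 ≤ u t * v t := by
    set A := (1 + D * B - (u (r + 1) * v (r + 1) + D * J (r + 1))) / (E * κ) with hA
    refine ⟨r + 1 + |A|, by linarith [abs_nonneg A], fun t ht => ?_⟩
    have h1 := hG t (by linarith [abs_nonneg A])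
    have h2 := mul_le_mul_of_nonneg_left (hJB t (by linarith [abs_nonneg A])) hD0
    have h3 : E * κ * A ≤ E * κ * (t - (r + 1)) :=
      mul_le_mul_of_nonneg_left (by linarith [le_abs_self A]) hEκ.le
    rw [hA, mul_div_cancel₀ _ hEκ.ne'] at h3
    linarith
  have hsq : ∀ t, T + 1 ≤ t → 1 ≤ u t ^ 2 := by
    intro t ht
    have := add_mul_le_of_le_hasDerivAt (f := fun s => u s ^ 2) (k := 1) (a := T)
      (fun s hs => (hu s (by linarith)).pow 2) (fun s hs => by
        have := hTG s hs
        norm_num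
        linarith) (by linarith : T ≤ t)
    nlinarith [sq_nonneg (u T)]
  have hlin := add_mul_le_of_le_hasDerivAt (f := J) (k := 1) (a := T + 1)
    (t := T + 1 + |B - J (T + 1) + 1|)
    (fun s hs => hJd s (by linarith)) hsq (by linarith [abs_nonneg (B - J (T + 1) + 1)])
  have := hJB (T + 1 + |B - J (T + 1) + 1|) (by linarith [abs_nonneg (B - J (T + 1) + 1)])
  linarith [le_abs_self (B - J (T + 1) + 1)]

/-- Backward uniqueness for `u'' = q u`: zero Cauchy data at the right endpoint force the
solution to vanish. -/
lemma eq_zero_of_cauchyData_eq_zero_right {a b : ℝ} {q u v : ℝ → ℝ}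
    (hq : ContinuousOn q (Icc a b))
    (hu : ∀ t ∈ Icc a b, HasDerivWithinAt u (v t) (Icc a b) t)
    (hv : ∀ t ∈ Icc a b, HasDerivWithinAt v (q t * u t) (Icc a b) t)
    (hub : u b = 0) (hvb : v b = 0) : ∀ t ∈ Icc a b, u t = 0 := by
  obtain ⟨K, hK⟩ := isCompact_Icc.exists_bound_of_continuousOn hq
  set f : ℝ → ℝ := fun t => (u t ^ 2 + v t ^ 2) * Real.exp ((1 + K) * t) with hf
  have hfd : ∀ t ∈ Icc a b, HasDerivWithinAt f
      ((2 * (u t * v t) * (1 + q t) + (1 + K) * (u t ^ 2 + v t ^ 2)) * Real.exp ((1 + K) * t))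
      (Icc a b) t := by
    intro t ht
    have h2 := (((hasDerivAt_id t).const_mul (1 + K)).exp).hasDerivWithinAt (s := Icc a b)
    refine ((((hu t ht).pow 2).add ((hv t ht).pow 2)).mul h2).congr_deriv ?_
    simp only [Pi.add_apply, Pi.pow_apply, id]
    ring
  have hmono : MonotoneOn f (Icc a b) := by
    refine monotoneOn_of_hasDerivWithinAt_nonneg (convex_Icc a b)
      (fun t ht => (hfd t ht).continuousWithinAt)
      (fun t ht => (hfd t (interior_subset ht)).mono interior_subset) ?_
    intro t ht
    have hKt := hK t (interior_subset ht)
    rw [Real.norm_eq_abs, abs_le] at hKt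
    refine mul_nonneg ?_ (Real.exp_pos _).le
    nlinarith [mul_nonneg (by linarith [hKt.1] : 0 ≤ K + q t + 2) (sq_nonneg (u t + v t)),
      mul_nonneg (by linarith [hKt.2] : 0 ≤ K - q t) (sq_nonneg (u t - v t))]
  intro t ht
  have h1 : f t ≤ f b := hmono ht ⟨ht.1.trans ht.2, le_rfl⟩ ht.2
  have h2 : f b = 0 := by simp [hf, hub, hvb]
  rw [h2] at h1
  have h3 : u t ^ 2 + v t ^ 2 ≤ 0 := by
    by_contra! h4
    exact absurd h1 (not_le.2 (mul_pos h4 (Real.exp_pos _)))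
  nlinarith [sq_nonneg (u t), sq_nonneg (v t)]

/-- Negative powers of the logarithm tend to zero at infinity. -/
lemma tendsto_log_rpow_neg_atTop {s : ℝ} (hs : 0 < s) :
    Filter.Tendsto (fun t => Real.log t ^ (-s)) Filter.atTop (nhds 0) :=
  (tendsto_rpow_neg_atTop hs).comp Real.tendsto_log_atTop

/-- Let E > 0, c > 0, δ < 2, ε > 0, a ∈ ℝ, ρ₁ > 1 and 𝒳 continuous and
bounded on [ρ₁, ∞). If u solves u'' = q u on [ρ₁, ∞), where
q(ρ) = −E − c ρ^(δ−2) + a ρ^(δ−2)(log ρ)^(−ε) + e^(−ρ)𝒳(ρ), and u is square-integrable on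
[ρ₁, ∞), then u is identically zero on [ρ₁, ∞). -/
theorem stmt_14 (E c δ ε a ρ₁ : ℝ) (hE : 0 < E) (hc : 0 < c) (hδ : δ < 2) (hε : 0 < ε)
    (hρ₁ : 1 < ρ₁)
    (𝒳 : ℝ → ℝ) (h𝒳 : ContinuousOn 𝒳 (Ici ρ₁)) (h𝒳bd : ∃ M, ∀ ρ ∈ Ici ρ₁, |𝒳 ρ| ≤ M)
    (u u' : ℝ → ℝ)
    (hu : ∀ ρ ∈ Ici ρ₁, HasDerivWithinAt u (u' ρ) (Ici ρ₁) ρ)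
    (hu'cont : ContinuousOn u' (Ici ρ₁))
    (hu' : ∀ ρ ∈ Ici ρ₁, HasDerivWithinAt u'
      ((-E - c * ρ ^ (δ - 2) + a * ρ ^ (δ - 2) * Real.log ρ ^ (-ε)
          + Real.exp (-ρ) * 𝒳 ρ) * u ρ) (Ici ρ₁) ρ)
    (hL2 : IntegrableOn (fun ρ => u ρ ^ 2) (Ici ρ₁)) :
    ∀ ρ ∈ Ici ρ₁, u ρ = 0 := by
  obtain ⟨M, hM⟩ := h𝒳bd
  have hM0 : 0 ≤ M := (abs_nonneg _).trans (hM ρ₁ self_mem_Ici)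
  have hL0 := tendsto_log_rpow_neg_atTop hε
  have hL1 := tendsto_log_rpow_neg_atTop (by linarith : 0 < ε + 1)
  have hlim1 : Filter.Tendsto (fun t => c - a * Real.log t ^ (-ε)) Filter.atTop (nhds c) := by
    simpa using tendsto_const_nhds.sub (hL0.const_mul a)
  have hlim2 : Filter.Tendsto (fun t => (δ - 2) * (c - a * Real.log t ^ (-ε))
      + a * ε * Real.log t ^ (-(ε + 1))) Filter.atTop (nhds ((δ - 2) * c)) := by
    simpa using (hlim1.const_mul (δ - 2)).add (hL1.const_mul (a * ε))
  have hev := (hlim1.eventually (lt_mem_nhds hc)).and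
    (hlim2.eventually (gt_mem_nhds (mul_neg_of_neg_of_pos (by linarith : δ - 2 < 0) hc)))
  obtain ⟨R, hR⟩ := Filter.eventually_atTop.1 hev
  set w : ℝ → ℝ := fun t => E + t ^ (δ - 2) * (c - a * Real.log t ^ (-ε)) with hw
  set w' : ℝ → ℝ := fun t => t ^ (δ - 3) * ((δ - 2) * (c - a * Real.log t ^ (-ε))
      + a * ε * Real.log t ^ (-(ε + 1))) with hw'
  have hwd : ∀ t, ρ₁ ≤ t → HasDerivAt w (w' t) t := by
    intro t ht
    have ht0 : 0 < t := by linarith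
    have hlog : 0 < Real.log t := Real.log_pos (by linarith)
    have h1 := ((Real.hasDerivAt_log ht0.ne').rpow_const (p := -ε) (Or.inl hlog.ne'))
    have h2 := (Real.hasDerivAt_rpow_const (p := δ - 2) (Or.inl ht0.ne'))
    refine ((h2.mul ((h1.const_mul a).const_sub c)).const_add E).congr_deriv ?_
    have e1 : t ^ (δ - 2) = t ^ (δ - 3) * t := by
      rw [← Real.rpow_add_one ht0.ne']; ring_nf
    have e2 : δ - 2 - 1 = δ - 3 := by ring
    have e3 : -ε - 1 = -(ε + 1) := by ring
    rw [hw', e1, e2, e3]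
    field_simp
  have hdata : ∀ r, ρ₁ < r → R ≤ r → u r = 0 ∧ u' r = 0 := by
    intro r hr hRr
    have hw'neg : ∀ t, r ≤ t → w' t ≤ 0 := fun t ht =>
      mul_nonpos_of_nonneg_of_nonpos (Real.rpow_nonneg (by linarith) _)
        (hR t (hRr.trans ht)).2.le
    have hnhds : ∀ t, r ≤ t → Ici ρ₁ ∈ nhds t := fun t ht => Ici_mem_nhds (by linarith)
    refine cauchyData_eq_zero_of_sq_integrable (W := w r) (w := w) (w' := w')
      (h := fun t => Real.exp (-t) * 𝒳 t) hE hM0 (fun t ht => hwd t (by linarith)) hw'neg ?_ ?_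
      (by linarith) ?_ (fun t ht => (hu t (hr.le.trans ht)).hasDerivAt (hnhds t ht)) ?_
      (hL2.mono_set (Ici_subset_Ici.2 hr.le))
    · intro t ht
      have := mul_nonneg (Real.rpow_nonneg (by linarith : 0 ≤ t) (δ - 2))
        (hR t (hRr.trans ht)).1.le
      simp only [hw]
      linarith
    · intro t ht
      have := le_of_hasDerivAt_nonneg (f := fun s => -w s) (f' := fun s => -w' s)
        (fun s hs => (hwd s (by linarith : ρ₁ ≤ s)).neg)
        (fun s hs => neg_nonneg.2 (hw'neg s hs)) ht
      simpa using this
    · intro t ht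
      rw [abs_mul, Real.abs_exp, mul_comm]
      exact mul_le_mul_of_nonneg_right (hM t (hr.le.trans ht)) (Real.exp_pos _).le
    · intro t ht
      refine ((hu' t (hr.le.trans ht)).hasDerivAt (hnhds t ht)).congr_deriv ?_
      simp only [hw]
      ring
  intro ρ hρ
  set b := max (ρ + 1) R with hb
  have hρb : ρ + 1 ≤ b := le_max_left _ _
  have hρ' : ρ₁ ≤ ρ := hρ
  obtain ⟨hub, hvb⟩ := hdata b (by linarith) (le_max_right _ _)
  have hqcont : ContinuousOn (fun t => -w t + Real.exp (-t) * 𝒳 t) (Icc ρ₁ b) := by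
    refine ContinuousOn.add (fun t ht => (hwd t ht.1).continuousAt.neg.continuousWithinAt) ?_
    exact (Real.continuous_exp.comp continuous_neg).continuousOn.mul
      (h𝒳.mono Icc_subset_Ici_self)
  refine eq_zero_of_cauchyData_eq_zero_right hqcont
    (fun t ht => (hu t ht.1).mono Icc_subset_Ici_self)
    (fun t ht => ((hu' t ht.1).mono Icc_subset_Ici_self).congr_deriv ?_) hub hvb ρ
    ⟨hρ, by linarith⟩
  simp only [hw]
  ring
end

section
/- Let c > 0, δ ∈ (0, 2), ε > 0, a ∈ ℝ, ρ₁ > 1, and let 𝒳 : [ρ₁, ∞) → ℝ be continuous and bounded. Suppose u is a solution of u'' = q u on [ρ₁, ∞), where q(ρ) = −c ρ^(δ−2) + a ρ^(δ−2) (log ρ)^(−ε) + e^(−ρ) 𝒳(ρ), and u is square-integrable on [ρ₁, ∞). Then u is identically zero on [ρ₁, ∞). -/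
open Set MeasureTheory

lemma le_of_hasDerivAt_nonneg_s15 {f f' : ℝ → ℝ} {a b : ℝ} (hab : a ≤ b)
    (hf : ContinuousOn f (Icc a b)) (hd : ∀ x ∈ Ioo a b, HasDerivAt f (f' x) x)
    (h0 : ∀ x ∈ Ioo a b, 0 ≤ f' x) : f a ≤ f b := by
  refine monotoneOn_of_hasDerivWithinAt_nonneg (f' := f') (convex_Icc a b) hf ?_ ?_
    (left_mem_Icc.2 hab) (right_mem_Icc.2 hab) hab
  · intro x hx
    rw [interior_Icc] at hx
    exact (hd x hx).hasDerivWithinAt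
  · intro x hx
    rw [interior_Icc] at hx
    exact h0 x hx

/-- A function whose derivative is at least `m > 0` on a half-line exceeds any bound. -/
lemma exists_gt_of_hasDerivAt_ge {f f' : ℝ → ℝ} {R m : ℝ} (hm : 0 < m)
    (hd : ∀ x ∈ Ici R, HasDerivAt f (f' x) x) (h : ∀ x ∈ Ici R, m ≤ f' x) (B : ℝ) :
    ∃ S ∈ Ici R, ∀ x ∈ Ici S, B < f x := by
  have key : ∀ x ∈ Ici R, f R - m * R ≤ f x - m * x := by
    intro x hx
    have hg : ∀ y ∈ Ici R, HasDerivAt (fun y => f y - m * y) (f' y - m * 1) y := fun y hy =>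
      (hd y hy).sub ((hasDerivAt_id' y).const_mul m)
    exact le_of_hasDerivAt_nonneg_s15 (f := fun y => f y - m * y) hx
      (fun y hy => (hg y hy.1).continuousAt.continuousWithinAt)
      (fun y hy => hg y hy.1.le) (fun y hy => by linarith [h y hy.1.le])
  refine ⟨max R (R + (B - f R) / m + 1), mem_Ici.2 (le_max_left _ _), fun x hx => ?_⟩
  have h1 : R ≤ x := (le_max_left _ _).trans hx
  have h2 : R + (B - f R) / m + 1 ≤ x := (le_max_right _ _).trans hx
  have h3 := key x h1
  have h4 : m * ((B - f R) / m) = B - f R := by field_simp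
  nlinarith [mul_le_mul_of_nonneg_left h2 hm.le]

/-- If `u'' = (r - p) u` on `[R, ∞)`, where `p > 0` is nonincreasing and slowly varying and `r` is
small, and `∫ u²` stays bounded, then `u` and `u'` vanish at `R`. -/
lemma initial_data_eq_zero_of_bounded_primitive {p p' r u u' U : ℝ → ℝ} {R B : ℝ}
    (hp : ∀ x ∈ Ici R, HasDerivAt p (p' x) x)
    (hu : ∀ x ∈ Ici R, HasDerivAt u (u' x) x)
    (hu' : ∀ x ∈ Ici R, HasDerivAt u' ((r x - p x) * u x) x)
    (hU : ∀ x ∈ Ici R, HasDerivAt U (u x ^ 2) x) (hUB : ∀ x ∈ Ici R, |U x| ≤ B)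
    (p_pos : ∀ x ∈ Ici R, 0 < p x) (p'_nonpos : ∀ x ∈ Ici R, p' x ≤ 0)
    (p'_sq_le : ∀ x ∈ Ici R, p' x ^ 2 ≤ p x ^ 3) (r_le : ∀ x ∈ Ici R, |r x| ≤ p x / 2)
    (r_sq_le : ∀ x ∈ Ici R, r x ^ 2 ≤ Real.exp (-x) * p x) :
    u R = 0 ∧ u' R = 0 := by
  set G : ℝ → ℝ := fun x => u x ^ 2 + u' x ^ 2 / p x with hG
  have hGd : ∀ x ∈ Ici R, HasDerivAt G
      (-p' x / p x ^ 2 * u' x ^ 2 + 2 * u x * (r x * u' x / p x)) x := by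
    intro x hx
    have hpx := (p_pos x hx).ne'
    refine HasDerivAt.congr_deriv (((hu x hx).fun_pow 2).add (((hu' x hx).fun_pow 2).div (hp x hx) hpx)) ?_
    norm_num
    field_simp
    ring
  set E : ℝ → ℝ := fun x => Real.exp (-2 * Real.exp (-x / 2)) with hE
  have hEd : ∀ x, HasDerivAt E (E x * Real.exp (-x / 2)) x := by
    intro x
    refine HasDerivAt.congr_deriv (((((hasDerivAt_id' x).neg.div_const 2).exp).const_mul (-2)).exp) ?_
    norm_num [hE]
    ring
  have hEpos : ∀ x, 0 < E x := fun x => Real.exp_pos _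
  have hE1 : ∀ x, E x ≤ 1 := fun x => Real.exp_le_one_iff.2 (by nlinarith [Real.exp_pos (-x / 2)])
  have hGnn : ∀ x ∈ Ici R, 0 ≤ G x := fun x hx => by
    have := p_pos x hx
    positivity
  have hGE : ∀ x ∈ Ici R, G R * E R ≤ G x := by
    intro x hx
    have hd : ∀ y ∈ Ici R, HasDerivAt (fun y => G y * E y) _ y := fun y hy => (hGd y hy).mul (hEd y)
    have : G R * E R ≤ G x * E x := by
      refine le_of_hasDerivAt_nonneg_s15 (f := fun y => G y * E y) hx
        (fun y hy => (hd y hy.1).continuousAt.continuousWithinAt)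
        (fun y hy => hd y hy.1.le) (fun y hy => ?_)
      have hy : y ∈ Ici R := hy.1.le
      have hpy := p_pos y hy
      have h1 : 0 ≤ -p' y / p y ^ 2 * u' y ^ 2 := by
        have := p'_nonpos y hy
        have : 0 ≤ -p' y := by linarith
        positivity
      set φ := Real.exp (-y / 2) with hφ
      have hφ0 : 0 < φ := Real.exp_pos _
      have hφ2 : Real.exp (-y) = φ ^ 2 := by
        rw [hφ, ← Real.exp_nat_mul]; congr 1; push_cast; ring
      have h2 : (r y * u' y / p y) ^ 2 ≤ φ ^ 2 * (u' y ^ 2 / p y) := by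
        have := r_sq_le y hy
        rw [hφ2] at this
        calc (r y * u' y / p y) ^ 2 = r y ^ 2 * (u' y ^ 2 / p y ^ 2) := by ring
          _ ≤ (φ ^ 2 * p y) * (u' y ^ 2 / p y ^ 2) := by gcongr
          _ = _ := by field_simp
      have h3 : 0 ≤ 2 * u y * (r y * u' y / p y) + φ * G y := by
        have : 0 ≤ φ * (2 * u y * (r y * u' y / p y) + φ * G y) := by
          simp only [hG]
          nlinarith [sq_nonneg (φ * u y + r y * u' y / p y)]
        exact nonneg_of_mul_nonneg_right this hφ0
      have := mul_nonneg (hEpos y).le (add_nonneg h1 h3)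
      nlinarith
    exact this.trans (mul_le_of_le_one_right (hGnn x hx) (hE1 x))
  by_cases hG0 : G R = 0
  · have hpR := p_pos R self_mem_Ici
    have h1 : 0 ≤ u' R ^ 2 / p R := by positivity
    have h2 : u R ^ 2 + u' R ^ 2 / p R = 0 := hG0
    have h3 : u R ^ 2 = 0 := by nlinarith [sq_nonneg (u R)]
    have h4 : u' R ^ 2 / p R = 0 := by nlinarith [sq_nonneg (u R)]
    refine ⟨by simpa using h3, ?_⟩
    rcases div_eq_zero_iff.1 h4 with h | h
    · simpa using h
    · exact absurd h hpR.ne'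
  exfalso
  have hm : 0 < G R * E R :=
    mul_pos (lt_of_le_of_ne (hGnn R self_mem_Ici) (Ne.symm hG0)) (hEpos R)
  have hFd : ∀ x ∈ Ici R, HasDerivAt (fun x => u x * u' x / p x + 5 / 2 * U x)
      (u' x ^ 2 / p x - u x ^ 2 + r x / p x * u x ^ 2 - u x * (p' x * u' x / p x ^ 2)
        + 5 / 2 * u x ^ 2) x := by
    intro x hx
    have hpx := (p_pos x hx).ne'
    refine HasDerivAt.congr_deriv ((((hu x hx).mul (hu' x hx)).div (hp x hx) hpx).add ((hU x hx).const_mul (5 / 2))) ?_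
    norm_num
    field_simp
    ring
  obtain ⟨S, hS, hSB⟩ := exists_gt_of_hasDerivAt_ge (half_pos hm) hFd (fun x hx => by
    have hpx := p_pos x hx
    have h1 : (p' x * u' x / p x ^ 2) ^ 2 ≤ u' x ^ 2 / p x := by
      calc (p' x * u' x / p x ^ 2) ^ 2 = p' x ^ 2 * (u' x ^ 2 / p x ^ 4) := by ring
        _ ≤ p x ^ 3 * (u' x ^ 2 / p x ^ 4) := by gcongr; exact p'_sq_le x hx
        _ = _ := by field_simp
    have h2 : -(1 / 2) ≤ r x / p x := by
      rw [le_div_iff₀ hpx]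
      linarith [(abs_le.1 (r_le x hx)).1]
    have h3 := hGE x hx
    simp only [hG] at h3 ⊢
    nlinarith [sq_nonneg (u x - p' x * u' x / p x ^ 2),
      mul_le_mul_of_nonneg_right h2 (sq_nonneg (u x))]) (5 / 2 * B)
  have hpos : ∀ x ∈ Ici S, 0 < u x * u' x := by
    intro x hx
    have hxR : x ∈ Ici R := Ici_subset_Ici.2 hS hx
    have h1 := hSB x hx
    have h2 := (abs_le.1 (hUB x hxR)).2
    have h3 : 0 < u x * u' x / p x := by linarith
    exact (div_pos_iff_of_pos_right (p_pos x hxR)).1 h3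
  have hmono : ∀ x ∈ Ici S, u S ^ 2 ≤ u x ^ 2 := by
    intro x hx
    have hd : ∀ y ∈ Ici S, HasDerivAt (fun y => u y ^ 2) (2 * (u y * u' y)) y := fun y hy => by
      refine HasDerivAt.congr_deriv ((hu y (Ici_subset_Ici.2 hS hy)).fun_pow 2) ?_
      norm_num
      ring
    exact le_of_hasDerivAt_nonneg_s15 (f := fun y => u y ^ 2) hx
      (fun y hy => (hd y hy.1).continuousAt.continuousWithinAt)
      (fun y hy => hd y hy.1.le) (fun y hy => by linarith [hpos y hy.1.le])
  have huS : 0 < u S ^ 2 := by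
    have : u S ≠ 0 := fun h => by simpa [h] using hpos S self_mem_Ici
    positivity
  obtain ⟨T, hT, hTB⟩ := exists_gt_of_hasDerivAt_ge huS
    (fun x hx => hU x (Ici_subset_Ici.2 hS hx)) hmono B
  have h1 := hTB T self_mem_Ici
  have h2 := (abs_le.1 (hUB T (Ici_subset_Ici.2 hS hT))).2
  linarith

/-- Backward uniqueness for `u'' = q u` with `q` continuous. -/
lemma eq_zero_of_terminal_data_eq_zero {q u u' : ℝ → ℝ} {a b : ℝ}
    (hq : ContinuousOn q (Icc a b)) (hu : ContinuousOn u (Icc a b))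
    (hu' : ContinuousOn u' (Icc a b)) (hud : ∀ x ∈ Ioo a b, HasDerivAt u (u' x) x)
    (hu'd : ∀ x ∈ Ioo a b, HasDerivAt u' (q x * u x) x) (h0 : u b = 0) (h0' : u' b = 0) :
    ∀ x ∈ Icc a b, u x = 0 := by
  obtain ⟨K, hK⟩ := isCompact_Icc.exists_bound_of_continuousOn hq
  intro x hx
  have hsub : Icc x b ⊆ Icc a b := Icc_subset_Icc_left hx.1
  have hsub' : Ioo x b ⊆ Ioo a b := Ioo_subset_Ioo_left hx.1
  set F : ℝ → ℝ := fun y => (u y ^ 2 + u' y ^ 2) * Real.exp ((1 + K) * y) with hF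
  have hd : ∀ y ∈ Ioo x b, HasDerivAt F
      ((2 * (u y * u' y) * (1 + q y) + (1 + K) * (u y ^ 2 + u' y ^ 2))
        * Real.exp ((1 + K) * y)) y := by
    intro y hy
    refine HasDerivAt.congr_deriv ((((hud y (hsub' hy)).fun_pow 2).add ((hu'd y (hsub' hy)).fun_pow 2)).mul
      (((hasDerivAt_id' y).const_mul (1 + K)).exp)) ?_
    norm_num
    ring
  have h := le_of_hasDerivAt_nonneg_s15 (f := F) hx.2
    ((((hu.mono hsub).pow 2).add ((hu'.mono hsub).pow 2)).mul (by fun_prop)) hd (fun y hy => by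
      refine mul_nonneg ?_ (Real.exp_pos _).le
      have h1 := abs_le.1 (hK y (Ioo_subset_Icc_self (hsub' hy)))
      have h2 : |1 + q y| ≤ 1 + K := abs_le.2 ⟨by linarith, by linarith⟩
      have h3 := abs_le.1 h2
      nlinarith [mul_nonneg (sub_nonneg.2 h3.2) (sq_nonneg (u y - u' y)),
        mul_nonneg (sub_nonneg.2 h3.1) (sq_nonneg (u y + u' y))])
  have h2 : F b = 0 := by simp [hF, h0, h0']
  have h3 : (u x ^ 2 + u' x ^ 2) ≤ 0 := by
    rw [h2] at h
    exact nonpos_of_mul_nonpos_left h (Real.exp_pos _)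
  have : u x ^ 2 = 0 := by nlinarith [sq_nonneg (u x), sq_nonneg (u' x)]
  simpa using this

open Filter Topology in
/-- For large `x`, the potential `p = x ^ (δ - 2) (c - a (log x) ^ (-ε))` is positive,
nonincreasing, slowly varying, and dominates exponentially small terms. -/
lemma eventually_potential_estimates {c δ ε : ℝ} (a M : ℝ) (hc : 0 < c) (hδ : δ ∈ Ioo (0 : ℝ) 2)
    (hε : 0 < ε) :
    ∃ p' : ℝ → ℝ, ∀ᶠ x in atTop,
      HasDerivAt (fun x => x ^ (δ - 2) * (c - a * Real.log x ^ (-ε))) (p' x) x ∧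
      p' x ≤ 0 ∧ p' x ^ 2 ≤ (x ^ (δ - 2) * (c - a * Real.log x ^ (-ε))) ^ 3 ∧
      0 < x ^ (δ - 2) * (c - a * Real.log x ^ (-ε)) ∧
      M * Real.exp (-x) ≤ x ^ (δ - 2) * (c - a * Real.log x ^ (-ε)) := by
  obtain ⟨hδ0, hδ2⟩ := hδ
  have hL : Tendsto (fun x => Real.log x ^ (-ε)) atTop (𝓝 0) :=
    (tendsto_rpow_neg_atTop hε).comp Real.tendsto_log_atTop
  have hL1 : Tendsto (fun x => Real.log x ^ (-ε - 1)) atTop (𝓝 0) := by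
    have := (tendsto_rpow_neg_atTop (show 0 < ε + 1 by linarith)).comp Real.tendsto_log_atTop
    rw [neg_add'] at this
    exact this
  set g : ℝ → ℝ := fun x => c - a * Real.log x ^ (-ε) with hg
  set k : ℝ → ℝ := fun x => (δ - 2) * g x + a * ε * Real.log x ^ (-ε - 1) with hk
  have hgt : Tendsto g atTop (𝓝 c) := by
    simpa using (hL.const_mul a).const_sub c
  have hkt : Tendsto k atTop (𝓝 ((δ - 2) * c)) := by
    simpa using (hgt.const_mul (δ - 2)).add (hL1.const_mul (a * ε))
  have hslow : ∀ᶠ x in atTop, k x ^ 2 / g x ^ 3 < x ^ δ := by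
    have h1 : Tendsto (fun x => k x ^ 2 / g x ^ 3) atTop (𝓝 (((δ - 2) * c) ^ 2 / c ^ 3)) :=
      (hkt.pow 2).div (hgt.pow 3) (by positivity)
    filter_upwards [h1.eventually_lt_const (lt_add_one _),
      (tendsto_rpow_atTop hδ0).eventually_gt_atTop (((δ - 2) * c) ^ 2 / c ^ 3 + 1)] with x h2 h3
    exact h2.trans h3
  have hexp : ∀ᶠ x in atTop, M * (x ^ 2 * Real.exp (-x)) < c / 2 := by
    have := (Real.tendsto_pow_mul_exp_neg_atTop_nhds_zero 2).const_mul M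
    rw [mul_zero] at this
    exact this.eventually_lt_const (by positivity)
  refine ⟨fun x => x ^ (δ - 3) * k x, ?_⟩
  filter_upwards [hslow, hexp, hgt.eventually_const_lt (half_lt_self hc),
    hkt.eventually_lt_const (show (δ - 2) * c < 0 by nlinarith), eventually_gt_atTop 1]
    with x h1 h2 h3 h4 h5
  have hx : 0 < x := by linarith
  have hgx : 0 < g x := by linarith
  have hlog : 0 < Real.log x := Real.log_pos h5
  have e1 : x ^ (δ - 2) = x ^ δ / x ^ 2 := by
    rw [Real.rpow_sub hx]; norm_cast
  have e2 : x ^ (δ - 3) = x ^ δ / x ^ 3 := by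
    rw [Real.rpow_sub hx]; norm_cast
  have hxδ : 0 < x ^ δ := Real.rpow_pos_of_pos hx _
  refine ⟨?_, ?_, ?_, ?_, ?_⟩
  · refine HasDerivAt.congr_deriv ((Real.hasDerivAt_rpow_const (Or.inl hx.ne')).fun_mul
      ((((Real.hasDerivAt_log hx.ne').rpow_const (Or.inl hlog.ne')).const_mul a).const_sub c)) ?_
    rw [show δ - 2 - 1 = δ - 3 by ring, e1, e2]
    simp only [hk, hg]
    field_simp
  · exact mul_nonpos_of_nonneg_of_nonpos (Real.rpow_nonneg hx.le _) h4.le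
  · rw [div_lt_iff₀ (by positivity)] at h1
    change (x ^ (δ - 3) * k x) ^ 2 ≤ (x ^ (δ - 2) * g x) ^ 3
    rw [e1, e2]
    calc (x ^ δ / x ^ 3 * k x) ^ 2 = (x ^ δ) ^ 2 / x ^ 6 * k x ^ 2 := by ring
      _ ≤ (x ^ δ) ^ 2 / x ^ 6 * (x ^ δ * g x ^ 3) := by gcongr
      _ = _ := by ring
  · exact mul_pos (Real.rpow_pos_of_pos hx _) hgx
  · change M * Real.exp (-x) ≤ x ^ (δ - 2) * g x
    rw [e1, div_mul_eq_mul_div, le_div_iff₀ (by positivity)]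
    have := Real.one_le_rpow h5.le hδ0.le
    nlinarith

/-- Let c > 0, δ ∈ (0, 2), ε > 0, a ∈ ℝ, ρ₁ > 1 and 𝒳 continuous and bounded
on [ρ₁, ∞). If u solves u'' = q u on [ρ₁, ∞), where
q(ρ) = −c ρ^(δ−2) + a ρ^(δ−2)(log ρ)^(−ε) + e^(−ρ)𝒳(ρ), and u is square-integrable on
[ρ₁, ∞), then u is identically zero on [ρ₁, ∞). -/
theorem stmt_15 (c δ ε a ρ₁ : ℝ) (hc : 0 < c) (hδ : δ ∈ Ioo (0:ℝ) 2) (hε : 0 < ε)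
    (hρ₁ : 1 < ρ₁)
    (𝒳 : ℝ → ℝ) (h𝒳 : ContinuousOn 𝒳 (Ici ρ₁)) (h𝒳bd : ∃ M, ∀ ρ ∈ Ici ρ₁, |𝒳 ρ| ≤ M)
    (u u' : ℝ → ℝ)
    (hu : ∀ ρ ∈ Ici ρ₁, HasDerivWithinAt u (u' ρ) (Ici ρ₁) ρ)
    (hu'cont : ContinuousOn u' (Ici ρ₁))
    (hu' : ∀ ρ ∈ Ici ρ₁, HasDerivWithinAt u'
      ((-c * ρ ^ (δ - 2) + a * ρ ^ (δ - 2) * Real.log ρ ^ (-ε)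
          + Real.exp (-ρ) * 𝒳 ρ) * u ρ) (Ici ρ₁) ρ)
    (hL2 : IntegrableOn (fun ρ => u ρ ^ 2) (Ici ρ₁)) :
    ∀ ρ ∈ Ici ρ₁, u ρ = 0 := by
  obtain ⟨M, hM⟩ := h𝒳bd
  have hM0 : 0 ≤ M := (abs_nonneg _).trans (hM ρ₁ self_mem_Ici)
  have hud : ∀ x ∈ Ioi ρ₁, HasDerivAt u (u' x) x := fun x hx =>
    (hu x (mem_Ioi.1 hx).le).hasDerivAt (Ici_mem_nhds hx)
  have hu'd := fun x (hx : x ∈ Ioi ρ₁) =>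
    (hu' x (mem_Ioi.1 hx).le).hasDerivAt (Ici_mem_nhds hx)
  have hucont : ContinuousOn u (Ici ρ₁) := fun x hx => (hu x hx).continuousWithinAt
  have hUd : ∀ x ∈ Ioi ρ₁, HasDerivAt (fun x => ∫ t in ρ₁..x, u t ^ 2) (u x ^ 2) x := by
    intro x hx
    have hcont : ContinuousOn (fun t => u t ^ 2) (Ioi ρ₁) :=
      (hucont.mono Ioi_subset_Ici_self).pow 2
    exact intervalIntegral.integral_hasDerivAt_right
      ((hL2.mono_set (by rw [uIcc_of_le (mem_Ioi.1 hx).le]; exact Icc_subset_Ici_self)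
        ).intervalIntegrable)
      (hcont.stronglyMeasurableAtFilter isOpen_Ioi x hx)
      (hcont.continuousAt (Ioi_mem_nhds hx))
  have hUB : ∀ x ∈ Ioi ρ₁, |∫ t in ρ₁..x, u t ^ 2| ≤ ∫ t in Ici ρ₁, u t ^ 2 := by
    intro x hx
    have hx' : ρ₁ ≤ x := (mem_Ioi.1 hx).le
    rw [abs_of_nonneg (intervalIntegral.integral_nonneg hx' fun t _ => sq_nonneg _),
      intervalIntegral.integral_of_le hx']
    exact setIntegral_mono_set hL2 (Filter.Eventually.of_forall fun t => sq_nonneg _)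
      (Ioc_subset_Ioi_self.trans Ioi_subset_Ici_self).eventuallyLE
  obtain ⟨p', hp'⟩ := eventually_potential_estimates a (2 * M + M ^ 2) hc hδ hε
  obtain ⟨R₀, hR₀⟩ := Filter.eventually_atTop.1 hp'
  have hzero : ∀ R, R₀ ≤ R → ρ₁ < R → u R = 0 ∧ u' R = 0 := by
    intro R hR hRρ
    have hI : ∀ x ∈ Ici R, x ∈ Ioi ρ₁ := fun x hx => hRρ.trans_le hx
    have hJ := fun x (hx : x ∈ Ici R) => hR₀ x (hR.trans hx)
    refine initial_data_eq_zero_of_bounded_primitive (fun x hx => (hJ x hx).1)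
      (r := fun x => Real.exp (-x) * 𝒳 x)
      (fun x hx => hud x (hI x hx)) (fun x hx => (hu'd x (hI x hx)).congr_deriv (by ring))
      (fun x hx => hUd x (hI x hx)) (fun x hx => hUB x (hI x hx))
      (fun x hx => (hJ x hx).2.2.2.1) (fun x hx => (hJ x hx).2.1)
      (fun x hx => (hJ x hx).2.2.1) (fun x hx => ?_) (fun x hx => ?_)
    all_goals
      have h1 := (hJ x hx).2.2.2.2
      have h2 := hM x (mem_Ioi.1 (hI x hx)).le
      have h3 := Real.exp_pos (-x)
    · rw [abs_mul, abs_of_pos h3]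
      nlinarith [mul_le_mul_of_nonneg_left h2 h3.le, mul_nonneg (sq_nonneg M) h3.le]
    · have h4 : 𝒳 x ^ 2 ≤ M ^ 2 := sq_le_sq' (abs_le.1 h2).1 (abs_le.1 h2).2
      calc (Real.exp (-x) * 𝒳 x) ^ 2 = Real.exp (-x) * (Real.exp (-x) * 𝒳 x ^ 2) := by ring
        _ ≤ _ := by
          refine mul_le_mul_of_nonneg_left ?_ h3.le
          nlinarith [mul_le_mul_of_nonneg_left h4 h3.le, mul_nonneg hM0 h3.le]
  intro ρ hρ
  set R := max R₀ (ρ + 1) with hR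
  have hρR : ρ + 1 ≤ R := le_max_right _ _
  have hρ' : ρ₁ ≤ ρ := hρ
  obtain ⟨h0, h0'⟩ := hzero R (le_max_left _ _) (by linarith)
  refine eq_zero_of_terminal_data_eq_zero (a := ρ₁) (b := R) ?_ (hucont.mono Icc_subset_Ici_self)
    (hu'cont.mono Icc_subset_Ici_self) (fun x hx => hud x hx.1) (fun x hx => hu'd x hx.1) h0 h0' ρ
    ⟨hρ', by linarith⟩
  have hpow : ContinuousOn (fun x : ℝ => x ^ (δ - 2)) (Icc ρ₁ R) := fun x hx =>
    (Real.continuousAt_rpow_const _ _ (Or.inl (by linarith [hx.1]))).continuousWithinAt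
  have hlog : ContinuousOn (fun x : ℝ => Real.log x ^ (-ε)) (Icc ρ₁ R) := fun x hx =>
    ((Real.continuousAt_log (by linarith [hx.1])).rpow_const
      (Or.inl (Real.log_pos (hρ₁.trans_le hx.1)).ne')).continuousWithinAt
  exact ((hpow.const_mul (-c)).add ((hpow.const_mul a).mul hlog)).add
    ((by fun_prop : Continuous fun x : ℝ => Real.exp (-x)).continuousOn.mul
      (h𝒳.mono Icc_subset_Ici_self))
end

section
/- Let c > 0, δ ∈ (0, 2), ε > 0, a ∈ ℝ, and let B, 𝒳 : [2, ∞) → ℝ be continuous and bounded. Then there exist ρ₀ ≥ 2, E₀ > 0 and C > 0 such that for every E ∈ (0, E₀) and every μ ≥ 0, every nontrivial solution u of u'' = q u on (ρ₀, ∞), where q(ρ) = E + μ e^(−2ρ) (1 + e^(−ρ) B(ρ)) − c ρ^(δ−2) + a ρ^(δ−2) (log ρ)^(−ε) + e^(−ρ) 𝒳(ρ), has at most C · E^(−δ/(2(2−δ))) zeros in (ρ₀, ∞); that is, the set {ρ > ρ₀ : u(ρ) = 0} is finite with cardinality at most C · E^(−δ/(2(2−δ))). -/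
open Set

/-- A solution of `u'' = q u` on a half-line with `q` continuous that vanishes to second order at a
point vanishes identically. -/
theorem eq_zero_of_second_order_linear {ρ₀ x₀ : ℝ} {q u u' : ℝ → ℝ} (hq : ContinuousOn q (Ioi ρ₀))
    (hu : ∀ x ∈ Ioi ρ₀, HasDerivAt u (u' x) x) (hu' : ∀ x ∈ Ioi ρ₀, HasDerivAt u' (q x * u x) x)
    (hx₀ : x₀ ∈ Ioi ρ₀) (h0 : u x₀ = 0) (h0' : u' x₀ = 0) {x : ℝ} (hx : x ∈ Ioi ρ₀) : u x = 0 := by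
  have hsub : uIcc x₀ x ⊆ Ioi ρ₀ := fun y hy ↦ lt_of_lt_of_le (lt_min hx₀ hx) hy.1
  obtain ⟨L, hL⟩ := isCompact_uIcc.exists_bound_of_continuousOn (hq.mono hsub)
  have key : ∀ y ∈ uIcc x₀ x, |2 * u y * u' y * (1 + q y)| ≤ (1 + L) * (u y ^ 2 + u' y ^ 2) := by
    intro y hy
    have h1 : |1 + q y| ≤ 1 + L := (abs_add_le _ _).trans (by simpa using hL y hy)
    have h2 : |2 * u y * u' y| ≤ u y ^ 2 + u' y ^ 2 := by
      rw [abs_le]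
      constructor <;> nlinarith [sq_nonneg (u y + u' y), sq_nonneg (u y - u' y)]
    rw [abs_mul, mul_comm]
    exact mul_le_mul h1 h2 (abs_nonneg _) ((abs_nonneg _).trans h1)
  have hd : ∀ k : ℝ, ∀ y ∈ uIcc x₀ x, HasDerivAt
      (fun y ↦ (u y ^ 2 + u' y ^ 2) * Real.exp (k * y))
      ((2 * u y * u' y * (1 + q y) + k * (u y ^ 2 + u' y ^ 2)) * Real.exp (k * y)) y := by
    intro k y hy
    have h3 : HasDerivAt (fun y ↦ Real.exp (k * y)) (Real.exp (k * y) * (k * 1)) y :=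
      ((hasDerivAt_id y).const_mul k).exp
    refine ((((hu y (hsub hy)).pow 2).add ((hu' y (hsub hy)).pow 2)).mul h3).congr_deriv ?_
    simp only [Pi.add_apply, Pi.pow_apply]
    push_cast
    ring
  have fin : ∀ k : ℝ, (u x ^ 2 + u' x ^ 2) * Real.exp (k * x) ≤
      (u x₀ ^ 2 + u' x₀ ^ 2) * Real.exp (k * x₀) → u x = 0 := by
    intro k h
    rw [h0, h0'] at h
    have h4 : u x ^ 2 + u' x ^ 2 ≤ 0 := by
      by_contra! hc
      have := mul_pos hc (Real.exp_pos (k * x))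
      simp only [ne_eq, OfNat.ofNat_ne_zero, not_false_eq_true, zero_pow, add_zero, zero_mul] at h
      linarith
    exact pow_eq_zero_iff two_ne_zero |>.1 (by nlinarith [sq_nonneg (u x), sq_nonneg (u' x)])
  rcases le_total x₀ x with hle | hle
  · rw [uIcc_of_le hle] at hd key
    have hanti : AntitoneOn (fun y ↦ (u y ^ 2 + u' y ^ 2) * Real.exp (-(1 + L) * y))
        (Icc x₀ x) := by
      refine antitoneOn_of_hasDerivWithinAt_nonpos (convex_Icc _ _)
        (fun y hy ↦ (hd _ y hy).continuousAt.continuousWithinAt)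
        (fun y hy ↦ (hd _ y (interior_subset hy)).hasDerivWithinAt) fun y hy ↦ ?_
      have := (abs_le.1 (key y (interior_subset hy))).2
      exact mul_nonpos_of_nonpos_of_nonneg (by linarith) (Real.exp_pos _).le
    exact fin _ (hanti (left_mem_Icc.2 hle) (right_mem_Icc.2 hle) hle)
  · rw [uIcc_of_ge hle] at hd key
    have hmono : MonotoneOn (fun y ↦ (u y ^ 2 + u' y ^ 2) * Real.exp ((1 + L) * y))
        (Icc x x₀) := by
      refine monotoneOn_of_hasDerivWithinAt_nonneg (convex_Icc _ _)
        (fun y hy ↦ (hd _ y hy).continuousAt.continuousWithinAt)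
        (fun y hy ↦ (hd _ y (interior_subset hy)).hasDerivWithinAt) fun y hy ↦ ?_
      have := (abs_le.1 (key y (interior_subset hy))).1
      exact mul_nonneg (by linarith) (Real.exp_pos _).le
    exact fin _ (hmono (left_mem_Icc.2 hle) (right_mem_Icc.2 hle) hle)

/-- A solution of `u'' = q u` with `q ≥ -m` that vanishes at two points of distance at most
`1 / (2 √m)` vanishes between them. -/
theorem eq_zero_on_Icc_of_short {s t m : ℝ} {q u u' : ℝ → ℝ} (hst : s < t) (hm : 0 ≤ m)
    (hmst : 4 * m * (t - s) ^ 2 ≤ 1) (hq : ∀ x ∈ Icc s t, -m ≤ q x)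
    (hu : ∀ x ∈ Icc s t, HasDerivAt u (u' x) x)
    (hu' : ∀ x ∈ Icc s t, HasDerivAt u' (q x * u x) x) (hs : u s = 0) (ht : u t = 0) :
    ∀ x ∈ Icc s t, u x = 0 := by
  have hF : ∀ x ∈ Icc s t, HasDerivAt (fun x ↦ u x * (u' x + 2 * m * (x - s) * u x))
      ((u' x + 2 * m * (x - s) * u x) ^ 2 + (q x + 2 * m - (2 * m * (x - s)) ^ 2) * u x ^ 2) x := by
    intro x hx
    have h1 : HasDerivAt (fun x ↦ 2 * m * (x - s)) (2 * m * 1) x :=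
      ((hasDerivAt_id x).sub_const s).const_mul _
    refine ((hu x hx).mul ((hu' x hx).add (h1.mul (hu x hx)))).congr_deriv ?_
    simp only [Pi.add_apply, Pi.mul_apply]
    ring
  have hnn : ∀ x ∈ Icc s t, 0 ≤ q x + 2 * m - (2 * m * (x - s)) ^ 2 := by
    intro x hx
    have h1 : (x - s) ^ 2 ≤ (t - s) ^ 2 :=
      pow_le_pow_left₀ (by linarith [hx.1]) (by linarith [hx.2]) 2
    have h2 : 4 * m * (x - s) ^ 2 ≤ 1 := (mul_le_mul_of_nonneg_left h1 (by linarith)).trans hmst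
    have h3 := mul_le_mul_of_nonneg_left h2 hm
    nlinarith [hq x hx]
  have hmono : MonotoneOn (fun x ↦ u x * (u' x + 2 * m * (x - s) * u x)) (Icc s t) := by
    refine monotoneOn_of_hasDerivWithinAt_nonneg (convex_Icc _ _)
      (fun y hy ↦ (hF y hy).continuousAt.continuousWithinAt)
      (fun y hy ↦ (hF y (interior_subset hy)).hasDerivWithinAt) fun y hy ↦ ?_
    have := hnn y (interior_subset hy)
    positivity
  have hF0 : ∀ x ∈ Icc s t, u x * (u' x + 2 * m * (x - s) * u x) = 0 := by
    intro x hx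
    have h1 := hmono (left_mem_Icc.2 hst.le) hx hx.1
    have h2 := hmono hx (right_mem_Icc.2 hst.le) hx.2
    simp only [hs, ht, zero_mul] at h1 h2
    exact le_antisymm h2 h1
  have hfirst : ∀ x ∈ Ioo s t, u' x + 2 * m * (x - s) * u x = 0 := by
    intro x hx
    have hx' := Ioo_subset_Icc_self hx
    have h1 : HasDerivAt (fun x ↦ u x * (u' x + 2 * m * (x - s) * u x)) 0 x :=
      (hasDerivAt_const x (0 : ℝ)).congr_of_eventuallyEq <| by
        filter_upwards [Ioo_mem_nhds hx.1 hx.2] with y hy using hF0 y (Ioo_subset_Icc_self hy)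
    have h2 := (hF x hx').unique h1
    have h3 := mul_nonneg (hnn x hx') (sq_nonneg (u x))
    exact pow_eq_zero_iff two_ne_zero |>.1
      (by nlinarith [sq_nonneg (u' x + 2 * m * (x - s) * u x)])
  have hG : ∀ x ∈ Icc s t, HasDerivAt (fun x ↦ u x * Real.exp (m * (x - s) ^ 2))
      ((u' x + 2 * m * (x - s) * u x) * Real.exp (m * (x - s) ^ 2)) x := by
    intro x hx
    have h1 : HasDerivAt (fun x ↦ m * (x - s) ^ 2) (m * (2 * (x - s))) x := by
      simpa using (((hasDerivAt_id x).sub_const s).pow 2).const_mul m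
    refine ((hu x hx).mul h1.exp).congr_deriv ?_
    ring
  intro x hx
  have hcont : ContinuousOn (fun x ↦ u x * Real.exp (m * (x - s) ^ 2)) (Icc s t) :=
    fun y hy ↦ (hG y hy).continuousAt.continuousWithinAt
  have hder : ∀ y ∈ interior (Icc s t), HasDerivWithinAt
      (fun x ↦ u x * Real.exp (m * (x - s) ^ 2)) 0 (interior (Icc s t)) y := by
    intro y hy
    have h1 := hG y (interior_subset hy)
    rw [interior_Icc] at hy
    rw [hfirst y hy, zero_mul] at h1
    exact h1.hasDerivWithinAt
  have hconst := le_antisymm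
    (antitoneOn_of_hasDerivWithinAt_nonpos (convex_Icc _ _) hcont hder (fun _ _ ↦ le_rfl)
      (left_mem_Icc.2 hst.le) hx hx.1)
    (monotoneOn_of_hasDerivWithinAt_nonneg (convex_Icc _ _) hcont hder (fun _ _ ↦ le_rfl)
      (left_mem_Icc.2 hst.le) hx hx.1)
  simpa [hs] using hconst

/-- Two zeros of a nontrivial solution of `u'' = q u` with `q ≥ -m` between them are at distance
more than `1 / (2 √m)`. -/
theorem one_lt_of_two_zeros {ρ₀ s t m : ℝ} {q u u' : ℝ → ℝ} (hq : ContinuousOn q (Ioi ρ₀))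
    (hu : ∀ x ∈ Ioi ρ₀, HasDerivAt u (u' x) x) (hu' : ∀ x ∈ Ioi ρ₀, HasDerivAt u' (q x * u x) x)
    (hne : ∃ x ∈ Ioi ρ₀, u x ≠ 0) (hρs : ρ₀ < s) (hst : s < t) (hs : u s = 0) (ht : u t = 0)
    (hm : 0 ≤ m) (hqm : ∀ x ∈ Icc s t, -m ≤ q x) : 1 < 4 * m * (t - s) ^ 2 := by
  by_contra! hshort
  have hsub : Icc s t ⊆ Ioi ρ₀ := fun x hx ↦ hρs.trans_le hx.1
  have hzero := eq_zero_on_Icc_of_short hst hm hshort hqm (fun x hx ↦ hu x (hsub hx))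
    (fun x hx ↦ hu' x (hsub hx)) hs ht
  obtain ⟨y, hy⟩ := nonempty_Ioo.2 hst
  have hy' := Ioo_subset_Icc_self hy
  have hder : HasDerivAt u 0 y := (hasDerivAt_const y (0 : ℝ)).congr_of_eventuallyEq <| by
    filter_upwards [Ioo_mem_nhds hy.1 hy.2] with z hz using hzero z (Ioo_subset_Icc_self hz)
  obtain ⟨x, hx, hxne⟩ := hne
  exact hxne (eq_zero_of_second_order_linear hq hu hu' (hsub hy') (hzero y hy')
    ((hu y (hsub hy')).unique hder) hx)

/-- A step of size at least `η s ^ (1 - α)` from `s ≥ 1` increases `s ^ α` by a definite amount. -/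
theorem rpow_add_le_rpow_of_step {α η s t : ℝ} (hα0 : 0 < α) (hα1 : α < 1) (hη0 : 0 ≤ η)
    (hη1 : η ≤ 1) (hs : 1 ≤ s) (hst : s + η * s ^ (1 - α) ≤ t) :
    s ^ α + η * (2 ^ α - 1) ≤ t ^ α := by
  have hs0 : 0 < s := by linarith
  have hsα : 0 < s ^ α := Real.rpow_pos_of_pos hs0 α
  set x := η * s ^ (-α) with hx
  have hx0 : 0 ≤ x := by positivity
  have hx1 : x ≤ 1 :=
    mul_le_one₀ hη1 (by positivity) (Real.rpow_le_one_of_one_le_of_nonpos hs (by linarith))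
  have hconc := (Real.concaveOn_rpow hα0.le hα1.le).2 (show (1 : ℝ) ∈ Ici 0 by simp)
    (show (2 : ℝ) ∈ Ici 0 by simp) (sub_nonneg.2 hx1) hx0 (by ring)
  simp only [smul_eq_mul, Real.one_rpow] at hconc
  have hfac : s + η * s ^ (1 - α) = s * (1 - x + x * 2) := by
    rw [hx, sub_eq_add_neg, Real.rpow_add hs0, Real.rpow_one]
    ring
  have hxs : x * s ^ α = η := by
    rw [hx, mul_assoc, ← Real.rpow_add hs0, neg_add_cancel, Real.rpow_zero, mul_one]
  calc s ^ α + η * (2 ^ α - 1) = s ^ α * ((1 - x) * 1 + x * 2 ^ α) := by rw [← hxs]; ring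
    _ ≤ s ^ α * ((1 - x) * 1 + x * 2) ^ α := by gcongr
    _ = (s + η * s ^ (1 - α)) ^ α := by
      rw [hfac, Real.mul_rpow hs0.le (by linarith), mul_one]
    _ ≤ t ^ α := Real.rpow_le_rpow (by positivity) hst hα0.le

/-- A set of reals on which a nonnegative function `f` increases by at least `κ` from point to point,
and of which at most one point is not below `R`, has at most `L / κ + 2` elements when `f ≤ L`
below `R`. -/
theorem finite_and_ncard_le_of_separated_s17 {Z : Set ℝ} {f : ℝ → ℝ} {κ R L : ℝ} (hκ : 0 < κ)
    (hL : 0 ≤ L) (hf0 : ∀ x ∈ Z, 0 ≤ f x) (hfL : ∀ x ∈ Z, x < R → f x ≤ L)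
    (hsep : ∀ s ∈ Z, ∀ t ∈ Z, s < t → s < R ∧ f s + κ ≤ f t) :
    Z.Finite ∧ (Z.ncard : ℝ) ≤ L / κ + 2 := by
  have hinj : InjOn (fun x ↦ ⌊f x / κ⌋₊) (Z ∩ Iio R) := by
    have aux : ∀ s ∈ Z, ∀ t ∈ Z, s < t → ⌊f s / κ⌋₊ ≠ ⌊f t / κ⌋₊ := by
      intro s hs t ht hst heq
      have h1 : f s / κ + 1 ≤ f t / κ := by
        rw [div_add_one hκ.ne']
        exact div_le_div_of_nonneg_right (hsep s hs t ht hst).2 hκ.le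
      have h2 := Nat.floor_le (div_nonneg (hf0 s hs) hκ.le)
      have h3 := Nat.lt_floor_add_one (f t / κ)
      rw [← heq] at h3
      linarith
    intro s hs t ht heq
    rcases lt_trichotomy s t with h | h | h
    · exact absurd heq (aux s hs.1 t ht.1 h)
    · exact h
    · exact absurd heq.symm (aux t ht.1 s hs.1 h)
  have hmaps : MapsTo (fun x ↦ ⌊f x / κ⌋₊) (Z ∩ Iio R) (Finset.range (⌊L / κ⌋₊ + 1)) := by
    intro x hx
    simp only [Finset.coe_range, mem_Iio]
    exact Nat.lt_succ_of_le
      (Nat.floor_le_floor (div_le_div_of_nonneg_right (hfL x hx.1 hx.2) hκ.le))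
  have hfin1 : (Z ∩ Iio R).Finite :=
    Finite.of_injOn hmaps hinj (Finset.finite_toSet _)
  have hcard1 : (Z ∩ Iio R).ncard ≤ ⌊L / κ⌋₊ + 1 := by
    simpa using ncard_le_ncard_of_injOn _ hmaps hinj (Finset.finite_toSet _)
  have hsub : (Z ∩ Ici R).Subsingleton := by
    intro s hs t ht
    rcases lt_trichotomy s t with h | h | h
    · exact absurd (hsep s hs.1 t ht.1 h).1 (not_lt.2 hs.2)
    · exact h
    · exact absurd (hsep t ht.1 s hs.1 h).1 (not_lt.2 ht.2)
  have hunion : Z = (Z ∩ Iio R) ∪ (Z ∩ Ici R) := by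
    rw [← inter_union_distrib_left, Iio_union_Ici, inter_univ]
  refine ⟨hunion ▸ hfin1.union hsub.finite, ?_⟩
  have h1 : Z.ncard ≤ ⌊L / κ⌋₊ + 1 + 1 := by
    rw [hunion]
    exact (ncard_union_le _ _).trans
      (add_le_add hcard1 ((ncard_le_one hsub.finite).2 fun _ ha _ hb ↦ hsub ha hb))
  have h2 : (Z.ncard : ℝ) ≤ ⌊L / κ⌋₊ + 1 + 1 := by exact_mod_cast h1
  linarith [Nat.floor_le (div_nonneg hL hκ.le)]

/-- The zeros in `(ρ₀, ∞)` of a nontrivial solution of `u'' = q u`, where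
`q ρ ≥ E - K ρ ^ (2 α - 2)`, are controlled by the turning point `(K / E) ^ (1 / (2 - 2 α))`. -/
theorem finite_zeros_and_ncard_le {ρ₀ K E α : ℝ} {q u u' : ℝ → ℝ} (hρ₀ : 1 ≤ ρ₀) (hK : 1 ≤ K)
    (hE : 0 < E) (hα0 : 0 < α) (hα1 : α < 1) (hq : ContinuousOn q (Ioi ρ₀))
    (hqK : ∀ x ∈ Ioi ρ₀, E - K * x ^ (2 * α - 2) ≤ q x)
    (hu : ∀ x ∈ Ioi ρ₀, HasDerivAt u (u' x) x) (hu' : ∀ x ∈ Ioi ρ₀, HasDerivAt u' (q x * u x) x)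
    (hne : ∃ x ∈ Ioi ρ₀, u x ≠ 0) :
    {x ∈ Ioi ρ₀ | u x = 0}.Finite ∧ ({x ∈ Ioi ρ₀ | u x = 0}.ncard : ℝ) ≤
      (K / E) ^ (α / (2 - 2 * α)) / ((2 * √K)⁻¹ * (2 ^ α - 1)) + 2 := by
  have hK0 : 0 < K := by linarith
  have hsK : 1 ≤ √K := Real.one_le_sqrt.2 hK
  have h2α : 0 < (2 : ℝ) ^ α - 1 := sub_pos.2 (Real.one_lt_rpow one_lt_two hα0)
  have hRα : ((K / E) ^ (1 / (2 - 2 * α))) ^ α = (K / E) ^ (α / (2 - 2 * α)) := by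
    rw [← Real.rpow_mul (by positivity)]
    ring_nf
  refine finite_and_ncard_le_of_separated_s17 (f := fun x ↦ x ^ α) (R := (K / E) ^ (1 / (2 - 2 * α)))
    (by positivity) (by positivity) (fun x hx ↦ ?_) (fun x hx hxR ↦ ?_) ?_
  · have : ρ₀ < x := hx.1
    exact Real.rpow_nonneg (by linarith) _
  · have : ρ₀ < x := hx.1
    rw [← hRα]
    exact Real.rpow_le_rpow (by linarith) hxR.le hα0.le
  · rintro s ⟨hρs, hs⟩ t ⟨-, ht⟩ hst
    have hρs' : ρ₀ < s := hρs
    have hs1 : 1 ≤ s := by linarith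
    have hs0 : 0 < s := by linarith
    constructor
    · by_contra! hR
      refine absurd (one_lt_of_two_zeros hq hu hu' hne hρs hst hs ht le_rfl fun x hx ↦ ?_)
        (by norm_num)
      have hx0 : 0 < x := hs0.trans_le hx.1
      have h1 : K / E ≤ x ^ (2 - 2 * α) := by
        have := Real.rpow_le_rpow (by positivity) (hR.trans hx.1)
          (show 0 ≤ 2 - 2 * α by linarith)
        rwa [← Real.rpow_mul (by positivity), one_div_mul_cancel (by linarith), Real.rpow_one]
          at this
      have h2 : K * x ^ (2 * α - 2) ≤ E := by
        rw [show 2 * α - 2 = -(2 - 2 * α) by ring, Real.rpow_neg hx0.le, ← div_eq_mul_inv,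
          div_le_iff₀ (by positivity)]
        rw [div_le_iff₀ hE] at h1
        linarith
      have := hqK x (hρs'.trans_le hx.1)
      linarith
    · have h1 := one_lt_of_two_zeros (m := K * s ^ (2 * α - 2)) hq hu hu' hne hρs hst hs ht
        (by positivity) fun x hx ↦ by
          have h2 : x ^ (2 * α - 2) ≤ s ^ (2 * α - 2) :=
            Real.rpow_le_rpow_of_nonpos hs0 hx.1 (by linarith)
          have := mul_le_mul_of_nonneg_left h2 hK0.le
          have := hqK x (hρs'.trans_le hx.1)
          linarith
      have h3 : 4 * (K * s ^ (2 * α - 2)) * (t - s) ^ 2 =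
          (2 * √K * s ^ (α - 1) * (t - s)) ^ 2 := by
        rw [show 2 * α - 2 = (α - 1) * (2 : ℕ) by push_cast; ring, Real.rpow_mul_natCast hs0.le,
          mul_pow, mul_pow, mul_pow, Real.sq_sqrt hK0.le]
        ring
      rw [h3, one_lt_sq_iff₀ (by have := sub_pos.2 hst; positivity)] at h1
      refine rpow_add_le_rpow_of_step hα0 hα1 (by positivity)
        (inv_le_one_of_one_le₀ (by linarith)) hs1 ?_
      have h4 : s ^ (1 - α) * s ^ (α - 1) = 1 := by
        rw [← Real.rpow_add hs0]
        simp
      have h5 : (2 * √K)⁻¹ * s ^ (1 - α) ≤ t - s := by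
        calc (2 * √K)⁻¹ * s ^ (1 - α)
            ≤ (2 * √K)⁻¹ * s ^ (1 - α) * (2 * √K * s ^ (α - 1) * (t - s)) :=
              le_mul_of_one_le_right (by positivity) h1.le
          _ = ((2 * √K)⁻¹ * (2 * √K)) * (s ^ (1 - α) * s ^ (α - 1)) * (t - s) := by ring
          _ = t - s := by rw [h4, inv_mul_cancel₀ (by positivity)]; ring
      linarith

theorem exp_neg_le_two_mul_rpow {x β : ℝ} (hx : 1 ≤ x) (hβ : -2 ≤ β) :
    Real.exp (-x) ≤ 2 * x ^ β := by
  have h1 : x ^ (-2 : ℝ) ≤ x ^ β := Real.rpow_le_rpow_of_exponent_le hx hβ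
  have h2 : x ^ (-2 : ℝ) = (x ^ 2)⁻¹ := by
    rw [Real.rpow_neg (by linarith), Real.rpow_two]
  have h3 := Real.quadratic_le_exp_of_nonneg (show 0 ≤ x by linarith)
  have h4 : Real.exp (-x) ≤ 2 * (x ^ 2)⁻¹ := by
    rw [Real.exp_neg, ← div_eq_mul_inv, inv_le_comm₀ (Real.exp_pos x) (by positivity), inv_div]
    linarith
  linarith

/-- Upper bound on the number of zeros: for c > 0, δ ∈ (0,2), ε > 0, a ∈ ℝ
and B, 𝒳 continuous bounded on [2, ∞), there exist ρ₀ ≥ 2, E₀ > 0, C > 0 such that for all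
E ∈ (0, E₀) and μ ≥ 0, every nontrivial solution u of u'' = q u on (ρ₀, ∞), with
q(ρ) = E + μ e^(−2ρ)(1 + e^(−ρ)B(ρ)) − c ρ^(δ−2) + a ρ^(δ−2)(log ρ)^(−ε) + e^(−ρ)𝒳(ρ),
has at most C·E^(−δ/(2(2−δ))) zeros in (ρ₀, ∞). -/
theorem stmt_17 (c δ ε a : ℝ) (hc : 0 < c) (hδ : δ ∈ Ioo (0:ℝ) 2) (hε : 0 < ε)
    (B 𝒳 : ℝ → ℝ)
    (hB : ContinuousOn B (Ici 2)) (hBbd : ∃ M, ∀ ρ ∈ Ici (2:ℝ), |B ρ| ≤ M)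
    (h𝒳 : ContinuousOn 𝒳 (Ici 2)) (h𝒳bd : ∃ M, ∀ ρ ∈ Ici (2:ℝ), |𝒳 ρ| ≤ M) :
    ∃ ρ₀ : ℝ, 2 ≤ ρ₀ ∧ ∃ E₀ > (0:ℝ), ∃ C > (0:ℝ),
      ∀ E ∈ Ioo (0:ℝ) E₀, ∀ μ ≥ (0:ℝ), ∀ u u' : ℝ → ℝ,
        (∀ ρ ∈ Ioi ρ₀, HasDerivAt u (u' ρ) ρ) →
        (∀ ρ ∈ Ioi ρ₀, HasDerivAt u'
          ((E + μ * Real.exp (-2 * ρ) * (1 + Real.exp (-ρ) * B ρ)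
              - c * ρ ^ (δ - 2) + a * ρ ^ (δ - 2) * Real.log ρ ^ (-ε)
              + Real.exp (-ρ) * 𝒳 ρ) * u ρ) ρ) →
        (∃ ρ ∈ Ioi ρ₀, u ρ ≠ 0) →
        {ρ ∈ Ioi ρ₀ | u ρ = 0}.Finite ∧
          ({ρ ∈ Ioi ρ₀ | u ρ = 0}.ncard : ℝ) ≤ C * E ^ (-δ / (2 * (2 - δ))) := by
  obtain ⟨hδ0, hδ2⟩ := hδ
  obtain ⟨MB, hMB⟩ := hBbd
  obtain ⟨MX, hMX⟩ := h𝒳bd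
  have hMX0 : 0 ≤ MX := (abs_nonneg _).trans (hMX 2 (by simp))
  set K := c + |a| + 2 * MX + 1 with hK
  have hK1 : 1 ≤ K := by have := abs_nonneg a; linarith
  have hK0 : 0 < K := by linarith
  set κ := (2 * √K)⁻¹ * ((2 : ℝ) ^ (δ / 2) - 1) with hκ
  have hκ0 : 0 < κ := by
    have : 0 < (2 : ℝ) ^ (δ / 2) - 1 := sub_pos.2 (Real.one_lt_rpow one_lt_two (by linarith))
    have : 0 < √K := Real.sqrt_pos.2 hK0
    positivity
  have hp : 0 ≤ δ / (2 * (2 - δ)) := div_nonneg hδ0.le (by linarith)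
  refine ⟨max 3 MB, le_max_of_le_left (by norm_num), K, hK0,
    K ^ (δ / (2 * (2 - δ))) * (κ⁻¹ + 2), by positivity, ?_⟩
  rintro E ⟨hE0, hEK⟩ μ hμ u u' hu hu' hne
  have h3 : ∀ x ∈ Ioi (max 3 MB), 3 < x := fun x hx ↦ (le_max_left _ _).trans_lt hx
  have hlog : ∀ x ∈ Ioi (max 3 MB), 1 ≤ Real.log x := fun x hx ↦ by
    rw [Real.le_log_iff_exp_le (by linarith [h3 x hx])]
    linarith [h3 x hx, Real.exp_one_lt_d9]
  have hcont : ContinuousOn (fun ρ ↦ E + μ * Real.exp (-2 * ρ) * (1 + Real.exp (-ρ) * B ρ)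
      - c * ρ ^ (δ - 2) + a * ρ ^ (δ - 2) * Real.log ρ ^ (-ε)
      + Real.exp (-ρ) * 𝒳 ρ) (Ioi (max 3 MB)) := by
    have hsub : Ioi (max 3 MB) ⊆ Ici 2 := fun x hx ↦ by
      have := h3 x hx
      exact mem_Ici.2 (by linarith)
    have hB' := hB.mono hsub
    have h𝒳' := h𝒳.mono hsub
    have hpow : ContinuousOn (fun ρ : ℝ ↦ ρ ^ (δ - 2)) (Ioi (max 3 MB)) :=
      continuousOn_id.rpow_const fun x hx ↦ Or.inl (by have := h3 x hx; simp; linarith)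
    have hlogc : ContinuousOn (fun ρ : ℝ ↦ Real.log ρ) (Ioi (max 3 MB)) :=
      Real.continuousOn_log.mono fun x hx ↦ by have := h3 x hx; simp; linarith
    have hlogp : ContinuousOn (fun ρ : ℝ ↦ Real.log ρ ^ (-ε)) (Ioi (max 3 MB)) :=
      hlogc.rpow_const fun x hx ↦ Or.inl (by have := hlog x hx; linarith)
    fun_prop
  have hbound : ∀ x ∈ Ioi (max 3 MB), E - K * x ^ (2 * (δ / 2) - 2) ≤
      E + μ * Real.exp (-2 * x) * (1 + Real.exp (-x) * B x)
      - c * x ^ (δ - 2) + a * x ^ (δ - 2) * Real.log x ^ (-ε) + Real.exp (-x) * 𝒳 x := by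
    intro x hx
    have hx3 := h3 x hx
    have hxB : MB < x := (le_max_right _ _).trans_lt hx
    have hx2 : x ∈ Ici (2 : ℝ) := mem_Ici.2 (by linarith)
    rw [show 2 * (δ / 2) - 2 = δ - 2 by ring]
    set P := x ^ (δ - 2) with hP
    have hP0 : 0 < P := Real.rpow_pos_of_pos (by linarith) _
    have hcentrifugal : 0 ≤ μ * Real.exp (-2 * x) * (1 + Real.exp (-x) * B x) := by
      refine mul_nonneg (mul_nonneg hμ (Real.exp_pos _).le) ?_
      have h1 : Real.exp (-x) * x ≤ 1 := by
        rw [Real.exp_neg, inv_mul_le_one₀ (Real.exp_pos x)]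
        linarith [Real.add_one_le_exp x]
      have h2 : -x ≤ B x := by linarith [(abs_le.1 (hMB x hx2)).1]
      have h4 := mul_le_mul_of_nonneg_left h2 (Real.exp_pos (-x)).le
      linarith
    have hlogterm : -(|a| * P) ≤ a * P * Real.log x ^ (-ε) := by
      have h1 : Real.log x ^ (-ε) ≤ 1 :=
        Real.rpow_le_one_of_one_le_of_nonpos (hlog x hx) (by linarith)
      have h0 : 0 ≤ Real.log x ^ (-ε) := Real.rpow_nonneg (by linarith [hlog x hx]) _
      refine (abs_le.1 ?_).1
      rw [abs_mul, abs_mul, abs_of_pos hP0, abs_of_nonneg h0]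
      exact mul_le_of_le_one_right (by positivity) h1
    have hexpterm : -(2 * MX * P) ≤ Real.exp (-x) * 𝒳 x := by
      refine (abs_le.1 ?_).1
      rw [abs_mul, abs_of_pos (Real.exp_pos _)]
      calc Real.exp (-x) * |𝒳 x| ≤ (2 * P) * MX :=
            mul_le_mul (exp_neg_le_two_mul_rpow (by linarith) (by linarith)) (hMX x hx2)
              (abs_nonneg _) (by positivity)
        _ = 2 * MX * P := by ring
    have hKP : K * P = c * P + |a| * P + 2 * MX * P + P := by rw [hK]; ring
    linarith
  obtain ⟨hfin, hcard⟩ := finite_zeros_and_ncard_le (le_max_of_le_left (by norm_num)) hK1 hE0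
    (by linarith : 0 < δ / 2) (by linarith : δ / 2 < 1) hcont hbound hu hu' hne
  refine ⟨hfin, hcard.trans ?_⟩
  rw [show δ / 2 / (2 - 2 * (δ / 2)) = δ / (2 * (2 - δ)) by
    rw [div_div]; ring_nf, ← hκ]
  have h1 : 1 ≤ (K / E) ^ (δ / (2 * (2 - δ))) :=
    Real.one_le_rpow ((one_le_div hE0).2 hEK.le) hp
  have h2 : K ^ (δ / (2 * (2 - δ))) * E ^ (-δ / (2 * (2 - δ))) =
      (K / E) ^ (δ / (2 * (2 - δ))) := by
    rw [neg_div, Real.rpow_neg hE0.le, Real.div_rpow hK0.le hE0.le, ← div_eq_mul_inv]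
  rw [mul_right_comm, h2, mul_add, ← div_eq_mul_inv]
  linarith
end

section
/- Let c > 0, δ ∈ (0, 2), ε > 0, a ∈ ℝ, and let B, 𝒳 : [2, ∞) → ℝ be continuous and bounded. Then there exist ρ₀ ≥ 2, E₀ > 0 and c′ > 0 such that for every E ∈ (0, E₀) and every μ with 0 ≤ μ ≤ 2E · exp((c/(8E))^(1/(2−δ))), every nontrivial solution u of u'' = q u on (ρ₀, ∞), where q(ρ) = E + μ e^(−2ρ) (1 + e^(−ρ) B(ρ)) − c ρ^(δ−2) + a ρ^(δ−2) (log ρ)^(−ε) + e^(−ρ) 𝒳(ρ), has at least c′ · E^(−δ/(2(2−δ))) zeros in (ρ₀, ∞); that is, there is a finite set Z ⊆ {ρ > ρ₀ : u(ρ) = 0} with cardinality at least c′ · E^(−δ/(2(2−δ))). -/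
open Set

/-- Sturm comparison with the constant potential `-k²`: if `q ≤ -k²` on `[s, s + π / k]`, then every
solution of `u'' = q u` vanishes somewhere on that interval. -/
lemma exists_zero_of_le_neg_sq {q u u' : ℝ → ℝ} {k s : ℝ} (hk : 0 < k)
    (hu : ∀ t ∈ Icc s (s + Real.pi / k), HasDerivAt u (u' t) t)
    (hu' : ∀ t ∈ Icc s (s + Real.pi / k), HasDerivAt u' (q t * u t) t)
    (hq : ∀ t ∈ Icc s (s + Real.pi / k), q t ≤ -k ^ 2) :
    ∃ t ∈ Icc s (s + Real.pi / k), u t = 0 := by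
  have hpk : 0 < Real.pi / k := div_pos Real.pi_pos hk
  have hcont : ContinuousOn u (Icc s (s + Real.pi / k)) :=
    fun t ht => (hu t ht).continuousAt.continuousWithinAt
  have hs : s ∈ Icc s (s + Real.pi / k) := ⟨le_rfl, by linarith⟩
  have he : s + Real.pi / k ∈ Icc s (s + Real.pi / k) := ⟨by linarith, le_rfl⟩
  by_contra! hne
  have hsign : ∀ t ∈ Icc s (s + Real.pi / k), 0 < u t * u s := by
    intro t ht
    by_contra! hle
    have h0 : (0 : ℝ) ∈ uIcc (u s) (u t) := by
      rw [mem_uIcc]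
      rcases (hne s hs).lt_or_gt with h | h
      · exact Or.inl ⟨h.le, by nlinarith⟩
      · exact Or.inr ⟨by nlinarith, h.le⟩
    have hsub : uIcc s t ⊆ Icc s (s + Real.pi / k) := by
      rw [uIcc_of_le ht.1]
      exact Icc_subset_Icc_right ht.2
    obtain ⟨r, hr, hr0⟩ := intermediate_value_uIcc (hcont.mono hsub) h0
    exact hne r (hsub hr) hr0
  have hsin : ∀ t, HasDerivAt (fun t => Real.sin (k * (t - s))) (Real.cos (k * (t - s)) * k) t := by
    intro t
    have h := (((hasDerivAt_id t).sub_const s).const_mul k).sin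
    simpa using h
  have hcos : ∀ t,
      HasDerivAt (fun t => Real.cos (k * (t - s)) * k) (-Real.sin (k * (t - s)) * k * k) t := by
    intro t
    have h := (((hasDerivAt_id t).sub_const s).const_mul k).cos.mul_const k
    simpa using h
  set W : ℝ → ℝ := fun t =>
    (u' t * Real.sin (k * (t - s)) - u t * (Real.cos (k * (t - s)) * k)) * u s with hW
  have hWd : ∀ t ∈ Icc s (s + Real.pi / k),
      HasDerivAt W ((q t + k ^ 2) * (u t * u s) * Real.sin (k * (t - s))) t := by
    intro t ht
    have h := (((hu' t ht).mul (hsin t)).sub ((hu t ht).mul (hcos t))).mul_const (u s)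
    exact h.congr_deriv (by ring)
  have hanti : AntitoneOn W (Icc s (s + Real.pi / k)) := by
    refine antitoneOn_of_deriv_nonpos (convex_Icc _ _)
      (fun t ht => (hWd t ht).continuousAt.continuousWithinAt)
      (fun t ht => (hWd t (interior_subset ht)).differentiableAt.differentiableWithinAt) ?_
    intro t ht
    have ht' := interior_subset ht
    rw [(hWd t ht').deriv]
    have hk1 : k * (t - s) ≤ Real.pi := by
      have h := mul_le_mul_of_nonneg_left (show t - s ≤ Real.pi / k by linarith [ht'.2]) hk.le
      rwa [mul_div_cancel₀ _ hk.ne'] at h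
    have hk0 : 0 ≤ k * (t - s) := mul_nonneg hk.le (by linarith [ht'.1])
    exact mul_nonpos_of_nonpos_of_nonneg
      (mul_nonpos_of_nonpos_of_nonneg (by linarith [hq t ht']) (hsign t ht').le)
      (Real.sin_nonneg_of_nonneg_of_le_pi hk0 hk1)
  have hle := hanti hs he (by linarith)
  have hpi : k * (s + Real.pi / k - s) = Real.pi := by field_simp; ring
  simp only [hW, hpi, sub_self, mul_zero, Real.sin_zero, Real.cos_zero, Real.sin_pi,
    Real.cos_pi] at hle
  have h1 := mul_pos (hsign _ he) hk
  have h2 := mul_pos (hsign _ hs) hk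
  linarith

/-- If `q ≤ -k²` on an interval of length `N * (4 / k)`, then every solution of `u'' = q u` has at
least `N` zeros there. -/
lemma exists_zeros_of_le_neg_sq {q u u' : ℝ → ℝ} {k s : ℝ} (hk : 0 < k) (N : ℕ)
    (hu : ∀ t ∈ Icc s (s + N * (4 / k)), HasDerivAt u (u' t) t)
    (hu' : ∀ t ∈ Icc s (s + N * (4 / k)), HasDerivAt u' (q t * u t) t)
    (hq : ∀ t ∈ Icc s (s + N * (4 / k)), q t ≤ -k ^ 2) :
    ∃ Z : Set ℝ, Z ⊆ {t ∈ Icc s (s + N * (4 / k)) | u t = 0} ∧ Z.Finite ∧ Z.ncard = N := by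
  have hL : 0 < 4 / k := by positivity
  have hpi : Real.pi / k < 4 / k := div_lt_div_of_pos_right Real.pi_lt_four hk
  have hsub : ∀ i : Fin N, Icc (s + i * (4 / k)) (s + i * (4 / k) + Real.pi / k) ⊆
      Icc s (s + N * (4 / k)) := by
    intro i
    have hi : ((i : ℕ) : ℝ) + 1 ≤ N := by exact_mod_cast i.2
    have h0 : 0 ≤ ((i : ℕ) : ℝ) * (4 / k) := by positivity
    exact Icc_subset_Icc (by linarith) (by nlinarith)
  have hex : ∀ i : Fin N, ∃ t ∈ Icc (s + i * (4 / k)) (s + i * (4 / k) + Real.pi / k), u t = 0 :=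
    fun i => exists_zero_of_le_neg_sq hk (fun t ht => hu t (hsub i ht))
      (fun t ht => hu' t (hsub i ht)) (fun t ht => hq t (hsub i ht))
  choose z hz hz0 using hex
  have hmono : StrictMono z := by
    intro i j hij
    have hij' : ((i : ℕ) : ℝ) + 1 ≤ (j : ℕ) := by exact_mod_cast hij
    have h := mul_le_mul_of_nonneg_right hij' hL.le
    linarith [(hz i).2, (hz j).1]
  refine ⟨range z, ?_, finite_range z, ?_⟩
  · rintro _ ⟨i, rfl⟩
    exact ⟨hsub i (hz i), hz0 i⟩
  · rw [← Nat.card_coe_set_eq, Nat.card_range_of_injective hmono.injective, Nat.card_eq_fintype_card,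
      Fintype.card_fin]

/-- The perturbations of `-c ρ ^ (δ - 2)` in the potential are eventually small. -/
lemma eventually_perturbation_le {c δ ε : ℝ} (hc : 0 < c) (hε : 0 < ε) (a M₁ M₂ : ℝ) :
    ∀ᶠ ρ in Filter.atTop, Real.exp (-ρ) * M₁ ≤ 1 / 10 ∧ |a| * Real.log ρ ^ (-ε) ≤ c / 10 ∧
      Real.exp (-ρ) * M₂ ≤ c / 10 * ρ ^ (δ - 2) := by
  have h1 : Filter.Tendsto (fun ρ : ℝ => Real.exp (-ρ) * M₁) Filter.atTop (nhds 0) := by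
    simpa using (Real.tendsto_exp_neg_atTop_nhds_zero).mul_const M₁
  have h2 : Filter.Tendsto (fun ρ : ℝ => |a| * Real.log ρ ^ (-ε)) Filter.atTop (nhds 0) := by
    simpa using ((tendsto_rpow_neg_atTop hε).comp Real.tendsto_log_atTop).const_mul |a|
  have h3 : Filter.Tendsto (fun ρ : ℝ => ρ ^ (2 - δ) * Real.exp (-1 * ρ) * M₂)
      Filter.atTop (nhds 0) := by
    simpa using (tendsto_rpow_mul_exp_neg_mul_atTop_nhds_zero (2 - δ) 1 one_pos).mul_const M₂
  filter_upwards [h1.eventually_le_const (show (0 : ℝ) < 1 / 10 by norm_num),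
    h2.eventually_le_const (show (0 : ℝ) < c / 10 by positivity),
    h3.eventually_le_const (show (0 : ℝ) < c / 10 by positivity),
    Filter.eventually_gt_atTop 0] with ρ h1 h2 h3 hρ
  refine ⟨h1, h2, ?_⟩
  have hP : 0 < ρ ^ (δ - 2) := Real.rpow_pos_of_pos hρ _
  have hPP : ρ ^ (2 - δ) * ρ ^ (δ - 2) = 1 := by
    rw [← Real.rpow_add hρ]
    simp
  calc Real.exp (-ρ) * M₂ = ρ ^ (2 - δ) * ρ ^ (δ - 2) * (Real.exp (-ρ) * M₂) := by
        rw [hPP, one_mul]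
    _ = ρ ^ (2 - δ) * Real.exp (-1 * ρ) * M₂ * ρ ^ (δ - 2) := by
        rw [neg_one_mul]
        ring
    _ ≤ c / 10 * ρ ^ (δ - 2) := mul_le_mul_of_nonneg_right h3 hP.le

/-- Between half the turning point `R = (c / (8E)) ^ (1 / (2 - δ))` and `R` the potential is at most
`-E`, once its perturbations are small. -/
lemma potential_le_neg {c δ E μ ρ b l x a : ℝ} (hc : 0 < c) (hδ : δ < 2) (hE : 0 < E) (hμ0 : 0 ≤ μ)
    (hμ : μ ≤ 2 * E * Real.exp ((c / (8 * E)) ^ ((1 : ℝ) / (2 - δ))))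
    (hρ0 : 0 < ρ) (hρl : (c / (8 * E)) ^ ((1 : ℝ) / (2 - δ)) / 2 ≤ ρ)
    (hρu : ρ ≤ (c / (8 * E)) ^ ((1 : ℝ) / (2 - δ)))
    (hb : Real.exp (-ρ) * b ≤ 1 / 10) (hl : a * l ≤ c / 10)
    (hx : Real.exp (-ρ) * x ≤ c / 10 * ρ ^ (δ - 2)) :
    E + μ * Real.exp (-2 * ρ) * (1 + Real.exp (-ρ) * b) - c * ρ ^ (δ - 2) + a * ρ ^ (δ - 2) * l
      + Real.exp (-ρ) * x ≤ -E := by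
  set R := (c / (8 * E)) ^ ((1 : ℝ) / (2 - δ)) with hR
  have hP : 0 < ρ ^ (δ - 2) := Real.rpow_pos_of_pos hρ0 _
  have hPR : R ^ (δ - 2) ≤ ρ ^ (δ - 2) :=
    Real.rpow_le_rpow_of_nonpos hρ0 hρu (by linarith)
  have hRE : R ^ (δ - 2) = (c / (8 * E))⁻¹ := by
    rw [hR, ← Real.rpow_mul (by positivity), ← Real.rpow_neg_one]
    congr 1
    have : 2 - δ ≠ 0 := by linarith
    field_simp
    ring
  have hV : 8 * E ≤ c * ρ ^ (δ - 2) := by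
    rw [hRE, inv_div] at hPR
    calc 8 * E = c * (8 * E / c) := by field_simp
      _ ≤ _ := mul_le_mul_of_nonneg_left hPR hc.le
  have hμe : μ * Real.exp (-2 * ρ) ≤ 2 * E := by
    calc μ * Real.exp (-2 * ρ) ≤ 2 * E * Real.exp R * Real.exp (-2 * ρ) :=
          mul_le_mul_of_nonneg_right hμ (Real.exp_pos _).le
      _ = 2 * E * Real.exp (R - 2 * ρ) := by
          rw [mul_assoc, ← Real.exp_add]
          ring_nf
      _ ≤ 2 * E * 1 := by
          refine mul_le_mul_of_nonneg_left (Real.exp_le_one_iff.2 (by linarith)) (by positivity)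
      _ = 2 * E := mul_one _
  have hμe0 : 0 ≤ μ * Real.exp (-2 * ρ) := mul_nonneg hμ0 (Real.exp_pos _).le
  have h1 : μ * Real.exp (-2 * ρ) * (1 + Real.exp (-ρ) * b) ≤ 2 * E * (1 + 1 / 10) :=
    (mul_le_mul_of_nonneg_left (by linarith) hμe0).trans
      (mul_le_mul_of_nonneg_right hμe (by norm_num))
  have h2 : a * ρ ^ (δ - 2) * l ≤ c / 10 * ρ ^ (δ - 2) := by
    have := mul_le_mul_of_nonneg_right hl hP.le
    linarith
  linarith

/-- Lower bound on the number of zeros: for c > 0, δ ∈ (0,2), ε > 0, a ∈ ℝ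
and B, 𝒳 continuous bounded on [2, ∞), there exist ρ₀ ≥ 2, E₀ > 0, c′ > 0 such that for all
E ∈ (0, E₀) and 0 ≤ μ ≤ 2E·exp((c/(8E))^(1/(2−δ))), every nontrivial solution u of
u'' = q u on (ρ₀, ∞), with
q(ρ) = E + μ e^(−2ρ)(1 + e^(−ρ)B(ρ)) − c ρ^(δ−2) + a ρ^(δ−2)(log ρ)^(−ε) + e^(−ρ)𝒳(ρ),
has at least c′·E^(−δ/(2(2−δ))) zeros in (ρ₀, ∞). -/
theorem stmt_18 (c δ ε a : ℝ) (hc : 0 < c) (hδ : δ ∈ Ioo (0:ℝ) 2) (hε : 0 < ε)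
    (B 𝒳 : ℝ → ℝ)
    (hB : ContinuousOn B (Ici 2)) (hBbd : ∃ M, ∀ ρ ∈ Ici (2:ℝ), |B ρ| ≤ M)
    (h𝒳 : ContinuousOn 𝒳 (Ici 2)) (h𝒳bd : ∃ M, ∀ ρ ∈ Ici (2:ℝ), |𝒳 ρ| ≤ M) :
    ∃ ρ₀ : ℝ, 2 ≤ ρ₀ ∧ ∃ E₀ > (0:ℝ), ∃ c' > (0:ℝ),
      ∀ E ∈ Ioo (0:ℝ) E₀, ∀ μ : ℝ,
        0 ≤ μ → μ ≤ 2 * E * Real.exp ((c / (8 * E)) ^ ((1:ℝ) / (2 - δ))) →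
        ∀ u u' : ℝ → ℝ,
        (∀ ρ ∈ Ioi ρ₀, HasDerivAt u (u' ρ) ρ) →
        (∀ ρ ∈ Ioi ρ₀, HasDerivAt u'
          ((E + μ * Real.exp (-2 * ρ) * (1 + Real.exp (-ρ) * B ρ)
              - c * ρ ^ (δ - 2) + a * ρ ^ (δ - 2) * Real.log ρ ^ (-ε)
              + Real.exp (-ρ) * 𝒳 ρ) * u ρ) ρ) →
        (∃ ρ ∈ Ioi ρ₀, u ρ ≠ 0) →
        ∃ Z : Set ℝ, Z ⊆ {ρ ∈ Ioi ρ₀ | u ρ = 0} ∧ Z.Finite ∧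
          c' * E ^ (-δ / (2 * (2 - δ))) ≤ (Z.ncard : ℝ) := by
  obtain ⟨hδ0, hδ2⟩ := hδ
  obtain ⟨M₁, hM₁⟩ := hBbd
  obtain ⟨M₂, hM₂⟩ := h𝒳bd
  obtain ⟨T, hT⟩ := Filter.eventually_atTop.1
    (eventually_perturbation_le (δ := δ) hc hε a M₁ M₂)
  have hd : 0 < 2 - δ := by linarith
  set p : ℝ := 1 / (2 - δ) with hp
  set r : ℝ := -δ / (2 * (2 - δ)) with hr
  have hp0 : -p < 0 := neg_lt_zero.2 (by positivity)
  have hr0 : r < 0 := div_neg_of_neg_of_pos (by linarith) (by positivity)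
  set K : ℝ := (c / 8) ^ p with hK
  have hK0 : 0 < K := Real.rpow_pos_of_pos (by positivity) _
  have hRK : ∀ E : ℝ, 0 < E → (c / (8 * E)) ^ p = K * E ^ (-p) := by
    intro E hE
    rw [← div_div, Real.div_rpow (by positivity) hE.le, Real.rpow_neg hE.le, div_eq_mul_inv]
  have hev := ((tendsto_rpow_neg_nhdsGT_zero hp0).const_mul_atTop hK0).eventually_gt_atTop
    (2 * max 2 T) |>.and
    (((tendsto_rpow_neg_nhdsGT_zero hr0).const_mul_atTop hK0).eventually_ge_atTop 8)
  obtain ⟨E₀, hE₀, hE₀'⟩ := (mem_nhdsGT_iff_exists_Ioo_subset).1 hev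
  refine ⟨max 2 T, le_max_left _ _, E₀, hE₀, K / 16, by positivity, ?_⟩
  intro E hE μ hμ0 hμ u u' hu hu' _
  obtain ⟨hbig, hmany⟩ := hE₀' hE
  have hE0 : 0 < E := hE.1
  rw [← hRK E hE0] at hbig
  set R := (c / (8 * E)) ^ p with hR
  have hk : 0 < √E := Real.sqrt_pos.2 hE0
  have hRk : R * √E = K * E ^ r := by
    rw [hR, hRK E hE0, mul_assoc, Real.sqrt_eq_rpow, ← Real.rpow_add hE0]
    congr 2
    rw [hp, hr]
    field_simp
    ring
  set N := ⌊R * √E / 8⌋₊ with hN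
  have hRk8 : 1 ≤ R * √E / 8 := by
    rw [hRk]
    linarith
  have hN1 : (1 : ℝ) ≤ N := by
    exact_mod_cast Nat.le_floor (by simpa using hRk8)
  have hNlt : R * √E / 8 < N + 1 := Nat.lt_floor_add_one _
  have hNle : (N : ℝ) ≤ R * √E / 8 := Nat.floor_le (by linarith)
  have hend : R / 2 + N * (4 / √E) ≤ R := by
    have h := mul_le_mul_of_nonneg_right hNle (show 0 ≤ 4 / √E by positivity)
    have h' : R * √E / 8 * (4 / √E) = R / 2 := by
      field_simp
      ring
    linarith
  have hgt : ∀ t ∈ Icc (R / 2) (R / 2 + N * (4 / √E)), max 2 T < t :=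
    fun t ht => by linarith [ht.1]
  obtain ⟨Z, hZ, hZfin, hZcard⟩ := exists_zeros_of_le_neg_sq hk N
    (fun t ht => hu t (hgt t ht)) (fun t ht => hu' t (hgt t ht)) (fun t ht => by
      have ht0 := hgt t ht
      have ht2 : 2 ≤ t := (le_max_left _ _).trans ht0.le
      obtain ⟨h1, h2, h3⟩ := hT t ((le_max_right _ _).trans ht0.le)
      have hlog : 0 ≤ Real.log t ^ (-ε) := Real.rpow_nonneg (Real.log_nonneg (by linarith)) _
      rw [Real.sq_sqrt hE0.le]
      exact potential_le_neg hc hδ2 hE0 hμ0 hμ (by linarith) ht.1 (ht.2.trans hend)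
        ((mul_le_mul_of_nonneg_left ((le_abs_self _).trans (hM₁ t ht2))
          (Real.exp_pos _).le).trans h1)
        ((mul_le_mul_of_nonneg_right (le_abs_self a) hlog).trans h2)
        ((mul_le_mul_of_nonneg_left ((le_abs_self _).trans (hM₂ t ht2))
          (Real.exp_pos _).le).trans h3))
  refine ⟨Z, fun t ht => ⟨hgt t (hZ ht).1, (hZ ht).2⟩, hZfin, ?_⟩
  rw [hZcard]
  linarith
end
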